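/- arXiv:2508.08070 — 6 statements merged into one kernel-verified Lean document; each statement's English description precedes it below -/
import Mathlib

section
/- Let p > 2 and k > 3 be distinct primes and let q = p^r > 3 for some r ≥ 1. Then there exist invertible matrices M_a, M_b, M_c ∈ GL_k(F_q) such that the subgroup of SL_{4k}(F_q) generated by the set {V_a(λ), V_b(λ), V_c(λ) : λ ∈ F_q} is the whole of SL_{4k}(F_q). -/
open Matrix

/-- Assemble a `4 × 4` array of `k × k` blocks into a `4k × 4k` matrix. -/
def blocks4 {k : ℕ} {F : Type*} (B : Matrix (Fin 4) (Fin 4) (Matrix (Fin k) (Fin k) F)) :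
    Matrix (Fin 4 × Fin k) (Fin 4 × Fin k) F :=
  Matrix.of fun p q => B p.1 q.1 p.2 q.2

/-- The matrix `V_a(λ)`. -/
def Va {k : ℕ} {F : Type*} [Field F] (Ma : Matrix (Fin k) (Fin k) F) (l : F) :
    Matrix (Fin 4 × Fin k) (Fin 4 × Fin k) F :=
  blocks4 !![1, 0, 0, l • Ma; 0, 1, l • Ma, 0; 0, 0, 1, 0; 0, 0, 0, 1]

/-- The matrix `V_b(λ)`. -/
def Vb {k : ℕ} {F : Type*} [Field F] (Mb : Matrix (Fin k) (Fin k) F) (l : F) :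
    Matrix (Fin 4 × Fin k) (Fin 4 × Fin k) F :=
  blocks4 !![1, 0, 0, 0; l • Mb, 1, 0, 0; 0, 0, 1, -(l • Mb); 0, 0, 0, 1]

/-- The matrix `V_c(λ)`. -/
def Vc {k : ℕ} {F : Type*} [Field F] (Mc : Matrix (Fin k) (Fin k) F) (l : F) :
    Matrix (Fin 4 × Fin k) (Fin 4 × Fin k) F :=
  blocks4 !![1, 0, 0, 0; 0, 1, 0, 0; 0, 0, 1, 0; 0, l • Mc, 0, 1]

/-- The set `{V_a(λ), V_b(λ), V_c(λ) : λ ∈ F}`, viewed inside `SL_{4k}(F)`. -/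
def genSet {k : ℕ} {F : Type*} [Field F] (Ma Mb Mc : Matrix (Fin k) (Fin k) F) :
    Set (Matrix.SpecialLinearGroup (Fin 4 × Fin k) F) :=
  {g | ∃ l : F,
      (g : Matrix (Fin 4 × Fin k) (Fin 4 × Fin k) F) = Va Ma l ∨
      (g : Matrix (Fin 4 × Fin k) (Fin 4 × Fin k) F) = Vb Mb l ∨
      (g : Matrix (Fin 4 × Fin k) (Fin 4 × Fin k) F) = Vc Mc l}

section RootDirections

variable {n F : Type*} [Fintype n] [DecidableEq n] [Field F]

/-- `N` is a root direction of `G` if `G` contains `1 + t N` for every scalar `t`. -/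
def IsRootDirection (G : Subgroup (SpecialLinearGroup n F)) (N : Matrix n n F) : Prop :=
  ∀ t : F, ∃ g ∈ G, (g : Matrix n n F) = 1 + t • N

namespace IsRootDirection

variable {G : Subgroup (SpecialLinearGroup n F)} {N M A C : Matrix n n F}

theorem zero : IsRootDirection G (0 : Matrix n n F) := fun _ => ⟨1, G.one_mem, by simp⟩

theorem smul (hN : IsRootDirection G N) (c : F) : IsRootDirection G (c • N) := fun t => by
  simpa [smul_smul] using hN (t * c)

theorem neg (hN : IsRootDirection G N) : IsRootDirection G (-N) := by
  simpa using hN.smul (-1)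

theorem of_smul {c : F} (hc : c ≠ 0) (hN : IsRootDirection G (c • N)) : IsRootDirection G N := by
  simpa [smul_smul, hc] using hN.smul c⁻¹

theorem add (hN : IsRootDirection G N) (hM : IsRootDirection G M) (h : N * M = 0) :
    IsRootDirection G (N + M) := fun t => by
  obtain ⟨g, hg, hgN⟩ := hN t
  obtain ⟨k, hk, hkM⟩ := hM t
  refine ⟨g * k, G.mul_mem hg hk, ?_⟩
  change (g : Matrix n n F) * (k : Matrix n n F) = _
  rw [hgN, hkM]
  simp [mul_add, add_mul, h]
  abel

theorem conj (hN : IsRootDirection G N) (hA : IsRootDirection G A) (hAA : A * A = 0) :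
    IsRootDirection G ((1 + A) * N * (1 - A)) := fun t => by
  obtain ⟨g, hg, hgN⟩ := hN t
  obtain ⟨a, ha, haA⟩ := hA 1
  obtain ⟨b, hb, hbA⟩ := hA (-1)
  refine ⟨a * g * b, G.mul_mem (G.mul_mem ha hg) hb, ?_⟩
  have h1 : (1 + A) * (1 - A) = 1 := by
    simp [mul_sub, add_mul, hAA]
  rw [one_smul] at haA
  rw [neg_one_smul, ← sub_eq_add_neg] at hbA
  change (a : Matrix n n F) * (g : Matrix n n F) * (b : Matrix n n F) = _
  rw [hgN, haA, hbA, mul_add, add_mul, mul_one, h1, mul_smul_comm, smul_mul_assoc]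

/-- The two components of the orbit of `N` under conjugation by `1 + t A`. -/
theorem bracket_and_quad (h2 : (2 : F) ≠ 0) (hN : IsRootDirection G N) (hA : IsRootDirection G A)
    (hAA : A * A = 0) (hNN : N * N = 0) (hNAN : N * A * N = 0) :
    IsRootDirection G (A * N - N * A) ∧ IsRootDirection G (A * N * A) := by
  have hp := hN.conj hA hAA
  have hm : IsRootDirection G ((1 - A) * N * (1 + A)) := by
    simpa [← sub_eq_add_neg] using hN.conj hA.neg (by simpa using hAA)
  have hpm : ((1 + A) * N * (1 - A)) * ((1 - A) * N * (1 + A)) = 0 := by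
    have : ((1 + A) * N * (1 - A)) * ((1 - A) * N * (1 + A)) =
        (1 + A) * (N * N - 2 • (N * A * N) + N * (A * A) * N) * (1 + A) := by noncomm_ring
    rw [this, hNN, hNAN, hAA]
    simp
  constructor
  · refine of_smul h2 ?_
    have := hp.add hm.neg (by rw [mul_neg, hpm, neg_zero])
    convert this using 1
    rw [ofNat_smul_eq_nsmul]
    noncomm_ring
  · have hsum : (1 + A) * N * (1 - A) + (1 - A) * N * (1 + A) = 2 • N - 2 • (A * N * A) := by
      noncomm_ring
    have := (hp.add hm hpm).add (hN.smul (-2)) (by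
      rw [hsum, mul_smul_comm, sub_mul, smul_mul_assoc, smul_mul_assoc, hNN,
        show A * N * A * N = A * (N * A * N) by noncomm_ring, hNAN]
      simp)
    rw [hsum] at this
    refine of_smul (neg_ne_zero.2 h2) ?_
    convert this using 1
    module

theorem bracket (h2 : (2 : F) ≠ 0) (hN : IsRootDirection G N) (hA : IsRootDirection G A)
    (hAA : A * A = 0) (hNN : N * N = 0) (hNAN : N * A * N = 0) :
    IsRootDirection G (A * N - N * A) :=
  (bracket_and_quad h2 hN hA hAA hNN hNAN).1

theorem quad (h2 : (2 : F) ≠ 0) (hN : IsRootDirection G N) (hA : IsRootDirection G A)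
    (hAA : A * A = 0) (hNN : N * N = 0) (hNAN : N * A * N = 0) :
    IsRootDirection G (A * N * A) :=
  (bracket_and_quad h2 hN hA hAA hNN hNAN).2

theorem opposite (h2 : (2 : F) ≠ 0) {κ : F} (hN : IsRootDirection G N) (hC : IsRootDirection G C)
    (hCC : C * C = 0) (hNN : N * N = 0) (hNCN : N * C * N = κ • N) :
    IsRootDirection G (C * N * C) := by
  rcases eq_or_ne κ 0 with rfl | hκ
  · exact hN.quad h2 hC hCC hNN (by simpa using hNCN)
  have h := (hN.conj hC hCC).conj (hN.smul (-κ⁻¹)) (by simp [hNN])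
  convert h.neg using 1
  have hN' : N = κ⁻¹ • (N * C * N) := by simp [hNCN, smul_smul, hκ]
  have hl : (1 + (-κ⁻¹) • N) * (1 + C) * N = C * N := by
    have : (1 + (-κ⁻¹) • N) * (1 + C) * N
        = N + C * N + (-κ⁻¹) • (N * N) + (-κ⁻¹) • (N * C * N) := by
      simp only [add_mul, mul_add, one_mul, mul_one, smul_mul_assoc]
      abel
    rw [this, hNN, hNCN, smul_smul]
    simp [hκ]
  have hr : N * (1 - C) * (1 - (-κ⁻¹) • N) = -(N * C) := by
    have : N * (1 - C) * (1 - (-κ⁻¹) • N)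
        = N - N * C - (-κ⁻¹) • (N * N) + (-κ⁻¹) • (N * C * N) := by
      simp only [sub_mul, mul_sub, mul_one, mul_smul_comm, smul_sub]
      abel
    rw [this, hNN, hNCN, smul_smul]
    simp [hκ, sub_add_eq_add_sub]
  have : (1 + (-κ⁻¹) • N) * ((1 + C) * N * (1 - C)) * (1 - (-κ⁻¹) • N)
      = κ⁻¹ • ((1 + (-κ⁻¹) • N) * (1 + C) * N * C * (N * (1 - C) * (1 - (-κ⁻¹) • N))) := by
    conv_lhs => rw [show (1 + C) * N * (1 - C) = (1 + C) * (κ⁻¹ • (N * C * N)) * (1 - C) by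
      rw [← hN']]
    simp only [mul_smul_comm, smul_mul_assoc, mul_assoc]
  rw [this, hl, hr, show C * N * C * -(N * C) = -(C * (N * C * N) * C) by noncomm_ring, hNCN]
  simp [smul_smul, hκ]

end IsRootDirection

theorem diag2n_eq_prod_transvection {i j : n} (hij : i ≠ j) {c : F} (hc : c ≠ 0) :
    SpecialLinearGroup.diag2n hij c hc =
      .transvection hij c * .transvection hij.symm (-c⁻¹) * .transvection hij (c - 1) *
        .transvection hij.symm 1 * .transvection hij (-1) := by
  have hd : (SpecialLinearGroup.diag2n hij c hc : Matrix n n F) =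
      1 + single i i (c - 1) + single j j (c⁻¹ - 1) := by
    change diagonal (fun k ↦ if k = i then c else if k = j then c⁻¹ else 1) = _
    ext a b
    simp only [diagonal_apply, Matrix.add_apply, one_apply, single_apply]
    grind
  apply Subtype.ext
  refine hd.trans ?_
  change _ = transvection i j c * transvection j i (-c⁻¹) * transvection i j (c - 1) *
    transvection j i 1 * transvection i j (-1)
  simp only [transvection, mul_add, add_mul, mul_one, one_mul, single_mul_single_same,
    single_mul_single_of_ne _ _ _ _ hij, single_mul_single_of_ne _ _ _ _ hij.symm]
  ext a b
  simp only [Matrix.add_apply, one_apply, single_apply, Matrix.zero_apply]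
  by_cases hai : i = a <;> by_cases hbi : i = b <;> by_cases haj : j = a <;>
    by_cases hbj : j = b <;> simp_all <;> field_simp <;> ring

theorem eq_top_of_forall_isRootDirection_single [Nontrivial n]
    {G : Subgroup (SpecialLinearGroup n F)}
    (h : ∀ i j, i ≠ j → IsRootDirection G (single i j 1)) : G = ⊤ := by
  have ht : ∀ (i j : n) (hij : i ≠ j) (a : F), SpecialLinearGroup.transvection hij a ∈ G := by
    intro i j hij a
    obtain ⟨g, hg, hga⟩ := h i j hij a
    convert hg
    apply Subtype.ext
    rw [hga, SpecialLinearGroup.transvection_coe, smul_single, smul_eq_mul, mul_one]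
  refine (Subgroup.eq_top_iff' G).2 fun g =>
    SpecialLinearGroup.diagonal_transvection_induction' (· ∈ G) g (fun i j hij c hc => ?_) ht
      fun _ _ => G.mul_mem
  rw [diag2n_eq_prod_transvection]
  exact G.mul_mem (G.mul_mem (G.mul_mem (G.mul_mem (ht _ _ _ _) (ht _ _ _ _)) (ht _ _ _ _))
    (ht _ _ _ _)) (ht _ _ _ _)

end RootDirections

section TwistedClosure

variable {k : ℕ} {F : Type*} [Field F]

/-- The invertible matrix with ones on the subdiagonal and in the first row, except for the corner
entry. -/
def hessenbergMatrix (k : ℕ) (F : Type*) [Field F] : Matrix (Fin k) (Fin k) F :=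
  of fun i j =>
    if i.val = 0 then (if j.val = 0 then 0 else 1) else if i.val = j.val + 1 then 1 else 0

/-- The diagonal matrix `diag(1, -1, …, -1)`. -/
def reflectionMatrix (k : ℕ) (F : Type*) [Field F] : Matrix (Fin k) (Fin k) F :=
  diagonal fun i => if i.val = 0 then 1 else -1

/-- The `n`-th standard basis vector, or zero if `n` is out of range. -/
def stdVec (k : ℕ) (F : Type*) [Field F] (n : ℕ) : Fin k → F :=
  fun i => if i.val = n then 1 else 0

/-- The indicator covector of the positions `1, …, k - 1 - n`. -/
def tailVec (k : ℕ) (F : Type*) [Field F] (n : ℕ) : Fin k → F :=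
  fun i => if 1 ≤ i.val ∧ i.val + n < k then 1 else 0

theorem sum_ite_val_eq (f : Fin k → F) (g : ℕ → F) (n : ℕ) (h : ∀ i : Fin k, i.val = n → f i = g n)
    (h0 : ∀ i : Fin k, i.val ≠ n → f i = 0) :
    ∑ i, f i = if n < k then g n else 0 := by
  split_ifs with hn
  · rw [Finset.sum_eq_single ⟨n, hn⟩ (fun b _ hb => h0 b fun h => hb (Fin.ext h)) (by simp)]
    exact h _ rfl
  · exact Finset.sum_eq_zero fun i _ => h0 i (by omega)

theorem hessenbergMatrix_mulVec_zero : hessenbergMatrix k F *ᵥ stdVec k F 0 = stdVec k F 1 := by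
  ext i
  simp only [mulVec, dotProduct, hessenbergMatrix, stdVec, of_apply]
  rw [sum_ite_val_eq _ (fun _ => if i.val = 1 then 1 else 0) 0]
  · rw [if_pos i.pos]
  · intro j hj
    simp only [hj]
    grind
  · grind

theorem hessenbergMatrix_mulVec_succ (n : ℕ) : hessenbergMatrix k F *ᵥ stdVec k F (n + 1) =
    (if n + 1 < k then (1 : F) else 0) • stdVec k F 0 + stdVec k F (n + 2) := by
  ext i
  simp only [mulVec, dotProduct, hessenbergMatrix, stdVec, of_apply, Pi.add_apply, Pi.smul_apply,
    smul_eq_mul]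
  rw [sum_ite_val_eq _ (fun _ => if i.val = 0 ∨ i.val = n + 2 then 1 else 0) (n + 1)]
  · grind
  · grind
  · grind

theorem vecMul_hessenbergMatrix_zero : stdVec k F 0 ᵥ* hessenbergMatrix k F = tailVec k F 0 := by
  ext j
  simp only [vecMul, dotProduct, hessenbergMatrix, stdVec, of_apply, tailVec]
  rw [sum_ite_val_eq _ (fun _ => if j.val = 0 then 0 else 1) 0]
  · grind
  · grind
  · grind

theorem vecMul_hessenbergMatrix (n : ℕ) : tailVec k F n ᵥ* hessenbergMatrix k F =
    (if n + 1 < k then (1 : F) else 0) • stdVec k F 0 + tailVec k F (n + 1) := by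
  ext j
  simp only [vecMul, dotProduct, hessenbergMatrix, stdVec, of_apply, tailVec, Pi.add_apply,
    Pi.smul_apply, smul_eq_mul]
  rw [sum_ite_val_eq _ (fun _ => if j.val + 1 + n < k then 1 else 0) (j.val + 1)]
  · grind
  · grind
  · grind

theorem reflectionMatrix_mulVec_zero :
    reflectionMatrix k F *ᵥ stdVec k F 0 = stdVec k F 0 := by
  ext i
  simp only [reflectionMatrix, mulVec_diagonal, stdVec]
  grind

theorem reflectionMatrix_mulVec_succ (n : ℕ) :
    reflectionMatrix k F *ᵥ stdVec k F (n + 1) = -stdVec k F (n + 1) := by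
  ext i
  simp only [reflectionMatrix, mulVec_diagonal, stdVec, Pi.neg_apply]
  grind

theorem vecMul_reflectionMatrix_zero :
    stdVec k F 0 ᵥ* reflectionMatrix k F = stdVec k F 0 := by
  ext i
  simp only [reflectionMatrix, vecMul_diagonal, stdVec]
  grind

theorem vecMul_reflectionMatrix_tailVec (n : ℕ) :
    tailVec k F n ᵥ* reflectionMatrix k F = -tailVec k F n := by
  ext i
  simp only [reflectionMatrix, vecMul_diagonal, tailVec, Pi.neg_apply]
  grind

theorem isUnit_hessenbergMatrix (hk : 2 ≤ k) : IsUnit (hessenbergMatrix k F) := by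
  rw [← mulVec_surjective_iff_isUnit]
  let R := LinearMap.range (hessenbergMatrix k F).mulVecLin
  have hR (x : Fin k → F) : hessenbergMatrix k F *ᵥ x ∈ R := ⟨x, rfl⟩
  have h0 : stdVec k F 0 ∈ R := by
    have := hR (stdVec k F (k - 2 + 1))
    rw [hessenbergMatrix_mulVec_succ, if_pos (by omega), one_smul] at this
    convert this
    rw [left_eq_add]
    ext i
    simp only [stdVec, Pi.zero_apply]
    grind
  have hall : ∀ n, stdVec k F n ∈ R
    | 0 => h0
    | 1 => hessenbergMatrix_mulVec_zero (k := k) (F := F) ▸ hR _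
    | n + 2 => by
      have := hR (stdVec k F (n + 1))
      rw [hessenbergMatrix_mulVec_succ] at this
      exact (R.add_mem_iff_right (R.smul_mem _ h0)).1 this
  intro x
  have hx : x = ∑ i : Fin k, x i • stdVec k F i := by
    ext j
    simp [stdVec, Finset.sum_apply, Fin.val_inj]
  obtain ⟨y, hy⟩ : x ∈ R := hx ▸ R.sum_mem fun i _ => R.smul_mem _ (hall i)
  exact ⟨y, hy⟩

theorem eq_top_of_twisted_closed (hk : 3 ≤ k) (h2 : (2 : F) ≠ 0)
    (S : Submodule F (Matrix (Fin k) (Fin k) F))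
    (h0 : vecMulVec (stdVec k F 0) (stdVec k F 0) ∈ S)
    (hr : ∀ M ∈ S, hessenbergMatrix k F * M * (hessenbergMatrix k F * reflectionMatrix k F) ∈ S)
    (hl : ∀ M ∈ S, reflectionMatrix k F * hessenbergMatrix k F * M * hessenbergMatrix k F ∈ S) :
    S = ⊤ := by
  set e := stdVec k F 0 with he
  set u : ℕ → Fin k → F := fun n => stdVec k F (n + 1) with hu
  set v : ℕ → Fin k → F := tailVec k F with hv
  set β : ℕ → F := fun n => if n + 1 < k then 1 else 0 with hβ
  set P := hessenbergMatrix k F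
  set D := reflectionMatrix k F
  have hPe : P *ᵥ e = u 0 := hessenbergMatrix_mulVec_zero
  have hPu n : P *ᵥ u n = β n • e + u (n + 1) := hessenbergMatrix_mulVec_succ n
  have heP : e ᵥ* P = v 0 := vecMul_hessenbergMatrix_zero
  have hvP n : v n ᵥ* P = β n • e + v (n + 1) := vecMul_hessenbergMatrix n
  have hDPe : (D * P) *ᵥ e = -u 0 := by
    rw [← mulVec_mulVec, hPe]
    exact reflectionMatrix_mulVec_succ 0
  have hDPu n : (D * P) *ᵥ u n = β n • e - u (n + 1) := by
    rw [← mulVec_mulVec, hPu, mulVec_add, mulVec_smul, sub_eq_add_neg]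
    exact congr_arg₂ (β n • · + ·) reflectionMatrix_mulVec_zero (reflectionMatrix_mulVec_succ _)
  have hePD : e ᵥ* (P * D) = -v 0 := by
    rw [← vecMul_vecMul, heP]
    exact vecMul_reflectionMatrix_tailVec 0
  have hvPD n : v n ᵥ* (P * D) = β n • e - v (n + 1) := by
    rw [← vecMul_vecMul, hvP, add_vecMul, smul_vecMul, sub_eq_add_neg]
    exact congr_arg₂ (β n • · + ·) vecMul_reflectionMatrix_zero (vecMul_reflectionMatrix_tailVec _)
  have hR x y : P * vecMulVec x y * (P * D) = vecMulVec (P *ᵥ x) (y ᵥ* (P * D)) := by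
    rw [mul_vecMulVec, vecMulVec_mul]
  have hL x y : D * P * vecMulVec x y * P = vecMulVec ((D * P) *ᵥ x) (y ᵥ* P) := by
    rw [mul_vecMulVec, vecMulVec_mul]
  have hβ1 {n : ℕ} (hn : n + 1 < k) : β n = 1 := if_pos hn
  have half {M : Matrix (Fin k) (Fin k) F} (h : (2 : F) • M ∈ S) : M ∈ S :=
    (S.smul_mem_iff h2).1 h
  have step i j (h : vecMulVec (u i) (v j) ∈ S) : vecMulVec (u (i + 1)) (v (j + 1)) ∈ S ∧
      β j • vecMulVec (u (i + 1)) e - β i • vecMulVec e (v (j + 1)) ∈ S := by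
    constructor
    · refine half ?_
      convert S.sub_mem (S.smul_mem (2 * (β i * β j)) h0) (S.add_mem (hr _ h) (hl _ h)) using 1
      simp only [hR, hL, hPu, hvP, hDPu, hvPD, add_vecMulVec, sub_vecMulVec, vecMulVec_add,
        vecMulVec_sub, smul_vecMulVec,
        vecMulVec_smul]
      module
    · refine half ?_
      convert S.sub_mem (hr _ h) (hl _ h) using 1
      simp only [hR, hL, hPu, hvP, hDPu, hvPD, add_vecMulVec, sub_vecMulVec, vecMulVec_add,
        vecMulVec_sub, smul_vecMulVec,
        vecMulVec_smul]
      module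
  have hw00 : vecMulVec (u 0) (v 0) ∈ S := by
    convert S.neg_mem (hr _ h0) using 1
    simp only [hR, hPe, hePD, vecMulVec_neg]
    module
  have hab1 : vecMulVec (u 1) e - vecMulVec e (v 1) ∈ S := by
    simpa [hβ1 (show 0 + 1 < k by omega)] using (step 0 0 hw00).2
  have hadd : vecMulVec (u 0) e + vecMulVec e (v 0) ∈ S := by
    refine half ?_
    convert S.sub_mem (hl _ hab1) (hr _ hab1) using 1
    simp only [Matrix.mul_sub, Matrix.sub_mul, hR, hL, hPe, hPu, heP, hvP, hDPe,
      hDPu, hePD, hvPD, neg_vecMulVec, vecMulVec_neg, add_vecMulVec, sub_vecMulVec, vecMulVec_add,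
      vecMulVec_sub, smul_vecMulVec,
      vecMulVec_smul]
    rw [hβ1 (show 1 + 1 < k by omega)]
    module
  have hsub : vecMulVec (u 0) e - vecMulVec e (v 0) ∈ S := by
    refine half ?_
    convert S.sub_mem (hr _ hadd) (hl _ hadd) using 1
    simp only [Matrix.mul_add, Matrix.add_mul, hR, hL, hPe, hPu, heP, hvP, hDPe,
      hDPu, hePD, hvPD, neg_vecMulVec, vecMulVec_neg, add_vecMulVec, sub_vecMulVec, vecMulVec_add,
      vecMulVec_sub, smul_vecMulVec,
      vecMulVec_smul]
    rw [hβ1 (show 0 + 1 < k by omega)]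
    module
  have ha0 : vecMulVec (u 0) e ∈ S := by
    refine half ?_
    convert S.add_mem hadd hsub using 1
    module
  have hb0 : vecMulVec e (v 0) ∈ S := by
    convert S.sub_mem hadd ha0 using 1
    module
  have hul m (ha : vecMulVec (u m) e ∈ S) : vecMulVec (u (m + 1)) (v 0) ∈ S := by
    convert S.neg_mem (S.add_mem (hr _ ha) (S.smul_mem (β m) hb0)) using 1
    simp only [hR, hPu, hePD, vecMulVec_neg, add_vecMulVec, smul_vecMulVec]
    module
  have hvl m (hb : vecMulVec e (v m) ∈ S) : vecMulVec (u 0) (v (m + 1)) ∈ S := by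
    convert S.sub_mem (S.smul_mem (β m) ha0) (hr _ hb) using 1
    simp only [hR, hPe, hvPD, vecMulVec_sub, vecMulVec_smul]
    module
  have hnear m : vecMulVec (u (m + 1)) (v m) ∈ S ∧ vecMulVec (u m) (v (m + 1)) ∈ S := by
    induction m with
    | zero => exact ⟨hul 0 ha0, hvl 0 hb0⟩
    | succ m ih => exact ⟨(step _ _ ih.1).1, (step _ _ ih.2).1⟩
  have hab d : ∀ n, k ≤ n + 1 + d → vecMulVec (u n) e ∈ S ∧ vecMulVec e (v n) ∈ S := by
    induction d with
    | zero =>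
      intro n hn
      have hun : u n = 0 := by
        ext i
        simp only [hu, stdVec, Pi.zero_apply]
        grind
      have hvn : v n = 0 := by
        ext i
        simp only [hv, tailVec, Pi.zero_apply]
        grind
      simp [hun, hvn]
    | succ d ih =>
      intro n hn
      obtain _ | n := n
      · exact ⟨ha0, hb0⟩
      by_cases hkn : n + 2 < k
      · have h1 := (step _ _ (hnear n).1).2
        have h2 := (step _ _ (hnear n).2).2
        rw [hβ1 (show n + 1 < k by omega), hβ1 hkn, one_smul, one_smul] at h1 h2
        obtain ⟨ha, hb⟩ := ih (n + 2) (by omega)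
        exact ⟨(S.sub_mem_iff_left hb).1 h2, (S.sub_mem_iff_right ha).1 h1⟩
      · exact ih _ (by omega)
  have ha n : vecMulVec (u n) e ∈ S := (hab k n (by omega)).1
  have hb n : vecMulVec e (v n) ∈ S := (hab k n (by omega)).2
  have huv i : ∀ j, vecMulVec (u i) (v j) ∈ S := by
    induction i with
    | zero =>
      rintro (_ | j)
      exacts [hw00, hvl j (hb j)]
    | succ i ih =>
      rintro (_ | j)
      exacts [hul i (ha i), (step i j (ih j)).1]
  have hstd_tail : ∀ i j, vecMulVec (stdVec k F i) (v j) ∈ S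
    | 0, j => hb j
    | i + 1, j => huv i j
  have hstd_zero : ∀ i, vecMulVec (stdVec k F i) e ∈ S
    | 0 => h0
    | i + 1 => ha i
  have hstd i (j : Fin k) : vecMulVec (stdVec k F i) (stdVec k F j) ∈ S := by
    rcases Nat.eq_zero_or_pos j.val with hj | hj
    · exact hj ▸ hstd_zero i
    · have : stdVec k F j = v (k - 1 - j) - v (k - j) := by
        ext l
        simp only [hv, stdVec, tailVec, Pi.sub_apply]
        grind
      rw [this, vecMulVec_sub]
      exact S.sub_mem (hstd_tail _ _) (hstd_tail _ _)
  refine (Submodule.eq_top_iff').2 fun M => ?_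
  rw [matrix_eq_sum_single M]
  refine S.sum_mem fun i _ => S.sum_mem fun j _ => ?_
  convert S.smul_mem (M i j) (hstd i j) using 1
  ext a b
  simp only [single_apply, Matrix.smul_apply, vecMulVec_apply, stdVec, smul_eq_mul]
  grind

end TwistedClosure

section BlockSingle

variable {ι m F : Type*} [DecidableEq ι] [Field F]

/-- The block matrix with block `M` in position `(i, j)` and zeros elsewhere. -/
def blockSingle (i j : ι) (M : Matrix m m F) : Matrix (ι × m) (ι × m) F :=
  kroneckerMap (· * ·) (single i j 1) M

theorem blockSingle_apply (i j : ι) (M : Matrix m m F) (x y : ι × m) :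
    blockSingle i j M x y = if i = x.1 ∧ j = y.1 then M x.2 y.2 else 0 := by
  simp [blockSingle, single_apply]

theorem blockSingle_single [DecidableEq m] (i j : ι) (s t : m) (c : F) :
    blockSingle i j (single s t c) = single (i, s) (j, t) c := by
  ext x y
  simp only [blockSingle_apply, single_apply]
  grind

theorem blockSingle_zero (i j : ι) : blockSingle i j (0 : Matrix m m F) = 0 := by
  ext
  simp [blockSingle_apply]

theorem blockSingle_add (i j : ι) (M N : Matrix m m F) :
    blockSingle i j (M + N) = blockSingle i j M + blockSingle i j N :=
  kronecker_add _ _ _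

theorem blockSingle_smul (i j : ι) (c : F) (M : Matrix m m F) :
    blockSingle i j (c • M) = c • blockSingle i j M :=
  kronecker_smul _ _ _

theorem blockSingle_neg (i j : ι) (M : Matrix m m F) :
    blockSingle i j (-M) = -blockSingle i j M := by
  simpa using blockSingle_smul i j (-1) M

theorem blockSingle_mul_blockSingle [Fintype ι] [Fintype m] (i j j' l : ι) (M N : Matrix m m F) :
    blockSingle i j M * blockSingle j' l N =
      if j = j' then blockSingle i l (M * N) else 0 := by
  rw [blockSingle, blockSingle, ← mul_kronecker_mul]
  split_ifs with h
  · subst h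
    rw [single_mul_single_same, one_mul, blockSingle]
  · rw [single_mul_single_of_ne _ _ _ _ h, zero_kronecker]

variable [Fintype ι] [Fintype m] [DecidableEq m]

/-- The block matrices `M` such that `blockSingle i j M` is a root direction of `G`. -/
def blockDirections (G : Subgroup (SpecialLinearGroup (ι × m) F)) {i j : ι} (hij : i ≠ j) :
    Submodule F (Matrix m m F) where
  carrier := {M | IsRootDirection G (blockSingle i j M)}
  add_mem' hM hN := by
    rw [Set.mem_ofPred_eq, blockSingle_add]
    exact IsRootDirection.add hM hN (by simp [blockSingle_mul_blockSingle, hij.symm])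
  zero_mem' := by
    rw [Set.mem_ofPred_eq, blockSingle_zero]
    exact IsRootDirection.zero
  smul_mem' c M hM := by
    rw [Set.mem_ofPred_eq, blockSingle_smul]
    exact IsRootDirection.smul hM c

variable {G : Subgroup (SpecialLinearGroup (ι × m) F)} {i j l : ι} {M N : Matrix m m F}

theorem mem_blockDirections {hij : i ≠ j} :
    M ∈ blockDirections G hij ↔ IsRootDirection G (blockSingle i j M) := Iff.rfl

theorem mul_mem_blockDirections (h2 : (2 : F) ≠ 0) {hij : i ≠ j} {hjl : j ≠ l} {hil : i ≠ l}
    (hM : M ∈ blockDirections G hij) (hN : N ∈ blockDirections G hjl) :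
    M * N ∈ blockDirections G hil := by
  have := IsRootDirection.bracket h2 hN hM (by simp [blockSingle_mul_blockSingle, hij.symm])
    (by simp [blockSingle_mul_blockSingle, hjl.symm])
    (by simp [blockSingle_mul_blockSingle, hil.symm])
  simpa [mem_blockDirections, blockSingle_mul_blockSingle, hil.symm] using this

theorem blockDirections_eq_top_of_right (h2 : (2 : F) ≠ 0) {hij : i ≠ j} {hjl : j ≠ l}
    (hil : i ≠ l) (hM : blockDirections G hij = ⊤) (hN : N ∈ blockDirections G hjl)
    (hNu : IsUnit N) : blockDirections G hil = ⊤ := by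
  obtain ⟨N, rfl⟩ := hNu
  refine Submodule.eq_top_iff'.2 fun M => ?_
  have := mul_mem_blockDirections h2 (hil := hil)
    (show M * (↑N⁻¹ : Matrix m m F) ∈ blockDirections G hij from hM ▸ Submodule.mem_top) hN
  simpa [mul_assoc] using this

theorem blockDirections_eq_top_of_left (h2 : (2 : F) ≠ 0) {hij : i ≠ j} {hjl : j ≠ l}
    (hil : i ≠ l) (hM : M ∈ blockDirections G hij) (hMu : IsUnit M)
    (hN : blockDirections G hjl = ⊤) : blockDirections G hil = ⊤ := by
  obtain ⟨M, rfl⟩ := hMu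
  refine Submodule.eq_top_iff'.2 fun N => ?_
  have := mul_mem_blockDirections h2 (hil := hil) hM
    (show (↑M⁻¹ : Matrix m m F) * N ∈ blockDirections G hjl from hN ▸ Submodule.mem_top)
  simpa [← mul_assoc] using this

theorem blockDirections_eq_top_trans (h2 : (2 : F) ≠ 0) {hij : i ≠ j} {hjl : j ≠ l}
    (hil : i ≠ l) (hM : blockDirections G hij = ⊤) (hN : blockDirections G hjl = ⊤) :
    blockDirections G hil = ⊤ :=
  blockDirections_eq_top_of_right h2 hil hM (N := 1) (hN ▸ Submodule.mem_top) isUnit_one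

theorem submodule_eq_top_of_forall_single {S : Submodule F (Matrix m m F)}
    (h : ∀ s t, single s t 1 ∈ S) : S = ⊤ := by
  refine Submodule.eq_top_iff'.2 fun M => ?_
  rw [matrix_eq_sum_single M]
  refine S.sum_mem fun s _ => S.sum_mem fun t _ => ?_
  simpa [smul_single] using S.smul_mem (M s t) (h s t)

theorem eq_top_of_forall_blockDirections [Nontrivial ι] [Nonempty m] (h2 : (2 : F) ≠ 0)
    (h : ∀ {i j : ι} (hij : i ≠ j), blockDirections G hij = ⊤) : G = ⊤ := by
  have hmem {i j : ι} (hij : i ≠ j) (M : Matrix m m F) : IsRootDirection G (blockSingle i j M) := by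
    rw [← mem_blockDirections (hij := hij), h hij]
    exact Submodule.mem_top
  refine eq_top_of_forall_isRootDirection_single fun ⟨i, s⟩ ⟨j, t⟩ hst => ?_
  rw [← blockSingle_single]
  rcases ne_or_eq i j with hij | rfl
  · exact hmem hij _
  have hst : s ≠ t := fun h => hst (h ▸ rfl)
  obtain ⟨j, hji⟩ := exists_ne i
  have := (hmem hji (single s t 1)).bracket h2 (hmem hji.symm (single s s 1))
    (by simp [blockSingle_mul_blockSingle, hji])
    (by simp [blockSingle_mul_blockSingle, hji.symm])
    (by simp [blockSingle_mul_blockSingle, blockSingle_zero, hst.symm])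
  simpa [blockSingle_mul_blockSingle, blockSingle_zero, hst.symm] using this

theorem opposite_mem_blockDirections (h2 : (2 : F) ≠ 0) {hij : i ≠ j} {hji : j ≠ i}
    {C : Matrix m m F} (hC : C ∈ blockDirections G hji) {u v : m → F}
    (h : vecMulVec u v ∈ blockDirections G hij) :
    C * vecMulVec u v * C ∈ blockDirections G hji := by
  have := IsRootDirection.opposite h2 (κ := v ⬝ᵥ C *ᵥ u) h hC
    (by simp [blockSingle_mul_blockSingle, hij]) (by simp [blockSingle_mul_blockSingle, hji]) (by
      simp only [blockSingle_mul_blockSingle, if_true, ← blockSingle_smul]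
      congr 1
      rw [vecMulVec_mul, vecMulVec_mul_vecMulVec, dotProduct_mulVec, vecMulVec_smul])
  simpa [mem_blockDirections, blockSingle_mul_blockSingle] using this

end BlockSingle

section Generation

variable {k : ℕ} {F : Type*} [Field F] {G : Subgroup (SpecialLinearGroup (Fin 4 × Fin k) F)}
  {Ma Mb Mc : Matrix (Fin k) (Fin k) F}

theorem add_mul_mem_blockDirections_one_three (h2 : (2 : F) ≠ 0)
    (hA : IsRootDirection G (blockSingle 0 3 Ma + blockSingle 1 2 Ma))
    (hB : IsRootDirection G (blockSingle 1 0 Mb - blockSingle 2 3 Mb)) :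
    Ma * Mb + Mb * Ma ∈ blockDirections G (show (1 : Fin 4) ≠ 3 by decide) := by
  have := (hB.bracket h2 hA (by simp [add_mul, mul_add, blockSingle_mul_blockSingle])
    (by simp [sub_mul, mul_sub, blockSingle_mul_blockSingle])
    (by simp [mul_add, sub_mul, mul_sub, blockSingle_mul_blockSingle])).neg
  rw [mem_blockDirections, add_comm, blockSingle_add]
  simpa [add_mul, mul_add, sub_mul, mul_sub, blockSingle_mul_blockSingle] using this

theorem mul_mul_mem_blockDirections_zero_two (h2 : (2 : F) ≠ 0)
    (hA : IsRootDirection G (blockSingle 0 3 Ma + blockSingle 1 2 Ma))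
    {M : Matrix (Fin k) (Fin k) F}
    (hM : M ∈ blockDirections G (show (3 : Fin 4) ≠ 1 by decide)) :
    Ma * M * Ma ∈ blockDirections G (show (0 : Fin 4) ≠ 2 by decide) := by
  have := (mem_blockDirections.1 hM).quad h2 hA
    (by simp [add_mul, mul_add, blockSingle_mul_blockSingle])
    (by simp [blockSingle_mul_blockSingle])
    (by simp [mul_add, blockSingle_mul_blockSingle])
  simpa [mem_blockDirections, add_mul, mul_add, blockSingle_mul_blockSingle] using this

theorem mul_mul_mem_blockDirections_one_three (h2 : (2 : F) ≠ 0)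
    (hA : IsRootDirection G (blockSingle 0 3 Ma + blockSingle 1 2 Ma))
    {M : Matrix (Fin k) (Fin k) F}
    (hM : M ∈ blockDirections G (show (2 : Fin 4) ≠ 0 by decide)) :
    Ma * M * Ma ∈ blockDirections G (show (1 : Fin 4) ≠ 3 by decide) := by
  have := (mem_blockDirections.1 hM).quad h2 hA
    (by simp [add_mul, mul_add, blockSingle_mul_blockSingle])
    (by simp [blockSingle_mul_blockSingle])
    (by simp [mul_add, blockSingle_mul_blockSingle])
  simpa [mem_blockDirections, add_mul, mul_add, blockSingle_mul_blockSingle] using this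

theorem mul_mul_mem_blockDirections_two_zero (h2 : (2 : F) ≠ 0)
    (hB : IsRootDirection G (blockSingle 1 0 Mb - blockSingle 2 3 Mb))
    {M : Matrix (Fin k) (Fin k) F}
    (hM : M ∈ blockDirections G (show (3 : Fin 4) ≠ 1 by decide)) :
    Mb * M * Mb ∈ blockDirections G (show (2 : Fin 4) ≠ 0 by decide) := by
  have := ((mem_blockDirections.1 hM).quad h2 hB
    (by simp [sub_mul, mul_sub, blockSingle_mul_blockSingle])
    (by simp [blockSingle_mul_blockSingle])
    (by simp [mul_sub, blockSingle_mul_blockSingle])).neg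
  simpa [mem_blockDirections, sub_mul, mul_sub, blockSingle_mul_blockSingle] using this

theorem mul_mul_mem_blockDirections_one_three' (h2 : (2 : F) ≠ 0)
    (hB : IsRootDirection G (blockSingle 1 0 Mb - blockSingle 2 3 Mb))
    {M : Matrix (Fin k) (Fin k) F}
    (hM : M ∈ blockDirections G (show (0 : Fin 4) ≠ 2 by decide)) :
    Mb * M * Mb ∈ blockDirections G (show (1 : Fin 4) ≠ 3 by decide) := by
  have := ((mem_blockDirections.1 hM).quad h2 hB
    (by simp [sub_mul, mul_sub, blockSingle_mul_blockSingle])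
    (by simp [blockSingle_mul_blockSingle])
    (by simp [mul_sub, blockSingle_mul_blockSingle])).neg
  simpa [mem_blockDirections, sub_mul, mul_sub, blockSingle_mul_blockSingle] using this

theorem reflectionMatrix_add_one :
    reflectionMatrix k F + 1 = (2 : F) • vecMulVec (stdVec k F 0) (stdVec k F 0) := by
  ext i j
  simp only [reflectionMatrix, Matrix.add_apply, diagonal_apply, one_apply, Matrix.smul_apply,
    vecMulVec_apply, stdVec, smul_eq_mul]
  grind

theorem blockDirections_one_three_eq_top (hk : 3 ≤ k) (h2 : (2 : F) ≠ 0)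
    (hJ : IsUnit (Mb * Ma)) (hD : Ma * Mb = reflectionMatrix k F * (Mb * Ma))
    (hP : Mb * Ma * Mc = hessenbergMatrix k F)
    (hA : IsRootDirection G (blockSingle 0 3 Ma + blockSingle 1 2 Ma))
    (hB : IsRootDirection G (blockSingle 1 0 Mb - blockSingle 2 3 Mb))
    (hC : Mc ∈ blockDirections G (show (3 : Fin 4) ≠ 1 by decide)) :
    blockDirections G (show (1 : Fin 4) ≠ 3 by decide) = ⊤ := by
  set S := blockDirections G (show (1 : Fin 4) ≠ 3 by decide)
  set T : Submodule F (Matrix (Fin k) (Fin k) F) :=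
    Submodule.span F {M | M ∈ S ∧ ∃ u v, M = vecMulVec u v} with hT
  have hTS : T ≤ S := Submodule.span_le.2 fun M hM => hM.1
  have hclosed (X Y : Matrix (Fin k) (Fin k) F)
      (hXY : ∀ u v, vecMulVec u v ∈ S → X * (Mc * vecMulVec u v * Mc) * Y ∈ S) :
      ∀ M ∈ T, X * (Mc * M * Mc) * Y ∈ T := by
    intro M hM
    induction hM using Submodule.span_induction with
    | mem M hM =>
      obtain ⟨hM, u, v, rfl⟩ := hM
      refine Submodule.subset_span ⟨hXY u v hM, X *ᵥ Mc *ᵥ u, v ᵥ* Mc ᵥ* Y, ?_⟩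
      simp only [mul_vecMulVec, vecMulVec_mul]
    | zero => simp
    | add M N _ _ hM hN =>
      rw [Matrix.mul_add, Matrix.add_mul, Matrix.mul_add, Matrix.add_mul]
      exact T.add_mem hM hN
    | smul c M _ hM =>
      rw [Matrix.mul_smul, Matrix.smul_mul, Matrix.mul_smul, Matrix.smul_mul]
      exact T.smul_mem c hM
  have htop : T.comap (LinearMap.mulRight F (Mb * Ma)) = ⊤ := by
    refine eq_top_of_twisted_closed hk h2 _ ?_ ?_ ?_
    · rw [Submodule.mem_comap, LinearMap.mulRight_apply]
      refine Submodule.subset_span ⟨?_, _, _, vecMulVec_mul _ _ _⟩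
      have := add_mul_mem_blockDirections_one_three h2 hA hB
      rw [hD, ← add_one_mul, reflectionMatrix_add_one, smul_mul_assoc] at this
      exact (S.smul_mem_iff h2).1 this
    · intro M hM
      have := hclosed (Mb * Ma) (Ma * Mb) (fun u v h => by
        simpa only [Matrix.mul_assoc] using mul_mul_mem_blockDirections_one_three' h2 hB
          (mul_mul_mem_blockDirections_zero_two h2 hA (opposite_mem_blockDirections h2 hC h))) _ hM
      rw [Submodule.mem_comap, LinearMap.mulRight_apply]
      convert this using 1
      rw [LinearMap.mulRight_apply, hD, ← hP]
      simp only [Matrix.mul_assoc]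
    · intro M hM
      have := hclosed (Ma * Mb) (Mb * Ma) (fun u v h => by
        simpa only [Matrix.mul_assoc] using mul_mul_mem_blockDirections_one_three h2 hA
          (mul_mul_mem_blockDirections_two_zero h2 hB (opposite_mem_blockDirections h2 hC h))) _ hM
      rw [Submodule.mem_comap, LinearMap.mulRight_apply]
      convert this using 1
      rw [LinearMap.mulRight_apply, hD, ← hP]
      simp only [Matrix.mul_assoc]
  refine Submodule.eq_top_iff'.2 fun M => hTS ?_
  obtain ⟨J, hJ⟩ := hJ
  have : M * (↑J⁻¹ : Matrix (Fin k) (Fin k) F) ∈ T.comap (LinearMap.mulRight F (Mb * Ma)) :=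
    htop ▸ Submodule.mem_top
  rw [Submodule.mem_comap, LinearMap.mulRight_apply, ← hJ] at this
  simpa [mul_assoc] using this

theorem submodule_eq_top_of_forall_mul_mul_mem {S : Submodule F (Matrix (Fin k) (Fin k) F)}
    {X : Matrix (Fin k) (Fin k) F} (hX : IsUnit X) (h : ∀ M, X * M * X ∈ S) : S = ⊤ := by
  obtain ⟨X, rfl⟩ := hX
  refine Submodule.eq_top_iff'.2 fun M => ?_
  simpa [mul_assoc] using
    h ((↑X⁻¹ : Matrix (Fin k) (Fin k) F) * M * (↑X⁻¹ : Matrix (Fin k) (Fin k) F))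

theorem single_mem_blockDirections_zero_three (h2 : (2 : F) ≠ 0)
    (hA : IsRootDirection G (blockSingle 0 3 Ma + blockSingle 1 2 Ma))
    (h13 : blockDirections G (show (1 : Fin 4) ≠ 3 by decide) = ⊤)
    (h31 : blockDirections G (show (3 : Fin 4) ≠ 1 by decide) = ⊤) {s t : Fin k} (hst : s ≠ t) :
    Ma * single s t 1 ∈ blockDirections G (show (0 : Fin 4) ≠ 3 by decide) := by
  have hN : single s s 1 ∈ blockDirections G (show (3 : Fin 4) ≠ 1 by decide) :=
    h31 ▸ Submodule.mem_top
  have hN' : single s t 1 ∈ blockDirections G (show (1 : Fin 4) ≠ 3 by decide) :=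
    h13 ▸ Submodule.mem_top
  have h := (mem_blockDirections.1 hN).bracket h2 hA
    (by simp [add_mul, mul_add, blockSingle_mul_blockSingle])
    (by simp [blockSingle_mul_blockSingle])
    (by simp [mul_add, blockSingle_mul_blockSingle])
  have h' := (mem_blockDirections.1 hN').bracket h2 h
    (by simp [add_mul, mul_add, sub_mul, mul_sub, blockSingle_mul_blockSingle])
    (by simp [blockSingle_mul_blockSingle])
    (by simp [add_mul, mul_add, mul_sub, blockSingle_mul_blockSingle])
  simpa [mem_blockDirections, add_mul, mul_add, sub_mul, mul_sub, blockSingle_mul_blockSingle,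
    ← mul_assoc, hst.symm, Matrix.mul_assoc, blockSingle_zero] using h'

theorem blockDirections_two_one_eq_top (h2 : (2 : F) ≠ 0) (hMa : IsUnit Ma) {s t : Fin k}
    (hst : Ma * single s t 1 ∈ blockDirections G (show (0 : Fin 4) ≠ 3 by decide))
    (h20 : blockDirections G (show (2 : Fin 4) ≠ 0 by decide) = ⊤)
    (h31 : blockDirections G (show (3 : Fin 4) ≠ 1 by decide) = ⊤) :
    blockDirections G (show (2 : Fin 4) ≠ 1 by decide) = ⊤ := by
  obtain ⟨Ma, rfl⟩ := hMa
  refine submodule_eq_top_of_forall_single fun a b => ?_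
  have h := mul_mem_blockDirections h2 (hil := (show (2 : Fin 4) ≠ 1 by decide))
    (mul_mem_blockDirections h2 (hil := (show (2 : Fin 4) ≠ 3 by decide))
      (show single a s 1 * (↑Ma⁻¹ : Matrix (Fin k) (Fin k) F) ∈ blockDirections G _ from
        h20 ▸ Submodule.mem_top) hst)
    (show single t b 1 ∈ blockDirections G _ from h31 ▸ Submodule.mem_top)
  simpa [Matrix.mul_assoc] using h

theorem eq_top_of_isRootDirection (hk : 3 ≤ k) (h2 : (2 : F) ≠ 0)
    (hMa : IsUnit Ma) (hMb : IsUnit Mb) (hMc : IsUnit Mc)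
    (hD : Ma * Mb = reflectionMatrix k F * (Mb * Ma))
    (hP : Mb * Ma * Mc = hessenbergMatrix k F)
    (hA : IsRootDirection G (blockSingle 0 3 Ma + blockSingle 1 2 Ma))
    (hB : IsRootDirection G (blockSingle 1 0 Mb - blockSingle 2 3 Mb))
    (hC : IsRootDirection G (blockSingle 3 1 Mc)) : G = ⊤ := by
  have hC : Mc ∈ blockDirections G (show (3 : Fin 4) ≠ 1 by decide) := hC
  have h13 := blockDirections_one_three_eq_top hk h2 (hMb.mul hMa) hD hP hA hB hC
  have h31 : blockDirections G (show (3 : Fin 4) ≠ 1 by decide) = ⊤ := by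
    have : (blockDirections G (show (3 : Fin 4) ≠ 1 by decide)).comap
        (LinearMap.mulLeftRight F (Mc, Mc)) = ⊤ := by
      refine submodule_eq_top_of_forall_single fun s t => ?_
      rw [Submodule.mem_comap, LinearMap.mulLeftRight_apply, single_eq_single_vecMulVec_single]
      exact opposite_mem_blockDirections h2 hC
        (show _ ∈ blockDirections G (show (1 : Fin 4) ≠ 3 by decide) from h13 ▸ Submodule.mem_top)
    refine submodule_eq_top_of_forall_mul_mul_mem hMc fun M => ?_
    rw [← LinearMap.mulLeftRight_apply (R := F), ← Submodule.mem_comap, this]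
    exact Submodule.mem_top
  have h02 : blockDirections G (show (0 : Fin 4) ≠ 2 by decide) = ⊤ :=
    submodule_eq_top_of_forall_mul_mul_mem hMa fun M =>
      mul_mul_mem_blockDirections_zero_two h2 hA (h31 ▸ Submodule.mem_top)
  have h20 : blockDirections G (show (2 : Fin 4) ≠ 0 by decide) = ⊤ :=
    submodule_eq_top_of_forall_mul_mul_mem hMb fun M =>
      mul_mul_mem_blockDirections_two_zero h2 hB (h31 ▸ Submodule.mem_top)
  have h21 := blockDirections_two_one_eq_top h2 hMa
    (single_mem_blockDirections_zero_three h2 hA h13 h31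
      (show (⟨0, by omega⟩ : Fin k) ≠ ⟨1, by omega⟩ by simp)) h20 h31
  have h01 := blockDirections_eq_top_trans h2 (show (0 : Fin 4) ≠ 1 by decide) h02 h21
  have h03 := blockDirections_eq_top_trans h2 (show (0 : Fin 4) ≠ 3 by decide) h01 h13
  have h23 := blockDirections_eq_top_trans h2 (show (2 : Fin 4) ≠ 3 by decide) h21 h13
  have hMa12 : Ma ∈ blockDirections G (show (1 : Fin 4) ≠ 2 by decide) := by
    have hMa03 : -Ma ∈ blockDirections G (show (0 : Fin 4) ≠ 3 by decide) :=
      h03 ▸ Submodule.mem_top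
    have := hA.add hMa03 (by simp [add_mul, blockSingle_mul_blockSingle])
    simpa [mem_blockDirections, blockSingle_neg] using this
  have h32 := blockDirections_eq_top_of_right h2 (show (3 : Fin 4) ≠ 2 by decide) h31 hMa12 hMa
  have h10 := blockDirections_eq_top_of_left h2 (show (1 : Fin 4) ≠ 0 by decide) hMa12 hMa h20
  have h30 := blockDirections_eq_top_trans h2 (show (3 : Fin 4) ≠ 0 by decide) h32 h20
  have h12 := blockDirections_eq_top_trans h2 (show (1 : Fin 4) ≠ 2 by decide) h10 h02
  have : Nonempty (Fin k) := ⟨⟨0, by omega⟩⟩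
  refine eq_top_of_forall_blockDirections h2 fun {i j} hij => ?_
  fin_cases i <;> fin_cases j <;> first | exact absurd rfl hij | assumption

theorem det_one_add_of_mul_self_eq_zero {n : Type*} [Fintype n] [DecidableEq n] {N : Matrix n n F}
    (hN : N * N = 0) : (1 + N).det = 1 := by
  have hnil : IsNilpotent (-N) := ⟨2, by rw [sq, neg_mul_neg, hN]⟩
  have h := (isNilpotent_charpoly_sub_pow_of_isNilpotent hnil).eq_zero
  have := eval_charpoly (-N) 1
  rw [sub_eq_zero.1 h] at this
  simpa using this.symm

theorem Va_eq (Ma : Matrix (Fin k) (Fin k) F) (l : F) :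
    Va Ma l = 1 + l • (blockSingle 0 3 Ma + blockSingle 1 2 Ma) := by
  ext ⟨i, s⟩ ⟨j, t⟩
  revert i j
  simp [Fin.forall_fin_succ, Va, blocks4, blockSingle_apply, one_apply]

theorem Vb_eq (Mb : Matrix (Fin k) (Fin k) F) (l : F) :
    Vb Mb l = 1 + l • (blockSingle 1 0 Mb - blockSingle 2 3 Mb) := by
  ext ⟨i, s⟩ ⟨j, t⟩
  revert i j
  simp [Fin.forall_fin_succ, Vb, blocks4, blockSingle_apply, one_apply]

theorem Vc_eq (Mc : Matrix (Fin k) (Fin k) F) (l : F) :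
    Vc Mc l = 1 + l • blockSingle 3 1 Mc := by
  ext ⟨i, s⟩ ⟨j, t⟩
  revert i j
  simp [Fin.forall_fin_succ, Vc, blocks4, blockSingle_apply, one_apply]

theorem isRootDirection_closure {n : Type*} [Fintype n] [DecidableEq n]
    {s : Set (SpecialLinearGroup n F)} {N : Matrix n n F} (hN : N * N = 0)
    (hs : ∀ g : SpecialLinearGroup n F, (∃ t : F, (g : Matrix n n F) = 1 + t • N) → g ∈ s) :
    IsRootDirection (Subgroup.closure s) N := fun t =>
  ⟨⟨1 + t • N, det_one_add_of_mul_self_eq_zero (by simp [hN])⟩,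
    Subgroup.subset_closure (hs _ ⟨t, rfl⟩), rfl⟩

theorem closure_genSet_eq_top (hk : 3 ≤ k) (h2 : (2 : F) ≠ 0)
    (hMa : IsUnit Ma) (hMb : IsUnit Mb) (hMc : IsUnit Mc)
    (hD : Ma * Mb = reflectionMatrix k F * (Mb * Ma))
    (hP : Mb * Ma * Mc = hessenbergMatrix k F) :
    Subgroup.closure (genSet Ma Mb Mc) = ⊤ := by
  refine eq_top_of_isRootDirection hk h2 hMa hMb hMc hD hP ?_ ?_ ?_
  · refine isRootDirection_closure
      (by simp [add_mul, mul_add, blockSingle_mul_blockSingle]) fun g ⟨t, ht⟩ => ⟨t, .inl ?_⟩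
    rw [ht, Va_eq]
  · refine isRootDirection_closure
      (by simp [sub_mul, mul_sub, blockSingle_mul_blockSingle]) fun g ⟨t, ht⟩ => ⟨t, .inr (.inl ?_)⟩
    rw [ht, Vb_eq]
  · refine isRootDirection_closure
      (by simp [blockSingle_mul_blockSingle]) fun g ⟨t, ht⟩ => ⟨t, .inr (.inr ?_)⟩
    rw [ht, Vc_eq]

theorem exists_isUnit_mul_eq_reflectionMatrix_mul (hk : Odd k) :
    ∃ Ma Mb : Matrix (Fin k) (Fin k) F, IsUnit Ma ∧ IsUnit Mb ∧
      Ma * Mb = reflectionMatrix k F * (Mb * Ma) := by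
  obtain ⟨n, rfl⟩ : ∃ n, k = n + 1 := ⟨k - 1, (Nat.sub_add_cancel hk.pos).symm⟩
  have hn : Even n := by simpa [Nat.odd_add_one] using hk
  refine ⟨Equiv.Perm.permMatrix F (finRotate (n + 1)).symm, diagonal fun i => (-1) ^ i.val,
    ?_, ?_, ?_⟩
  · rw [isUnit_iff_isUnit_det, det_permutation]
    exact (Equiv.Perm.sign _).isUnit.map (Int.castRingHom F)
  · rw [isUnit_iff_isUnit_det, det_diagonal]
    exact IsUnit.prod_univ_iff.2 fun i => isUnit_one.neg.pow _
  · ext i j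
    obtain ⟨i, rfl⟩ := (finRotate (n + 1)).surjective i
    rw [reflectionMatrix, mul_diagonal, diagonal_mul, diagonal_mul, Equiv.Perm.permMatrix,
      PEquiv.toMatrix_apply, Equiv.toPEquiv_apply, Equiv.symm_apply_apply]
    rcases eq_or_ne i j with rfl | hij
    · rcases eq_or_ne i (Fin.last n) with rfl | hi
      · simp [hn.neg_one_pow]
      · rw [coe_finRotate_of_ne_last hi, if_neg i.val.succ_ne_zero]
        simp [pow_succ]
    · simp [hij]

theorem two_ne_zero_of_card_eq_pow {p r : ℕ} (hp : p.Prime) (hp2 : 2 < p) [Fintype F]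
    (hF : Fintype.card F = p ^ r) : (2 : F) ≠ 0 := by
  intro h
  have hdvd : ringChar F ∣ 2 := ringChar.dvd (by exact_mod_cast h)
  have hcop : Nat.Coprime 2 (p ^ r) := ((Nat.coprime_primes Nat.prime_two hp).2 hp2.ne).pow_right r
  exact CharP.ringChar_ne_one (R := F)
    (Nat.eq_one_of_dvd_coprimes hcop hdvd (ringChar.dvd (hF ▸ Nat.cast_card_eq_zero F)))

end Generation

theorem stmt0 (p k r q : ℕ) (hp : p.Prime) (hk : k.Prime) (hp2 : 2 < p) (hk3 : 3 < k)
    (hpk : p ≠ k) (hr : 1 ≤ r) (hq : q = p ^ r) (hq3 : 3 < q)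
    (F : Type) [Field F] [Fintype F] (hF : Fintype.card F = q) :
    ∃ Ma Mb Mc : Matrix (Fin k) (Fin k) F,
      IsUnit Ma ∧ IsUnit Mb ∧ IsUnit Mc ∧
      Subgroup.closure (genSet Ma Mb Mc) = ⊤ := by
  have h2 : (2 : F) ≠ 0 := two_ne_zero_of_card_eq_pow hp hp2 (hF.trans hq)
  obtain ⟨Ma, Mb, hMa, hMb, hD⟩ := exists_isUnit_mul_eq_reflectionMatrix_mul (F := F)
    (hk.odd_of_ne_two (by omega))
  obtain ⟨J, hJ⟩ := hMb.mul hMa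
  have hMc : IsUnit ((↑J⁻¹ : Matrix (Fin k) (Fin k) F) * hessenbergMatrix k F) :=
    J⁻¹.isUnit.mul (isUnit_hessenbergMatrix (by omega))
  exact ⟨Ma, Mb, _, hMa, hMb, hMc,
    closure_genSet_eq_top (by omega) h2 hMa hMb hMc hD (by rw [← hJ, Units.mul_inv_cancel_left])⟩
end

section
/- Let p > 2 and k > 3 be distinct primes and let q = p^r > 3 for some r ≥ 1. Then there exist symmetric invertible matrices M_a, M_b, M_c ∈ GL_k(F_q) such that the subgroup of SL_{4k}(F_q) generated by the set {V_a(λ), V_b(λ), V_c(λ) : λ ∈ F_q} equals the symplectic group Sp_{4k}(F_q, Ω_{2k}) = {X ∈ GL_{4k}(F_q) : Xᵀ Ω_{2k} X = Ω_{2k}}, where Ω_{2k} is the 4k×4k block matrix ((0, −I_{2k}), (I_{2k}, 0)). -/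
open Matrix

/-- The standard symplectic matrix `Ω_{2k}` of size `4k`, with `2k × 2k` blocks
`((0, -I_{2k}), (I_{2k}, 0))`, written as a `4 × 4` array of `k × k` blocks. -/
def Omega2k {k : ℕ} {F : Type*} [Field F] : Matrix (Fin 4 × Fin k) (Fin 4 × Fin k) F :=
  blocks4 !![0, 0, -1, 0; 0, 0, 0, -1; 1, 0, 0, 0; 0, 1, 0, 0]

section Forms

variable {F V : Type*} [Field F] [AddCommGroup V] [Module F V]

/-- A scalar-invariant set that is closed under sums of non-orthogonal vectors is everything, as
soon as it contains a hyperbolic pair and its members not orthogonal to that pair span. -/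
theorem mem_of_span_not_orthogonal (h2 : (2 : F) ≠ 0) {B : LinearMap.BilinForm F V} (hB : B.IsAlt)
    (hnd : ∀ z, z ≠ 0 → ∃ y, B z y ≠ 0) {D : Set V}
    (hs : ∀ (c : F), ∀ v ∈ D, c • v ∈ D)
    (hadd : ∀ v ∈ D, ∀ w ∈ D, B v w ≠ 0 → v + w ∈ D)
    {u w : V} (hu : u ∈ D) (hw : w ∈ D) (huw : B u w ≠ 0)
    (hspan : Submodule.span F {d | d ∈ D ∧ (B u d ≠ 0 ∨ B w d ≠ 0)} = ⊤) (v : V) : v ∈ D := by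
  have hu0 : u ≠ 0 := by rintro rfl; simp at huw
  have huu : B u u = 0 := hB u
  have hww : B w w = 0 := hB w
  have hwu : B w u ≠ 0 := by rw [← hB.neg_eq]; simpa using huw
  set U : Submodule F V := Submodule.span F {u, w} with hU
  have huU : u ∈ U := Submodule.subset_span (by simp)
  have hwU : w ∈ U := Submodule.subset_span (by simp)
  have hUD : ∀ x ∈ U, x ∈ D := by
    intro x hx
    obtain ⟨a, b, rfl⟩ := Submodule.mem_span_pair.1 hx
    by_cases ha : a = 0
    · subst ha; simpa using hs b w hw
    by_cases hb : b = 0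
    · subst hb; simpa using hs a u hu
    · exact hadd _ (hs a u hu) _ (hs b w hw) (by simp [ha, hb, huw])
  have hUnd : ∀ x ∈ U, x ≠ 0 → ∃ y ∈ U, B x y ≠ 0 := by
    intro x hx hx0
    by_contra! h
    obtain ⟨a, b, rfl⟩ := Submodule.mem_span_pair.1 hx
    have h1 := h u huU
    have h2 := h w hwU
    simp [huu, hww, huw, hwu] at h1 h2
    simp [h1, h2] at hx0
  let Z : Submodule F V :=
    { carrier := {z | (∀ x ∈ U, B x z = 0) ∧ ∀ x ∈ U, x ≠ 0 → x + z ∈ D}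
      zero_mem' := ⟨by simp, fun x hx _ => by simpa using hUD x hx⟩
      smul_mem' := by
        rintro c z ⟨hz, hz'⟩
        refine ⟨fun x hx => by simp [hz x hx], fun x hx hx0 => ?_⟩
        by_cases hc : c = 0
        · simpa [hc] using hUD x hx
        · have := hs c _ (hz' (c⁻¹ • x) (U.smul_mem _ hx) (by simp [hc, hx0]))
          simpa [smul_smul, hc] using this
      add_mem' := by
        rintro z z' ⟨hz, hz1⟩ ⟨hz', hz1'⟩
        refine ⟨fun x hx => by simp [hz x hx, hz' x hx], fun x hx hx0 => ?_⟩
        have hzl : ∀ x ∈ U, B z x = 0 := fun x hx => by rw [← hB.neg_eq, hz x hx, neg_zero]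
        by_cases hzz : B z z' = 0
        · obtain ⟨y, hy, hxy⟩ := hUnd x hx hx0
          have hyy : B y y = 0 := hB y
          have := hadd _ (hz1 (x - y) (U.sub_mem hx hy) ?_) _ (hz1' y hy ?_) ?_
          · convert this using 1; abel
          · intro h; rw [sub_eq_zero] at h; subst h; exact hxy hyy
          · rintro rfl; simp at hxy
          · simp [hyy, hzz, hz' x hx, hz' y hy, hzl y hy, hxy]
        · have hx2 : (2 : F)⁻¹ • x ∈ U := U.smul_mem _ hx
          have hx20 : (2 : F)⁻¹ • x ≠ 0 := by simp [h2, hx0]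
          have hxx : B x x = 0 := hB x
          have := hadd _ (hz1 _ hx2 hx20) _ (hz1' _ hx2 hx20)
            (by simp [hz' x hx, hzl x hx, hzz, hxx])
          convert this using 1
          rw [add_add_add_comm, ← add_smul, ← two_mul, mul_inv_cancel₀ h2, one_smul] }
  have hUZ : U ⊔ Z = ⊤ := by
    rw [eq_top_iff, ← hspan, Submodule.span_le]
    rintro d ⟨hd, hdU⟩
    obtain ⟨x₀, hx₀, z, hz, rfl⟩ : ∃ x ∈ U, ∃ z, (∀ x ∈ U, B x z = 0) ∧ x + z = d := by
      refine ⟨(B w d / B w u) • u + (B u d / B u w) • w,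
        U.add_mem (U.smul_mem _ huU) (U.smul_mem _ hwU), _, ?_, add_sub_cancel _ _⟩
      intro x hx
      obtain ⟨a, b, rfl⟩ := Submodule.mem_span_pair.1 hx
      simp [huu, hww, huw, hwu]
    have hzl : ∀ x ∈ U, B z x = 0 := fun x hx => by rw [← hB.neg_eq, hz x hx, neg_zero]
    have hx00 : x₀ ≠ 0 := by
      rintro rfl; simp [hz u huU, hz w hwU] at hdU
    have step : ∀ x ∈ U, ∀ y ∈ U, x + z ∈ D → B x y ≠ 0 → y + z ∈ D := by
      intro x hx y hy hxD hxy
      have := hadd _ hxD (y - x) (hUD _ (U.sub_mem hy hx))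
        (by have hxx : B x x = 0 := hB x
            simp [hxx, hzl y hy, hzl x hx, hxy])
      convert this using 1; abel
    refine Submodule.add_mem_sup hx₀ ⟨hz, fun x hx hx0 => ?_⟩
    obtain ⟨y, hy, hxy⟩ := hUnd x₀ hx₀ hx00
    by_cases h1 : B y x = 0
    · obtain ⟨y', hy', hxy'⟩ := hUnd x hx hx0
      have hyx' : B y' x ≠ 0 := by rw [← hB.neg_eq]; simpa using hxy'
      by_cases h3 : B x₀ y' = 0
      · exact step (y + y') (U.add_mem hy hy') x hx
          (step x₀ hx₀ _ (U.add_mem hy hy') hd (by simp [h3, hxy])) (by simp [h1, hyx'])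
      · exact step y' hy' x hx (step x₀ hx₀ _ hy' hd h3) hyx'
    · exact step y hy x hx (step x₀ hx₀ _ hy hd hxy) h1
  have hv : v ∈ U ⊔ Z := hUZ ▸ Submodule.mem_top
  obtain ⟨x, hx, z, hz, rfl⟩ := Submodule.mem_sup.1 hv
  by_cases hx0 : x = 0
  · subst hx0
    by_cases hz0 : z = 0
    · subst hz0; simpa using hs 0 u hu
    obtain ⟨y, hy⟩ := hnd z hz0
    have hyUZ : y ∈ U ⊔ Z := hUZ ▸ Submodule.mem_top
    obtain ⟨x', hx', z', hz', rfl⟩ := Submodule.mem_sup.1 hyUZ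
    have hzl : ∀ x ∈ U, B z x = 0 := fun x hx => by rw [← hB.neg_eq, hz.1 x hx, neg_zero]
    have hzl' : ∀ x ∈ U, B z' x = 0 := fun x hx => by rw [← hB.neg_eq, hz'.1 x hx, neg_zero]
    have hzz' : B z' z ≠ 0 := by rw [← hB.neg_eq]; simpa [hzl x' hx'] using hy
    have hz'' : B z' z' = 0 := hB z'
    have := hadd _ (hz'.2 u huU hu0) _
      ((Z.sub_mem hz hz').2 (-u) (U.neg_mem huU) (by simpa using hu0))
      (by simp [huu, hz.1 u huU, hz'.1 u huU, hzl' u huU, hz'', hzz'])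
    convert this using 1; abel
  · exact hz.2 x hx hx0

/-- A property of isometries of a symplectic space which holds for the identity and is reflected by
left multiplication with transvections holds for all isometries. -/
theorem isometry_induction [FiniteDimensional F V] {B : LinearMap.BilinForm F V} (hB : B.IsAlt)
    (hnd : ∀ z, z ≠ 0 → ∃ y, B y z ≠ 0) {P : (V →ₗ[F] V) → Prop} (hone : P LinearMap.id)
    (htrans : ∀ (a : V) (c : F) (X : V →ₗ[F] V),
      P (LinearMap.transvection (c • B a) a ∘ₗ X) → P X)
    (X : V →ₗ[F] V) (hX : ∀ x y, B (X x) (X y) = B x y) : P X := by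
  have key : ∀ n, ∀ X : V →ₗ[F] V, (∀ x y, B (X x) (X y) = B x y) →
      Module.finrank F V = Module.finrank F (LinearMap.eqLocus X LinearMap.id) + n → P X := by
    intro n
    induction n using Nat.strong_induction_on with
    | _ n ih =>
    have hiso : ∀ (a : V) (c : F) (X : V →ₗ[F] V), (∀ x y, B (X x) (X y) = B x y) → ∀ x y,
        B ((LinearMap.transvection (c • B a) a ∘ₗ X) x)
          ((LinearMap.transvection (c • B a) a ∘ₗ X) y) = B x y := by
      intro a c X hX x y
      have haa : B a a = 0 := hB a
      simp [LinearMap.transvection.apply, hX, haa, ← hB.neg_eq a (X x)]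
      ring
    have moved : ∀ X : V →ₗ[F] V, (∀ x y, B (X x) (X y) = B x y) → (∃ v, B v (X v) ≠ 0) →
        (∃ m, m ≤ n ∧ Module.finrank F V =
          Module.finrank F (LinearMap.eqLocus X LinearMap.id) + m) → P X := by
      rintro X hX ⟨v, hv⟩ ⟨m, hmn, hm⟩
      apply htrans (X v - v) (B v (X v))⁻¹
      have hlt : LinearMap.eqLocus X LinearMap.id < LinearMap.eqLocus
          (LinearMap.transvection ((B v (X v))⁻¹ • B (X v - v)) (X v - v) ∘ₗ X) LinearMap.id := by
        refine SetLike.lt_iff_le_and_exists.2 ⟨fun w hw => ?_, v, ?_, fun h => ?_⟩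
        · have hw' : X w = w := hw
          have : B (X v) w = B v w := by conv_lhs => rw [← hw', hX]
          simp [LinearMap.transvection.apply, hw', this]
        · have hvv : B (X v) (X v) = 0 := hB _
          simp [LinearMap.transvection.apply, hvv, hv]
        · have h' : X v = v := h
          rw [h'] at hv
          exact hv (hB v)
      have h1 := Submodule.finrank_lt_finrank_of_lt hlt
      have h2 := Submodule.finrank_le (LinearMap.eqLocus
          (LinearMap.transvection ((B v (X v))⁻¹ • B (X v - v)) (X v - v) ∘ₗ X) LinearMap.id)
      exact ih (Module.finrank F V - _) (by omega) _ (hiso _ _ X hX)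
        (Nat.add_sub_cancel' h2).symm
    intro X hX hn
    by_cases hv : ∃ v, B v (X v) ≠ 0
    · exact moved X hX hv ⟨n, le_rfl, hn⟩
    push Not at hv
    by_cases hid : X = LinearMap.id
    · rwa [hid]
    obtain ⟨v, hvX⟩ : ∃ v, X v ≠ v := by
      by_contra! h
      exact hid (LinearMap.ext h)
    obtain ⟨w, hw⟩ := hnd (v - X v) (sub_ne_zero.2 (Ne.symm hvX))
    apply htrans (X w - w) 1
    have hle : LinearMap.eqLocus X LinearMap.id ≤ LinearMap.eqLocus
        (LinearMap.transvection ((1 : F) • B (X w - w)) (X w - w) ∘ₗ X) LinearMap.id := by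
      intro y hy
      have hy' : X y = y := hy
      have : B (X w) y = B w y := by conv_lhs => rw [← hy', hX]
      simp [LinearMap.transvection.apply, hy', this]
    have h1 := Submodule.finrank_mono hle
    have h2 := Submodule.finrank_le (LinearMap.eqLocus
        (LinearMap.transvection ((1 : F) • B (X w - w)) (X w - w) ∘ₗ X) LinearMap.id)
    refine moved _ (hiso _ _ X hX) ⟨v, ?_⟩ ⟨Module.finrank F V - _, by omega,
      (Nat.add_sub_cancel' h2).symm⟩
    have hpol : B v (X w) = - B w (X v) := by
      have := hv (v + w)
      simp [hv v, hv w] at this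
      exact eq_neg_of_add_eq_zero_left (by rw [← this])
    have hsub : B v (X w - w) = B w (v - X v) := by
      simp [hpol, ← hB.neg_eq w v]
      ring
    have hsub' : B (X w - w) (X v) = B w (v - X v) := by
      simp [hX]
    simp only [LinearMap.comp_apply, LinearMap.transvection.apply, map_add, map_smul,
      hv v, hsub, hsub', one_smul, smul_eq_mul, zero_add]
    exact mul_ne_zero hw hw
  have h2 := Submodule.finrank_le (LinearMap.eqLocus X LinearMap.id)
  exact key _ X hX (Nat.add_sub_cancel' h2).symm

end Forms

section Matrices

variable {F n : Type*} [Field F] [Fintype n] [DecidableEq n]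

/-- The transvection `x ↦ x + c ⟨v, x⟩ v` for the bilinear form with Gram matrix `Ω`. -/
def formTransvection (Ω : Matrix n n F) (v : n → F) (c : F) : Matrix n n F :=
  1 + c • vecMulVec v (v ᵥ* Ω)

theorem formTransvection_mulVec (Ω : Matrix n n F) (v : n → F) (c : F) (x : n → F) :
    formTransvection Ω v c *ᵥ x = x + (c * (v ⬝ᵥ Ω *ᵥ x)) • v := by
  rw [formTransvection, add_mulVec, one_mulVec, smul_mulVec, vecMulVec_mulVec,
    ← dotProduct_mulVec, mul_smul]
  simp

theorem mul_formTransvection {Ω g : Matrix n n F} (hg : gᵀ * Ω * g = Ω) (v : n → F) (c : F) :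
    g * formTransvection Ω v c = formTransvection Ω (g *ᵥ v) c * g := by
  have h : v ᵥ* Ω = (g *ᵥ v) ᵥ* Ω ᵥ* g := by
    conv_lhs => rw [← hg]
    rw [← vecMul_transpose g v, ← vecMul_vecMul, ← vecMul_vecMul]
  rw [formTransvection, formTransvection, mul_add, add_mul, mul_one, one_mul, mul_smul_comm,
    smul_mul_assoc, mul_vecMulVec, vecMulVec_mul, h]

/-- A group of isometries of a symplectic form which contains the transvections along a vector `u`
contains every isometry, provided it moves `u` to some vector not orthogonal to `u` and
no proper subspace containing `u` is invariant under a family of one-parameter subgroups. -/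
theorem mem_of_transvection_of_cyclic (h2 : (2 : F) ≠ 0) {Ω : Matrix n n F}
    (hΩ : (Matrix.toBilin' Ω).IsAlt) (hnd : IsUnit Ω)
    (G : Subgroup (Matrix.SpecialLinearGroup n F))
    (hG : ∀ g ∈ G, (g : Matrix n n F)ᵀ * Ω * (g : Matrix n n F) = Ω) (u : n → F)
    (hu : ∀ c, ∃ g ∈ G, (g : Matrix n n F) = formTransvection Ω u c)
    (hu' : ∃ g ∈ G, u ⬝ᵥ Ω *ᵥ ((g : Matrix n n F) *ᵥ u) ≠ 0) (S : Set (Matrix n n F))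
    (hS : ∀ N ∈ S, ∀ l : F, ∃ g ∈ G, (g : Matrix n n F) = 1 + l • N)
    (hcyc : ∀ W : Submodule F (n → F), u ∈ W → (∀ N ∈ S, ∀ d ∈ W, N *ᵥ d ∈ W) → W = ⊤)
    (X : Matrix n n F) (hX : Xᵀ * Ω * X = Ω) : ∃ g ∈ G, (g : Matrix n n F) = X := by
  have coe_mul (g h : Matrix.SpecialLinearGroup n F) :
      ((g * h : Matrix.SpecialLinearGroup n F) : Matrix n n F) = g * h := rfl
  have coe_one : ((1 : Matrix.SpecialLinearGroup n F) : Matrix n n F) = 1 := rfl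
  set B : LinearMap.BilinForm F (n → F) := Matrix.toBilin' Ω with hBdef
  have hBa : ∀ x y, B x y = x ⬝ᵥ Ω *ᵥ y := fun x y => Matrix.toBilin'_apply' Ω x y
  have hBr : ∀ z, z ≠ 0 → ∃ y, B y z ≠ 0 := by
    intro z hz
    by_contra! h
    refine hz (Matrix.mulVec_injective_of_isUnit hnd ?_)
    rw [mulVec_zero]
    exact dotProduct_eq_zero _ fun y => by rw [dotProduct_comm, ← hBa, h]
  have hBl : ∀ z, z ≠ 0 → ∃ y, B z y ≠ 0 := fun z hz => by
    obtain ⟨y, hy⟩ := hBr z hz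
    exact ⟨y, by rw [← hΩ.neg_eq]; simpa using hy⟩
  have hiso : ∀ M : Matrix n n F, Mᵀ * Ω * M = Ω → ∀ x y, B (M *ᵥ x) (M *ᵥ y) = B x y := by
    intro M hM x y
    conv_rhs => rw [hBa, ← hM]
    rw [hBa, ← vecMul_transpose M x, ← dotProduct_mulVec, mulVec_mulVec, mulVec_mulVec, mul_assoc]
  set D : Set (n → F) := {v | ∀ c, ∃ g ∈ G, (g : Matrix n n F) = formTransvection Ω v c} with hD
  have hGD : ∀ g ∈ G, ∀ v ∈ D, (g : Matrix n n F) *ᵥ v ∈ D := by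
    intro g hg v hv c
    obtain ⟨t, ht, htv⟩ := hv c
    refine ⟨g * t * g⁻¹, G.mul_mem (G.mul_mem hg ht) (G.inv_mem hg), ?_⟩
    rw [coe_mul, coe_mul, htv, mul_formTransvection (hG g hg), mul_assoc, ← coe_mul,
      mul_inv_cancel, coe_one, mul_one]
  have hs : ∀ (c : F), ∀ v ∈ D, c • v ∈ D := by
    intro c v hv a
    obtain ⟨t, ht, htv⟩ := hv (a * c * c)
    refine ⟨t, ht, ?_⟩
    rw [htv, formTransvection, formTransvection, smul_vecMul, smul_vecMulVec, vecMulVec_smul,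
      smul_smul, smul_smul]
  have hadd : ∀ v ∈ D, ∀ w ∈ D, B v w ≠ 0 → v + w ∈ D := by
    intro v hv w hw hvw
    obtain ⟨t, ht, htv⟩ := hv (B v w)⁻¹
    have := hGD t ht w hw
    rwa [htv, formTransvection_mulVec, ← hBa, inv_mul_cancel₀ hvw, one_smul, add_comm] at this
  obtain ⟨g, hg, hgu⟩ := hu'
  have huD : u ∈ D := hu
  have hwD : (g : Matrix n n F) *ᵥ u ∈ D := hGD g hg u huD
  rw [← hBa] at hgu
  have hDtop : ∀ v, v ∈ D := by
    refine mem_of_span_not_orthogonal h2 hΩ hBl hs hadd huD hwD hgu (hcyc _ ?_ ?_)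
    · refine Submodule.subset_span ⟨huD, Or.inr ?_⟩
      rw [← hΩ.neg_eq]; simpa using hgu
    · intro N hN
      set W := Submodule.span F {d | d ∈ D ∧ (B u d ≠ 0 ∨ B ((g : Matrix n n F) *ᵥ u) d ≠ 0)}
      suffices W ≤ W.comap (Matrix.mulVecLin N) from fun d hd => this hd
      refine Submodule.span_le.2 ?_
      rintro d ⟨hd, hdU⟩
      have hmove : ∀ l : F, d + l • N *ᵥ d ∈ D := by
        intro l
        obtain ⟨h, hh, hhN⟩ := hS N hN l
        have := hGD h hh d hd
        rwa [hhN, add_mulVec, one_mulVec, smul_mulVec] at this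
      have hdW : d ∈ W := Submodule.subset_span ⟨hd, hdU⟩
      obtain ⟨l, hl0, hl⟩ : ∃ l : F, l ≠ 0 ∧ d + l • N *ᵥ d ∈ W := by
        by_contra! h
        have h1 : d + (1 : F) • N *ᵥ d ∉ W := h 1 one_ne_zero
        have h3 : d + (-1 : F) • N *ᵥ d ∉ W := h (-1) (by simp)
        have hz : ∀ l : F, d + l • N *ᵥ d ∉ W → B u (d + l • N *ᵥ d) = 0 ∧
            B ((g : Matrix n n F) *ᵥ u) (d + l • N *ᵥ d) = 0 := by
          intro l hl
          by_contra hne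
          exact hl (Submodule.subset_span ⟨hmove l, by tauto⟩)
        obtain ⟨a1, a2⟩ := hz _ h1
        obtain ⟨b1, b2⟩ := hz _ h3
        simp only [map_add, map_smul, smul_eq_mul] at a1 a2 b1 b2
        rcases hdU with hdU | hdU
        · exact mul_ne_zero h2 hdU (by linear_combination a1 + b1)
        · exact mul_ne_zero h2 hdU (by linear_combination a2 + b2)
      have := W.smul_mem l⁻¹ (W.sub_mem hl hdW)
      simpa [smul_smul, hl0] using this
  have hP := isometry_induction hΩ hBr
    (P := fun Y => ∃ g ∈ G, (g : Matrix n n F) = LinearMap.toMatrix' Y)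
    ⟨1, G.one_mem, by simp⟩ ?_ (Matrix.toLin' X) (fun x y => by simpa using hiso X hX x y)
  · simpa using hP
  · rintro a c Y ⟨h, hh, hhY⟩
    obtain ⟨t, ht, hta⟩ := hDtop a c
    refine ⟨t⁻¹ * h, G.mul_mem (G.inv_mem ht) hh, ?_⟩
    have hT : LinearMap.toMatrix' (LinearMap.transvection (c • B a) a) = (t : Matrix n n F) := by
      rw [← LinearMap.toMatrix'_toLin' (t : Matrix n n F)]
      congr 1
      refine LinearMap.ext fun x => ?_
      rw [Matrix.toLin'_apply, hta, formTransvection_mulVec, LinearMap.transvection.apply, ← hBa]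
      simp
    rw [LinearMap.toMatrix'_comp, hT] at hhY
    rw [coe_mul, hhY, ← mul_assoc, ← coe_mul, inv_mul_cancel, coe_one, one_mul]

end Matrices

section Blocks

theorem blocks4_transpose {k : ℕ} {F : Type*}
    (A : Matrix (Fin 4) (Fin 4) (Matrix (Fin k) (Fin k) F)) :
    (blocks4 A)ᵀ = blocks4 (A.map transpose)ᵀ := rfl

variable {k : ℕ} {F : Type*} [Field F]

theorem blocks4_mul (A B : Matrix (Fin 4) (Fin 4) (Matrix (Fin k) (Fin k) F)) :
    blocks4 A * blocks4 B = blocks4 (A * B) :=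
  ((compRingEquiv (Fin 4) (Fin k) F).map_mul A B).symm

theorem blocks4_one :
    blocks4 (1 : Matrix (Fin 4) (Fin 4) (Matrix (Fin k) (Fin k) F)) = 1 :=
  (compRingEquiv (Fin 4) (Fin k) F).map_one

theorem blocks4_add (A B : Matrix (Fin 4) (Fin 4) (Matrix (Fin k) (Fin k) F)) :
    blocks4 (A + B) = blocks4 A + blocks4 B := rfl

theorem blocks4_neg (A : Matrix (Fin 4) (Fin 4) (Matrix (Fin k) (Fin k) F)) :
    blocks4 (-A) = -blocks4 A := rfl

theorem blocks4_smul (c : F) (A : Matrix (Fin 4) (Fin 4) (Matrix (Fin k) (Fin k) F)) :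
    blocks4 (c • A) = c • blocks4 A := rfl

/-- The vector with block `i` equal to `v` and all other blocks zero. -/
def blockVec (i : Fin 4) : (Fin k → F) →ₗ[F] (Fin 4 × Fin k → F) where
  toFun v p := if p.1 = i then v p.2 else 0
  map_add' v w := by ext p; by_cases h : p.1 = i <;> simp [h]
  map_smul' c v := by ext p; by_cases h : p.1 = i <;> simp [h]

theorem blockVec_apply (i : Fin 4) (v : Fin k → F) (p : Fin 4 × Fin k) :
    blockVec i v p = if p.1 = i then v p.2 else 0 := rfl

theorem sum_blockVec (x : Fin 4 × Fin k → F) :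
    ∑ i, blockVec i (fun j => x (i, j)) = x := by
  ext p
  simp [blockVec_apply, Finset.sum_apply]

theorem blockVec_dotProduct_blockVec (i j : Fin 4) (v w : Fin k → F) :
    blockVec i v ⬝ᵥ blockVec j w = if i = j then v ⬝ᵥ w else 0 := by
  by_cases h : i = j
  · simp [blockVec_apply, dotProduct, Fintype.sum_prod_type, h]
  · simp [blockVec_apply, dotProduct, Fintype.sum_prod_type, h, Ne.symm h]

theorem blocks4_mulVec_blockVec (A : Matrix (Fin 4) (Fin 4) (Matrix (Fin k) (Fin k) F))
    (i : Fin 4) (v : Fin k → F) :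
    blocks4 A *ᵥ blockVec i v = ∑ j, blockVec j (A j i *ᵥ v) := by
  ext p
  simp [blockVec_apply, blocks4, mulVec, dotProduct, Fintype.sum_prod_type, Finset.sum_apply]

theorem Omega2k_mul_self : (Omega2k : Matrix (Fin 4 × Fin k) (Fin 4 × Fin k) F) * Omega2k = -1 := by
  rw [Omega2k, blocks4_mul, ← blocks4_one, ← blocks4_neg]
  refine congrArg blocks4 ?_
  ext i j : 1
  fin_cases i <;> fin_cases j <;> simp [Matrix.mul_apply, Fin.sum_univ_four]

theorem isUnit_Omega2k : IsUnit (Omega2k : Matrix (Fin 4 × Fin k) (Fin 4 × Fin k) F) :=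
  IsUnit.of_mul_eq_one (-Omega2k) (by rw [mul_neg, Omega2k_mul_self, neg_neg])

theorem Omega2k_isAlt (h2 : (2 : F) ≠ 0) :
    (Matrix.toBilin' (Omega2k : Matrix (Fin 4 × Fin k) (Fin 4 × Fin k) F)).IsAlt := by
  intro x
  have hT : (Omega2k : Matrix (Fin 4 × Fin k) (Fin 4 × Fin k) F)ᵀ = -Omega2k := by
    rw [Omega2k, blocks4_transpose, ← blocks4_neg]
    refine congrArg blocks4 ?_
    ext i j : 1
    fin_cases i <;> fin_cases j <;> simp
  rw [Matrix.toBilin'_apply']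
  have h : x ⬝ᵥ Omega2k *ᵥ x = -(x ⬝ᵥ Omega2k *ᵥ x) := by
    conv_lhs => rw [dotProduct_mulVec, ← mulVec_transpose, hT, neg_mulVec, neg_dotProduct,
      dotProduct_comm]
  exact (mul_eq_zero_iff_left h2).1 (by linear_combination h)

theorem Va_symplectic {Ma : Matrix (Fin k) (Fin k) F} (h : Ma.IsSymm) (l : F) :
    (Va Ma l)ᵀ * Omega2k * Va Ma l = Omega2k := by
  rw [Va, Omega2k, blocks4_transpose, blocks4_mul, blocks4_mul]
  refine congrArg blocks4 ?_
  ext i j : 1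
  fin_cases i <;> fin_cases j <;> simp [Matrix.mul_apply, Fin.sum_univ_four, h.eq]

theorem Vb_symplectic {Mb : Matrix (Fin k) (Fin k) F} (h : Mb.IsSymm) (l : F) :
    (Vb Mb l)ᵀ * Omega2k * Vb Mb l = Omega2k := by
  rw [Vb, Omega2k, blocks4_transpose, blocks4_mul, blocks4_mul]
  refine congrArg blocks4 ?_
  ext i j : 1
  fin_cases i <;> fin_cases j <;> simp [Matrix.mul_apply, Fin.sum_univ_four, h.eq]

theorem Vc_symplectic {Mc : Matrix (Fin k) (Fin k) F} (h : Mc.IsSymm) (l : F) :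
    (Vc Mc l)ᵀ * Omega2k * Vc Mc l = Omega2k := by
  rw [Vc, Omega2k, blocks4_transpose, blocks4_mul, blocks4_mul]
  refine congrArg blocks4 ?_
  ext i j : 1
  fin_cases i <;> fin_cases j <;> simp [Matrix.mul_apply, Fin.sum_univ_four, h.eq]

theorem Va_add (Ma : Matrix (Fin k) (Fin k) F) (l m : F) : Va Ma (l + m) = Va Ma l * Va Ma m := by
  rw [Va, Va, Va, blocks4_mul]
  refine congrArg blocks4 ?_
  ext i j : 1
  fin_cases i <;> fin_cases j <;> simp [Matrix.mul_apply, Fin.sum_univ_four, add_smul, add_comm]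

theorem Vb_add (Mb : Matrix (Fin k) (Fin k) F) (l m : F) : Vb Mb (l + m) = Vb Mb l * Vb Mb m := by
  rw [Vb, Vb, Vb, blocks4_mul]
  refine congrArg blocks4 ?_
  ext i j : 1
  fin_cases i <;> fin_cases j <;> simp [Matrix.mul_apply, Fin.sum_univ_four, add_smul, add_comm]

theorem Vc_add (Mc : Matrix (Fin k) (Fin k) F) (l m : F) : Vc Mc (l + m) = Vc Mc l * Vc Mc m := by
  rw [Vc, Vc, Vc, blocks4_mul]
  refine congrArg blocks4 ?_
  ext i j : 1
  fin_cases i <;> fin_cases j <;> simp [Matrix.mul_apply, Fin.sum_univ_four, add_smul, add_comm]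

/-- A one-parameter family of isometries over a field in which `2 ≠ 0` has determinant one. -/
theorem det_eq_one_of_add (h2 : (2 : F) ≠ 0) (f : F → Matrix (Fin 4 × Fin k) (Fin 4 × Fin k) F)
    (hadd : ∀ l m, f (l + m) = f l * f m) (hf : ∀ l, (f l)ᵀ * Omega2k * f l = Omega2k) (l : F) :
    (f l).det = 1 := by
  have hl : l = l / 2 + l / 2 := by field_simp; ring
  have hΩ : (Omega2k : Matrix (Fin 4 × Fin k) (Fin 4 × Fin k) F).det ≠ 0 :=
    ((isUnit_iff_isUnit_det _).1 isUnit_Omega2k).ne_zero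
  have h := congrArg det (hf (l / 2))
  rw [det_mul, det_mul, det_transpose] at h
  rw [hl, hadd, det_mul]
  exact mul_right_cancel₀ hΩ (by linear_combination h)

theorem Va_mul_Vb (Ma Mb : Matrix (Fin k) (Fin k) F) (l : F) :
    Va Ma l * Vb Mb 1 =
      blocks4 (1 + single 1 3 (-(l • (Ma * Mb + Mb * Ma)))) * (Vb Mb 1 * Va Ma l) := by
  rw [Va, Vb, blocks4_mul, blocks4_mul, blocks4_mul, add_mul, one_mul]
  refine congrArg blocks4 ?_
  ext i j : 1
  fin_cases i <;> fin_cases j <;>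
    simp [Matrix.mul_apply, Fin.sum_univ_four, single_apply]

theorem blocks4_single_vecMulVec (i j : Fin 4) (v w : Fin k → F) :
    blocks4 (single i j (vecMulVec v w)) = vecMulVec (blockVec i v) (blockVec j w) := by
  ext p p'
  by_cases h : p.1 = i <;> by_cases h' : p'.1 = j <;>
    simp [blocks4, single_apply, vecMulVec_apply, blockVec_apply, h, h', eq_comm (a := i),
      eq_comm (a := j)]

theorem formTransvection_blockVec_one (v : Fin k → F) (c : F) :
    formTransvection Omega2k (blockVec 1 v) c =
      blocks4 (1 + single 1 3 (-(c • vecMulVec v v))) := by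
  have h : blockVec 1 v ᵥ* Omega2k = -blockVec 3 v := by
    ext ⟨i, j⟩
    fin_cases i <;>
      simp [Omega2k, blocks4, vecMul, dotProduct, blockVec_apply, Fintype.sum_prod_type,
        one_apply]
  rw [formTransvection, h, blocks4_add, blocks4_one, ← smul_neg, ← vecMulVec_neg, ← smul_vecMulVec,
    ← smul_vecMulVec, blocks4_single_vecMulVec, map_neg, map_smul]

end Blocks

section Cyclic

/-- For odd `k > 1` there are invertible symmetric `k × k` matrices whose first two members
anticommute up to a matrix of rank one, and whose product has a suitable cyclic vector. -/
theorem exists_symm_cyclic {F : Type*} [Field F] (h2 : (2 : F) ≠ 0) {k : ℕ} (hodd : Odd k)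
    (hk : 1 < k) : ∃ (v : Fin k → F) (Ma Mb Mc : Matrix (Fin k) (Fin k) F),
      Ma.IsSymm ∧ Mb.IsSymm ∧ Mc.IsSymm ∧ IsUnit Ma ∧ IsUnit Mb ∧ IsUnit Mc ∧
      (∃ c : F, c ≠ 0 ∧ Ma * Mb + Mb * Ma = c • vecMulVec v v) ∧ v ⬝ᵥ Mc *ᵥ v ≠ 0 ∧
      ∀ W : Submodule F (Fin k → F), v ∈ W → (∀ x ∈ W, Mb *ᵥ Ma *ᵥ Mc *ᵥ x ∈ W) → W = ⊤ := by
  have : NeZero k := ⟨by omega⟩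
  have h10 : (1 : Fin k) ≠ 0 := by
    intro h
    have := congrArg Fin.val h
    simp [Nat.mod_eq_of_lt hk] at this
  set ε : Fin k → F := fun i => if 2 * (i : ℕ) < k then 1 else -1 with hε
  have hε0 : ε 0 = 1 := by simp [hε]; omega
  have hεsq : ∀ i, ε i * ε i = 1 := by intro i; simp only [hε]; split_ifs <;> simp
  have hεneg : ∀ i, i ≠ 0 → ε (-i) = -ε i := by
    intro i hi
    have hi' : (i : ℕ) ≠ 0 := fun h => hi (Fin.ext (by simpa using h))
    have hv : ((-i : Fin k) : ℕ) = k - i := by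
      rw [Fin.val_neg', Nat.mod_eq_of_lt (by omega)]
    obtain ⟨m, rfl⟩ := hodd
    simp only [hε, hv]
    have := i.2
    split_ifs <;> first | omega | simp
  set Ma : Matrix (Fin k) (Fin k) F := diagonal ε with hMa
  set Mb : Matrix (Fin k) (Fin k) F := of fun i j => if j = -i then 1 else 0 with hMb
  set Mc : Matrix (Fin k) (Fin k) F :=
    of fun i j => (if j = 1 - i then 1 else 0) + (if i = 0 then if j = 0 then 1 else 0 else 0)
    with hMc
  have hMav : ∀ x i, (Ma *ᵥ x) i = ε i * x i := fun x i => by rw [hMa, mulVec_diagonal]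
  have hMbv : ∀ x i, (Mb *ᵥ x) i = x (-i) := fun x i => by simp [hMb, mulVec, dotProduct]
  have hMcv : ∀ x i, (Mc *ᵥ x) i = x (1 - i) + if i = 0 then x 0 else 0 := fun x i => by
    by_cases hi : i = 0 <;> simp [hMc, mulVec, dotProduct, hi, add_mul, Finset.sum_add_distrib]
  refine ⟨Pi.single 0 1, Ma, Mb, Mc, isSymm_diagonal _, ?_, ?_, ?_, ?_, ?_, ⟨2, h2, ?_⟩, ?_, ?_⟩
  · refine IsSymm.ext fun i j => ?_
    have : i = -j ↔ j = -i := by rw [eq_comm, neg_eq_iff_eq_neg]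
    simp [hMb, this]
  · refine IsSymm.ext fun i j => ?_
    have : i = 1 - j ↔ j = 1 - i := by rw [eq_sub_iff_add_eq, eq_sub_iff_add_eq, add_comm]
    simp only [hMc, of_apply, this]
    congr 1
    split_ifs <;> rfl
  · refine IsUnit.of_mul_eq_one Ma ?_
    rw [hMa, diagonal_mul_diagonal, ← diagonal_one]
    exact congrArg _ (funext hεsq)
  · refine mulVec_injective_iff_isUnit.1 fun x y hxy => funext fun i => ?_
    have := congrFun hxy (-i)
    rwa [hMbv, hMbv, neg_neg] at this
  · refine mulVec_injective_iff_isUnit.1 fun x y hxy => funext fun i => ?_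
    have h0 := congrFun hxy 1
    have hi := congrFun hxy (1 - i)
    rw [hMcv, hMcv, sub_self, if_neg h10, if_neg h10, add_zero, add_zero] at h0
    rw [hMcv, hMcv, sub_sub_cancel, h0] at hi
    exact add_right_cancel hi
  · ext i j
    rw [Matrix.add_apply, hMa, diagonal_mul, mul_diagonal]
    by_cases hi : i = 0
    · subst hi
      by_cases hj : j = 0
      · subst hj; simp [hMb, hε0, vecMulVec_apply, one_add_one_eq_two]
      · simp [hMb, vecMulVec_apply, hj]
    · by_cases hj : j = -i
      · subst hj; simp [hMb, hεneg i hi, vecMulVec_apply, hi]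
      · simp [hMb, vecMulVec_apply, hi, hj]
  · rw [single_dotProduct, hMcv]
    simp [h10]
  · intro W h0 hW
    have hMas : ∀ j, Ma *ᵥ Pi.single j 1 = ε j • Pi.single j 1 := fun j => by
      ext i
      by_cases hij : i = j
      · subst hij; simp [hMav]
      · simp [hMav, hij]
    have hMbs : ∀ j, Mb *ᵥ Pi.single j 1 = Pi.single (-j) 1 := fun j => by
      ext i
      simp [hMbv, Pi.single_apply, neg_eq_iff_eq_neg]
    have hMcs : ∀ j, Mc *ᵥ Pi.single j 1 =
        Pi.single (1 - j) 1 + if j = 0 then Pi.single 0 1 else 0 := fun j => by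
      ext i
      have h : 1 - i = j ↔ i = 1 - j := by
        rw [sub_eq_iff_eq_add, eq_sub_iff_add_eq, eq_comm, add_comm]
      by_cases hj : j = 0
      · rw [hMcv, Pi.add_apply, if_pos hj, Pi.single_apply, Pi.single_apply, Pi.single_apply]
        subst hj
        simp only [h, if_true, Pi.single_apply]
      · simp [hMcv, Pi.single_apply, h, hj, Ne.symm hj]
    have hstep : ∀ j, Pi.single j 1 ∈ W → Pi.single (j - 1) (1 : F) ∈ W := by
      intro j hjW
      have hj := hW _ hjW
      have hite : Mb *ᵥ Ma *ᵥ (if j = 0 then Pi.single 0 1 else 0 : Fin k → F) ∈ W := by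
        split_ifs
        · simpa [hMas, hMbs, mulVec_smul, hε0] using h0
        · simp
      rw [hMcs, mulVec_add, mulVec_add, W.add_mem_iff_left hite, hMas, mulVec_smul, hMbs,
        neg_sub] at hj
      have := W.smul_mem (ε (1 - j)) hj
      rwa [smul_smul, hεsq, one_smul] at this
    have hmem : ∀ (n : ℕ) (i : Fin k), ((-i : Fin k) : ℕ) = n → Pi.single i (1 : F) ∈ W := by
      intro n
      induction n with
      | zero =>
        intro i hi
        have : i = 0 := neg_eq_zero.1 (Fin.ext (by simpa using hi))
        rwa [this]
      | succ n ih =>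
        intro i hi
        have := hstep (i + 1) (ih _ ?_)
        · rwa [add_sub_cancel_right] at this
        · have hne : -i ≠ 0 := fun h => by rw [h] at hi; simp at hi
          rw [neg_add, ← sub_eq_add_neg, Fin.val_sub_one_of_ne_zero hne, hi, Nat.add_sub_cancel]
    rw [eq_top_iff, ← (Pi.basisFun F (Fin k)).span_eq, Submodule.span_le]
    rintro _ ⟨i, rfl⟩
    simpa using hmem _ i rfl

end Cyclic

theorem stmt1 (p k r q : ℕ) (hp : p.Prime) (hk : k.Prime) (hp2 : 2 < p) (hk3 : 3 < k)
    (hpk : p ≠ k) (hr : 1 ≤ r) (hq : q = p ^ r) (hq3 : 3 < q)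
    (F : Type) [Field F] [Fintype F] (hF : Fintype.card F = q) :
    ∃ Ma Mb Mc : Matrix (Fin k) (Fin k) F,
      Ma.IsSymm ∧ Mb.IsSymm ∧ Mc.IsSymm ∧ IsUnit Ma ∧ IsUnit Mb ∧ IsUnit Mc ∧
      (fun g : Matrix.SpecialLinearGroup (Fin 4 × Fin k) F =>
          (g : Matrix (Fin 4 × Fin k) (Fin 4 × Fin k) F)) ''
        (Subgroup.closure (genSet Ma Mb Mc) : Set (Matrix.SpecialLinearGroup (Fin 4 × Fin k) F)) =
      {A : Matrix (Fin 4 × Fin k) (Fin 4 × Fin k) F |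
        IsUnit A ∧ Aᵀ * Omega2k * A = Omega2k} := by
  have h2 : (2 : F) ≠ 0 := by
    intro h
    have h0 : (p : F) = 0 := by
      have := Nat.cast_card_eq_zero F
      rw [hF, hq, Nat.cast_pow] at this
      exact eq_zero_of_pow_eq_zero this
    obtain ⟨m, rfl⟩ := hp.odd_of_ne_two (by omega)
    rw [Nat.cast_add, Nat.cast_mul, Nat.cast_ofNat, h, zero_mul, zero_add, Nat.cast_one] at h0
    exact one_ne_zero h0
  obtain ⟨v, Ma, Mb, Mc, ha, hb, hc, ua, ub, uc, ⟨c, hc0, hab⟩, hvv, hcyc⟩ :=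
    exists_symm_cyclic h2 (hk.odd_of_ne_two (by omega)) hk.one_lt
  refine ⟨Ma, Mb, Mc, ha, hb, hc, ua, ub, uc, ?_⟩
  set G := Subgroup.closure (genSet Ma Mb Mc) with hGdef
  have hVa : ∀ l, ∃ g ∈ G, (g : Matrix (Fin 4 × Fin k) (Fin 4 × Fin k) F) = Va Ma l := fun l =>
    ⟨⟨Va Ma l, det_eq_one_of_add h2 _ (Va_add Ma) (Va_symplectic ha) l⟩,
      Subgroup.subset_closure ⟨l, Or.inl rfl⟩, rfl⟩
  have hVb : ∀ l, ∃ g ∈ G, (g : Matrix (Fin 4 × Fin k) (Fin 4 × Fin k) F) = Vb Mb l := fun l =>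
    ⟨⟨Vb Mb l, det_eq_one_of_add h2 _ (Vb_add Mb) (Vb_symplectic hb) l⟩,
      Subgroup.subset_closure ⟨l, Or.inr (Or.inl rfl)⟩, rfl⟩
  have hVc : ∀ l, ∃ g ∈ G, (g : Matrix (Fin 4 × Fin k) (Fin 4 × Fin k) F) = Vc Mc l := fun l =>
    ⟨⟨Vc Mc l, det_eq_one_of_add h2 _ (Vc_add Mc) (Vc_symplectic hc) l⟩,
      Subgroup.subset_closure ⟨l, Or.inr (Or.inr rfl)⟩, rfl⟩
  have coe_mul (g h : Matrix.SpecialLinearGroup (Fin 4 × Fin k) F) :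
      ((g * h : Matrix.SpecialLinearGroup (Fin 4 × Fin k) F) :
        Matrix (Fin 4 × Fin k) (Fin 4 × Fin k) F) = g * h := rfl
  have coe_one : ((1 : Matrix.SpecialLinearGroup (Fin 4 × Fin k) F) :
      Matrix (Fin 4 × Fin k) (Fin 4 × Fin k) F) = 1 := rfl
  have hsymp : ∀ g ∈ G, (g : Matrix (Fin 4 × Fin k) (Fin 4 × Fin k) F)ᵀ * Omega2k *
      (g : Matrix (Fin 4 × Fin k) (Fin 4 × Fin k) F) = Omega2k := by
    intro g hg
    induction hg using Subgroup.closure_induction with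
    | mem g hg =>
      obtain ⟨l, h | h | h⟩ := hg
      · rw [h, Va_symplectic ha]
      · rw [h, Vb_symplectic hb]
      · rw [h, Vc_symplectic hc]
    | one => rw [coe_one, transpose_one, one_mul, mul_one]
    | mul g h _ _ hg hh =>
      rw [coe_mul, transpose_mul]
      calc _ = (h : Matrix (Fin 4 × Fin k) (Fin 4 × Fin k) F)ᵀ *
            ((g : Matrix (Fin 4 × Fin k) (Fin 4 × Fin k) F)ᵀ * Omega2k *
              (g : Matrix (Fin 4 × Fin k) (Fin 4 × Fin k) F)) *
            (h : Matrix (Fin 4 × Fin k) (Fin 4 × Fin k) F) := by simp only [mul_assoc]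
        _ = _ := by rw [hg, hh]
    | inv g _ hg =>
      have h1 : (g : Matrix (Fin 4 × Fin k) (Fin 4 × Fin k) F) *
          ((g⁻¹ : Matrix.SpecialLinearGroup (Fin 4 × Fin k) F) :
            Matrix (Fin 4 × Fin k) (Fin 4 × Fin k) F) = 1 := by
        rw [← coe_mul, mul_inv_cancel, coe_one]
      have h3 := congrArg transpose h1
      rw [transpose_mul, transpose_one] at h3
      conv_lhs => rw [← hg]
      simp only [← mul_assoc]
      rw [h3, one_mul, mul_assoc, h1, mul_one]
  ext X
  constructor
  · rintro ⟨g, hg, rfl⟩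
    exact ⟨(isUnit_iff_isUnit_det _).2 (by rw [g.2]; exact isUnit_one), hsymp g hg⟩
  rintro ⟨-, hX⟩
  refine mem_of_transvection_of_cyclic h2 (Omega2k_isAlt h2) isUnit_Omega2k G hsymp (blockVec 1 v)
    ?_ ?_ {blocks4 !![0, 0, 0, Ma; 0, 0, Ma, 0; 0, 0, 0, 0; 0, 0, 0, 0],
      blocks4 !![0, 0, 0, 0; Mb, 0, 0, 0; 0, 0, 0, -Mb; 0, 0, 0, 0],
      blocks4 !![0, 0, 0, 0; 0, 0, 0, 0; 0, 0, 0, 0; 0, Mc, 0, 0]} ?_ ?_ X hX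
  · intro l
    obtain ⟨ga, hga, hga'⟩ := hVa (l / c)
    obtain ⟨gb, hgb, hgb'⟩ := hVb 1
    refine ⟨ga * gb * (gb * ga)⁻¹, G.mul_mem (G.mul_mem hga hgb)
      (G.inv_mem (G.mul_mem hgb hga)), ?_⟩
    have := Va_mul_Vb Ma Mb (l / c)
    rw [hab, smul_smul, div_mul_cancel₀ l hc0, ← formTransvection_blockVec_one, ← hga', ← hgb',
      ← coe_mul, ← coe_mul] at this
    rw [coe_mul, this, mul_assoc, ← coe_mul, mul_inv_cancel, coe_one, mul_one]
  · obtain ⟨g, hg, hg'⟩ := hVc 1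
    refine ⟨g, hg, ?_⟩
    rw [hg', Vc, blocks4_mulVec_blockVec, Omega2k]
    simpa [Fin.sum_univ_four, mulVec_add, blocks4_mulVec_blockVec, blockVec_dotProduct_blockVec,
      neg_mulVec] using hvv
  · rintro N (rfl | rfl | rfl) l
    · obtain ⟨g, hg, hg'⟩ := hVa l
      refine ⟨g, hg, ?_⟩
      rw [hg', Va, ← blocks4_one, ← blocks4_smul, ← blocks4_add]
      refine congrArg blocks4 ?_
      ext i j : 1
      fin_cases i <;> fin_cases j <;> simp
    · obtain ⟨g, hg, hg'⟩ := hVb l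
      refine ⟨g, hg, ?_⟩
      rw [hg', Vb, ← blocks4_one, ← blocks4_smul, ← blocks4_add]
      refine congrArg blocks4 ?_
      ext i j : 1
      fin_cases i <;> fin_cases j <;> simp
    · obtain ⟨g, hg, hg'⟩ := hVc l
      refine ⟨g, hg, ?_⟩
      rw [hg', Vc, ← blocks4_one, ← blocks4_smul, ← blocks4_add]
      refine congrArg blocks4 ?_
      ext i j : 1
      fin_cases i <;> fin_cases j <;> simp
  · intro W hvW hW
    simp only [Set.mem_insert_iff, Set.mem_singleton_iff, forall_eq_or_imp, forall_eq] at hW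
    obtain ⟨hWa, hWb, hWc⟩ := hW
    have h13 : ∀ x, blockVec 1 x ∈ W → blockVec 3 (Mc *ᵥ x) ∈ W := fun x hx => by
      simpa [blocks4_mulVec_blockVec, Fin.sum_univ_four] using hWc _ hx
    have h30 : ∀ x, blockVec 3 x ∈ W → blockVec 0 (Ma *ᵥ x) ∈ W := fun x hx => by
      simpa [blocks4_mulVec_blockVec, Fin.sum_univ_four] using hWa _ hx
    have h01 : ∀ x, blockVec 0 x ∈ W → blockVec 1 (Mb *ᵥ x) ∈ W := fun x hx => by
      simpa [blocks4_mulVec_blockVec, Fin.sum_univ_four] using hWb _ hx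
    have h32 : ∀ x, blockVec 3 x ∈ W → blockVec 2 (Mb *ᵥ x) ∈ W := fun x hx => by
      simpa [blocks4_mulVec_blockVec, Fin.sum_univ_four, neg_mulVec] using hWb _ hx
    have hW1 : ∀ x, blockVec 1 x ∈ W := by
      have := hcyc (W.comap (blockVec 1)) hvW fun x hx => h01 _ (h30 _ (h13 _ hx))
      intro x
      have hx : x ∈ W.comap (blockVec 1) := by rw [this]; exact Submodule.mem_top
      exact hx
    have hW3 : ∀ x, blockVec 3 x ∈ W := fun x => by
      obtain ⟨y, rfl⟩ := mulVec_surjective_iff_isUnit.2 uc x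
      exact h13 y (hW1 y)
    have hW0 : ∀ x, blockVec 0 x ∈ W := fun x => by
      obtain ⟨y, rfl⟩ := mulVec_surjective_iff_isUnit.2 ua x
      exact h30 y (hW3 y)
    have hW2 : ∀ x, blockVec 2 x ∈ W := fun x => by
      obtain ⟨y, rfl⟩ := mulVec_surjective_iff_isUnit.2 ub x
      exact h32 y (hW3 y)
    refine eq_top_iff.2 fun x _ => ?_
    rw [← sum_blockVec x, Fin.sum_univ_four]
    exact W.add_mem (W.add_mem (W.add_mem (hW0 _) (hW1 _)) (hW2 _)) (hW3 _)
end

section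
/- Let q be a prime power and k ≥ 1 an integer. If S ∈ GL_k(F_q) has order q^k − 1, then S acts irreducibly on F_q^k by matrix multiplication: the only F_q-linear subspaces W of F_q^k satisfying S·W ⊆ W are the zero subspace and F_q^k itself. -/
open Matrix

open Polynomial in
/-- The powers of a square matrix all lie in a subspace of dimension at most the matrix size. -/
theorem Matrix.exists_submodule_finrank_le_forall_pow_mem {K : Type*} [Field K] {k : ℕ}
    (M : Matrix (Fin k) (Fin k) K) :
    ∃ A : Submodule K (Matrix (Fin k) (Fin k) K), Module.finrank K A ≤ k ∧ ∀ i, M ^ i ∈ A := by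
  have : Module.Finite K (degreeLT K k) := Module.Finite.equiv (degreeLTEquiv K k).symm
  refine ⟨(degreeLT K k).map (aeval M).toLinearMap, ?_, fun i => ?_⟩
  · refine (Submodule.finrank_map_le _ _).trans ?_
    rw [(degreeLTEquiv K k).finrank_eq, Module.finrank_fin_fun]
  · refine ⟨X ^ i %ₘ M.charpoly, ?_, (M.pow_eq_aeval_mod_charpoly i).symm⟩
    rw [SetLike.mem_coe, mem_degreeLT]
    refine (degree_modByMonic_lt _ M.charpoly_monic).trans_le ?_
    simp [M.charpoly_degree_eq_dim]

theorem stmt2 (q k : ℕ) (hq : IsPrimePow q) (hk : 1 ≤ k)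
    (F : Type) [Field F] [Fintype F] (hF : Fintype.card F = q)
    (S : GL (Fin k) F) (hS : orderOf S = q ^ k - 1) :
    ∀ W : Submodule F (Fin k → F),
      (∀ v ∈ W, Matrix.mulVec (S : Matrix (Fin k) (Fin k) F) v ∈ W) →
      W = ⊥ ∨ W = ⊤ := by
  classical
  intro W hW
  refine or_iff_not_imp_left.2 fun hbot => ?_
  obtain ⟨w, hwW, hw⟩ := W.exists_mem_ne_zero_of_ne_bot hbot
  have : Nonempty (Fin k) := ⟨⟨0, hk⟩⟩
  have hqpos : 0 < q ^ k := pow_pos hq.pos k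
  obtain ⟨A, hA, hpow⟩ := Matrix.exists_submodule_finrank_le_forall_pow_mem
    (S : Matrix (Fin k) (Fin k) F)
  let P : Set (Matrix (Fin k) (Fin k) F) := Units.val '' (Subgroup.zpowers S : Set (GL (Fin k) F))
  have hP : ∀ a ∈ P, ∃ i : ℕ, (S : Matrix (Fin k) (Fin k) F) ^ i = a := by
    rintro _ ⟨u, hu, rfl⟩
    obtain ⟨i, rfl⟩ := mem_powers_iff_mem_zpowers.2 hu
    exact ⟨i, by simp⟩
  have hPcard : P.ncard = q ^ k - 1 := by
    rw [Set.ncard_image_of_injective _ Units.val_injective, ← hS, ← Nat.card_zpowers]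
    rfl
  have hP0 : (0 : Matrix (Fin k) (Fin k) F) ∉ P := by
    rintro ⟨u, -, hu⟩
    exact u.ne_zero hu
  have hBcard : (insert 0 P).ncard = q ^ k := by
    rw [Set.ncard_insert_of_notMem hP0, hPcard]
    omega
  have hBA : insert 0 P = (A : Set (Matrix (Fin k) (Fin k) F)) := by
    refine Set.eq_of_subset_of_ncard_le ?_ ?_
    · refine Set.insert_subset A.zero_mem fun a ha => ?_
      obtain ⟨i, rfl⟩ := hP a ha
      exact hpow i
    · have h : (A : Set (Matrix (Fin k) (Fin k) F)).ncard = q ^ Module.finrank F A := by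
        rw [← hF, ← Nat.card_eq_fintype_card (α := F), ← Module.natCard_eq_pow_finrank]
        rfl
      rw [hBcard, h]
      exact Nat.pow_le_pow_right hq.pos hA
  have hinj : Set.InjOn (fun a : Matrix (Fin k) (Fin k) F => a *ᵥ w) (insert 0 P) := by
    intro a ha b hb hab
    rw [hBA] at ha hb
    have hsub : a - b ∈ insert 0 P := hBA ▸ A.sub_mem ha hb
    rcases hsub with h | ⟨u, -, hu⟩
    · exact sub_eq_zero.1 h
    · refine absurd ?_ hw
      have h : (u : Matrix (Fin k) (Fin k) F) *ᵥ w = 0 := by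
        rw [hu, Matrix.sub_mulVec]
        exact sub_eq_zero.2 hab
      rw [← Matrix.one_mulVec w, ← u.inv_mul, ← Matrix.mulVec_mulVec, h, Matrix.mulVec_zero]
  have hpowW : ∀ i : ℕ, ((S : Matrix (Fin k) (Fin k) F) ^ i) *ᵥ w ∈ W := by
    intro i
    induction i with
    | zero => simpa using hwW
    | succ i ih =>
      rw [pow_succ', ← Matrix.mulVec_mulVec]
      exact hW _ ih
  have hsubset : (fun a : Matrix (Fin k) (Fin k) F => a *ᵥ w) '' insert 0 P ⊆ W := by
    rintro _ ⟨a, rfl | ha, rfl⟩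
    · simp
    · obtain ⟨i, rfl⟩ := hP a ha
      exact hpowW i
  have hle := Set.ncard_le_ncard hsubset
  rw [hinj.ncard_image, hBcard] at hle
  refine SetLike.coe_injective (Set.eq_of_subset_of_ncard_le (Set.subset_univ _) ?_)
  simpa [Set.ncard_univ, hF] using hle
end

section
/- Let q be a prime power and k ≥ 1 an integer. Then every element of GL_k(F_q) has multiplicative order at most q^k − 1, and there exists an element of GL_k(F_q) whose order is exactly q^k − 1. -/
open Matrix

open Polynomial in
/-- A unit annihilated by a monic polynomial of degree `n` over a finite field `F` has order at
most `|F| ^ n - 1`, since its powers are nonzero elements of the span of its first `n` powers. -/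
theorem Units.orderOf_le_card_pow_natDegree_sub_one {F A : Type*} [Field F] [Finite F] [Ring A]
    [Nontrivial A] [Algebra F A] (u : Aˣ) {p : F[X]} (hp : p.Monic)
    (hu : aeval (u : A) p = 0) : orderOf u ≤ Nat.card F ^ p.natDegree - 1 := by
  let f : (Fin p.natDegree → F) →ₗ[F] A :=
    (aeval (u : A)).toLinearMap ∘ₗ (degreeLT F p.natDegree).subtype ∘ₗ
      (degreeLTEquiv F p.natDegree).symm.toLinearMap
  have hmem (i : ℕ) : ((u ^ i : Aˣ) : A) ∈ Set.range f := by
    have hd : X ^ i %ₘ p ∈ degreeLT F p.natDegree := by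
      rw [mem_degreeLT, ← degree_eq_natDegree hp.ne_zero]
      exact degree_modByMonic_lt _ hp
    refine ⟨degreeLTEquiv F p.natDegree ⟨_, hd⟩, ?_⟩
    have h := congrArg (aeval (u : A)) (modByMonic_add_div (X ^ i) p)
    simpa [f, hu] using h
  have hsub : (fun v : Aˣ ↦ (v : A)) '' (Subgroup.zpowers u : Set Aˣ) ⊆ Set.range f \ {0} := by
    rintro _ ⟨v, hv, rfl⟩
    have hfin : IsOfFinOrder u := by
      have hr : (Set.range fun i : ℕ ↦ u ^ i).Finite := by
        refine Set.Finite.of_finite_image ((Set.finite_range f).subset ?_)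
          (f := fun v : Aˣ ↦ (v : A)) Units.val_injective.injOn
        rintro _ ⟨_, ⟨i, rfl⟩, rfl⟩
        exact hmem i
      by_contra h
      exact Set.infinite_range_of_injective (injective_pow_iff_not_isOfFinOrder.2 h) hr
    obtain ⟨i, rfl⟩ := hfin.mem_powers_iff_mem_zpowers.2 hv
    exact ⟨hmem i, Units.ne_zero _⟩
  calc orderOf u = ((fun v : Aˣ ↦ (v : A)) '' (Subgroup.zpowers u : Set Aˣ)).ncard := by
        rw [Set.ncard_image_of_injective _ Units.val_injective, ← Nat.card_zpowers]
        rfl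
    _ ≤ (Set.range f \ {0}).ncard := Set.ncard_le_ncard hsub ((Set.finite_range f).sdiff)
    _ = (Set.range f).ncard - 1 := Set.ncard_sdiff_singleton_of_mem ⟨0, map_zero f⟩
    _ ≤ Nat.card F ^ p.natDegree - 1 := by
        gcongr
        rw [← Set.image_univ]
        refine (Set.ncard_image_le Set.finite_univ).trans ?_
        simp [Set.ncard_univ, Nat.card_fun]

/-- The general linear group `GL_n` of a finite field `F` contains an element of order
`|F| ^ n - 1`, given by multiplication by a primitive element of the extension of degree `n`. -/
theorem Matrix.GeneralLinearGroup.exists_orderOf_eq_card_pow_sub_one (F : Type*) [Field F]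
    [Finite F] (n : ℕ) [NeZero n] : ∃ g : GL (Fin n) F, orderOf g = Nat.card F ^ n - 1 := by
  have : Fact (ringChar F).Prime := ⟨CharP.char_is_prime F _⟩
  let K := FiniteField.Extension F (ringChar F) n
  let b : Module.Basis (Fin n) F K :=
    Module.finBasisOfFinrankEq F K (FiniteField.finrank_extension F (ringChar F) n)
  obtain ⟨x, hx⟩ := IsCyclic.exists_ofOrder_eq_natCard (α := Kˣ)
  refine ⟨Units.map (Algebra.leftMulMatrix b : K →* Matrix (Fin n) (Fin n) F) x, ?_⟩
  rw [orderOf_injective _ (Units.map_injective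
    (f := (Algebra.leftMulMatrix b : K →* Matrix (Fin n) (Fin n) F))
    (Algebra.leftMulMatrix_injective b)), hx,
    Nat.card_units, FiniteField.natCard_extension]

theorem stmt3 (q k : ℕ) (hq : IsPrimePow q) (hk : 1 ≤ k)
    (F : Type) [Field F] [Fintype F] (hF : Fintype.card F = q) :
    (∀ g : GL (Fin k) F, orderOf g ≤ q ^ k - 1) ∧
    (∃ g : GL (Fin k) F, orderOf g = q ^ k - 1) := by
  have : NeZero k := ⟨Nat.one_le_iff_ne_zero.1 hk⟩
  rw [← hF, Fintype.card_eq_nat_card]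
  refine ⟨fun g ↦ ?_, Matrix.GeneralLinearGroup.exists_orderOf_eq_card_pow_sub_one F k⟩
  simpa using Units.orderOf_le_card_pow_natDegree_sub_one g (Matrix.charpoly_monic g.val)
    (Matrix.aeval_self_charpoly g.val)
end

section
/- Let q be a prime power and k ≥ 1 an integer. If S ∈ GL_k(F_q) has order q^k − 1, then the centraliser of S in GL_k(F_q) equals the cyclic subgroup ⟨S⟩ generated by S; that is, every g ∈ GL_k(F_q) with gS = Sg is a power of S. -/
open Matrix

/-- The matrices that are zero or a power of `S`. -/
def Matrix.zeroOrPowers {n F : Type*} [Fintype n] [DecidableEq n] [Field F] (S : GL n F) :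
    Set (Matrix n n F) :=
  insert 0 (Units.val '' (Subgroup.zpowers S : Set (GL n F)))

namespace Matrix

variable {n F : Type*} [Fintype n] [DecidableEq n] [Field F]

theorem coe_zpow_mem_range_aeval [Finite F] (S : GL n F) {g : GL n F}
    (hg : g ∈ Subgroup.zpowers S) :
    (g : Matrix n n F) ∈ ((Polynomial.aeval (S : Matrix n n F)).toLinearMap.domRestrict
      (Polynomial.degreeLT F (Fintype.card n))).range := by
  obtain ⟨m, rfl⟩ := (mem_powers_iff_mem_zpowers (x := S)).2 hg
  refine ⟨⟨Polynomial.X ^ m %ₘ (S : Matrix n n F).charpoly, ?_⟩, ?_⟩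
  · rw [Polynomial.mem_degreeLT, ← charpoly_degree_eq_dim (S : Matrix n n F)]
    exact Polynomial.degree_modByMonic_lt _ (charpoly_monic _)
  · simpa using (pow_eq_aeval_mod_charpoly (S : Matrix n n F) m).symm

theorem ncard_zeroOrPowers [Finite F] [Nonempty n] (S : GL n F) :
    (zeroOrPowers S).ncard = orderOf S + 1 := by
  rw [zeroOrPowers, Set.ncard_insert_of_notMem, Set.ncard_image_of_injective _ Units.val_injective]
  · exact congrArg (· + 1) (Nat.card_zpowers S)
  · rintro ⟨g, -, hg⟩
    exact g.ne_zero hg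

/-- For a Singer element `S`, the matrices that are zero or a power of `S` form a linear subspace. -/
theorem exists_submodule_coe_eq_zeroOrPowers [Fintype F] [Nonempty n] (S : GL n F)
    (hS : orderOf S = Fintype.card F ^ Fintype.card n - 1) :
    ∃ V : Submodule F (Matrix n n F), (V : Set (Matrix n n F)) = zeroOrPowers S := by
  let φ := (Polynomial.aeval (S : Matrix n n F)).toLinearMap.domRestrict
      (Polynomial.degreeLT F (Fintype.card n))
  let e := Polynomial.degreeLTEquiv F (Fintype.card n)
  have : Finite (Polynomial.degreeLT F (Fintype.card n)) := Finite.of_equiv _ e.symm.toEquiv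
  refine ⟨φ.range, (Set.eq_of_subset_of_ncard_le ?_ ?_ (Set.toFinite _)).symm⟩
  · rintro _ (rfl | ⟨g, hg, rfl⟩)
    · exact zero_mem _
    · exact coe_zpow_mem_range_aeval S hg
  · have hpos : 0 < Fintype.card F ^ Fintype.card n := pow_pos Fintype.card_pos _
    rw [ncard_zeroOrPowers, hS, Nat.sub_add_cancel hpos, LinearMap.coe_range]
    calc (Set.range φ).ncard ≤ Nat.card (Polynomial.degreeLT F (Fintype.card n)) :=
          Finite.card_range_le φ
      _ = _ := by simp [Nat.card_congr e.toEquiv]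

/-- A Singer element acts transitively on nonzero vectors: its powers, together with zero,
send any nonzero vector to every vector. -/
theorem exists_mem_zeroOrPowers_mulVec_eq [Fintype F] [Nonempty n] (S : GL n F)
    (hS : orderOf S = Fintype.card F ^ Fintype.card n - 1) {v : n → F} (hv : v ≠ 0) (w : n → F) :
    ∃ a ∈ zeroOrPowers S, a *ᵥ v = w := by
  obtain ⟨V, hV⟩ := exists_submodule_coe_eq_zeroOrPowers S hS
  have hinj : Set.InjOn (fun a : Matrix n n F ↦ a *ᵥ v) (zeroOrPowers S) := by
    intro a ha b hb hab
    rw [← hV] at ha hb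
    have hsub : a - b ∈ zeroOrPowers S := hV ▸ V.sub_mem ha hb
    have hzero : (a - b) *ᵥ v = 0 := by rw [sub_mulVec]; exact sub_eq_zero.2 hab
    rcases hsub with h | ⟨u, -, hu⟩
    · exact sub_eq_zero.1 h
    · refine absurd ?_ hv
      rw [← hu] at hzero
      rw [← one_mulVec v, ← u.inv_mul, ← mulVec_mulVec, hzero, mulVec_zero]
  have himage : (fun a : Matrix n n F ↦ a *ᵥ v) '' zeroOrPowers S = Set.univ := by
    have hpos : 0 < Fintype.card F ^ Fintype.card n := pow_pos Fintype.card_pos _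
    refine Set.eq_of_subset_of_ncard_le (Set.subset_univ _) ?_ (Set.toFinite _)
    rw [hinj.ncard_image, ncard_zeroOrPowers, hS, Nat.sub_add_cancel hpos,
      Set.ncard_univ]
    simp
  exact himage.ge (Set.mem_univ w)

theorem commute_of_mem_zeroOrPowers {S g : GL n F} (h : Commute g S) {a : Matrix n n F}
    (ha : a ∈ zeroOrPowers S) : Commute (g : Matrix n n F) a := by
  rcases ha with rfl | ⟨u, ⟨m, rfl⟩, rfl⟩
  · exact Commute.zero_right _
  · exact congrArg Units.val (h.zpow_right m).eq

/-- Every element commuting with a Singer element is a power of it. -/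
theorem mem_zpowers_of_commute [Fintype F] [Nonempty n] {S g : GL n F}
    (hS : orderOf S = Fintype.card F ^ Fintype.card n - 1) (h : Commute g S) :
    g ∈ Subgroup.zpowers S := by
  obtain ⟨v, hv⟩ := exists_ne (0 : n → F)
  obtain ⟨a, ha, hav⟩ := exists_mem_zeroOrPowers_mulVec_eq S hS hv ((g : Matrix n n F) *ᵥ v)
  have hga : (g : Matrix n n F) = a := by
    refine ext_of_mulVec_single fun i ↦ ?_
    obtain ⟨b, hb, hbv⟩ := exists_mem_zeroOrPowers_mulVec_eq S hS hv (Pi.single i 1)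
    have hab : a * b = b * a := by
      rcases ha with rfl | ⟨u, hu, rfl⟩
      · simp
      · obtain ⟨m, rfl⟩ := hu
        exact commute_of_mem_zeroOrPowers ((Commute.refl S).zpow_left m) hb
    rw [← hbv, mulVec_mulVec, (commute_of_mem_zeroOrPowers h hb).eq, ← mulVec_mulVec, ← hav,
      mulVec_mulVec, mulVec_mulVec, hab]
  rcases ha with rfl | ⟨u, hu, rfl⟩
  · exact absurd hga g.ne_zero
  · rwa [Units.val_injective hga]

end Matrix

theorem stmt4 (q k : ℕ) (hq : IsPrimePow q) (hk : 1 ≤ k)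
    (F : Type) [Field F] [Fintype F] (hF : Fintype.card F = q)
    (S : GL (Fin k) F) (hS : orderOf S = q ^ k - 1) :
    ∀ g : GL (Fin k) F, g * S = S * g → g ∈ Subgroup.zpowers S := by
  intro g hg
  have : Nonempty (Fin k) := ⟨⟨0, hk⟩⟩
  exact mem_zpowers_of_commute (by rw [hS, hF, Fintype.card_fin]) hg
end

section
/- Let q = p^r with p an odd prime and r ≥ 1, and let k ≥ 1 be an integer with q^k ≠ 9. Let S ∈ GL_k(F_q) be a Singer element, i.e. have order q^k − 1. Then the subgroup H of SL_{2k}(F_q) generated by the two block matrices ((I_k, 0), (S, I_k)) and ((I_k, I_k), (0, I_k)) (each entry a k×k block) is isomorphic as a group to SL_2(L), where L is a field with q^k elements. -/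
open Matrix

/-- Assemble a `2 × 2` array of `k × k` blocks into a `2k × 2k` matrix. -/
def blocks2 {k : ℕ} {F : Type*} (B : Matrix (Fin 2) (Fin 2) (Matrix (Fin k) (Fin k) F)) :
    Matrix (Fin 2 × Fin k) (Fin 2 × Fin k) F :=
  Matrix.of fun p q => B p.1 q.1 p.2 q.2

section FixedPoints

variable {G X : Type*} [Group G] [MulAction G X]

open Classical in
/-- The nontrivial group elements that fix the point `x`. -/
noncomputable def nontrivialFixers (G : Type*) [Group G] {X : Type*} [MulAction G X] [Fintype G]
    (x : X) : Finset G :=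
  {g | g ≠ 1 ∧ g • x = x}

open Classical in
/-- The nontrivial group elements that fix the point `x` and no other point. -/
noncomputable def parabolicFixers (G : Type*) [Group G] {X : Type*} [MulAction G X] [Fintype G]
    (x : X) : Finset G :=
  {g | g ≠ 1 ∧ ∀ z, g • z = z ↔ z = x}

theorem card_nontrivialFixers_smul [Fintype G] (a : G) (x : X) :
    (nontrivialFixers G (a • x)).card = (nontrivialFixers G x).card := by
  refine Finset.card_equiv (MulAut.conj a⁻¹).toEquiv fun g => ?_
  have h : g • a • x = a • x ↔ (a⁻¹ * g * a) • x = x := by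
    rw [mul_smul, mul_smul, inv_smul_eq_iff]
  simp [nontrivialFixers, h, mul_eq_one_iff_eq_inv]

theorem card_parabolicFixers_smul [Fintype G] (a : G) (x : X) :
    (parabolicFixers G (a • x)).card = (parabolicFixers G x).card := by
  refine Finset.card_equiv (MulAut.conj a⁻¹).toEquiv fun g => ?_
  have h : (∀ z, g • z = z ↔ z = a • x) ↔ ∀ z, (a⁻¹ * g * a) • z = z ↔ z = x := by
    rw [← (MulAction.toPerm a).forall_congr_right]
    refine forall_congr' fun z => ?_
    simp [mul_smul, inv_smul_eq_iff]
  simp [parabolicFixers, h, mul_eq_one_iff_eq_inv]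

theorem card_nontrivialFixers_add_one [Fintype G] (x : X) :
    (nontrivialFixers G x).card + 1 = Nat.card (MulAction.stabilizer G x) := by
  classical
  rw [← Finset.card_insert_of_notMem (a := (1 : G)) (by simp [nontrivialFixers]),
    Nat.card_eq_fintype_card, Fintype.card_subtype]
  congr 1
  ext g
  by_cases hg : g = 1 <;> simp [nontrivialFixers, hg]

theorem card_orbit_mul_nontrivialFixers [Fintype G] (x : X) :
    Nat.card (MulAction.orbit G x) * ((nontrivialFixers G x).card + 1) = Nat.card G := by
  rw [card_nontrivialFixers_add_one, ← Nat.card_prod,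
    Nat.card_congr (MulAction.orbitProdStabilizerEquivGroup G x)]

/-- If every nontrivial element has one or two fixed points, counting pairs `(g, x)` with
`g • x = x` gives this relation. -/
theorem sum_card_fixers [Fintype G] [Fintype X]
    (hfix : ∀ g : G, g ≠ 1 → ∃ x y : X, ∀ z, g • z = z ↔ z = x ∨ z = y) :
    ∑ x : X, ((nontrivialFixers G x).card + (parabolicFixers G x).card) + 2 =
      2 * Fintype.card G := by
  classical
  have key : ∀ g : G, (∑ x : X, ((if g ≠ 1 ∧ g • x = x then 1 else 0) +
      (if g ≠ 1 ∧ ∀ z, g • z = z ↔ z = x then 1 else 0))) = if g = 1 then 0 else 2 := by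
    intro g
    by_cases hg : g = 1
    · simp [hg]
    obtain ⟨x, y, h⟩ := hfix g hg
    simp only [ne_eq, hg, not_false_eq_true, true_and, if_false, h, Finset.sum_add_distrib,
      ← Finset.card_filter]
    by_cases hxy : x = y
    · subst hxy
      have h1 : (Finset.univ.filter fun z => z = x ∨ z = x) = {x} := by ext; simp
      have h2 : (Finset.univ.filter fun w => ∀ z, z = x ∨ z = x ↔ z = w) = {x} := by
        ext w
        simp only [or_self, Finset.mem_filter, Finset.mem_univ, true_and, Finset.mem_singleton]
        exact ⟨fun h => ((h x).1 rfl).symm, fun h => by simp [h]⟩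
      rw [h1, h2]; simp
    · have h1 : (Finset.univ.filter fun z => z = x ∨ z = y) = {x, y} := by ext; simp
      have h2 : (Finset.univ.filter fun w => ∀ z, z = x ∨ z = y ↔ z = w) = ∅ := by
        ext w
        simp only [Finset.mem_filter, Finset.mem_univ, true_and, Finset.notMem_empty, iff_false]
        intro h
        exact hxy (((h x).1 (Or.inl rfl)).trans ((h y).1 (Or.inr rfl)).symm)
      rw [h1, h2, Finset.card_pair hxy]; simp
  have h1 : ∑ x : X, ((nontrivialFixers G x).card + (parabolicFixers G x).card) =
      ∑ g : G, if g = 1 then 0 else 2 := by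
    simp_rw [← key, nontrivialFixers, parabolicFixers, Finset.card_filter,
      ← Finset.sum_add_distrib]
    rw [Finset.sum_comm]
    refine Finset.sum_congr rfl fun _ _ => Finset.sum_congr rfl fun _ _ => ?_
    congr!
  have h2 : (∑ g : G, if g = 1 then 0 else 2) + 2 = 2 * Fintype.card G := by
    rw [← Finset.sum_erase_add _ _ (Finset.mem_univ (1 : G)), Finset.sum_congr rfl
      (g := fun _ => 2) (fun g hg => by simp [Finset.ne_of_mem_erase hg])]
    simp only [Finset.sum_const, Finset.card_erase_of_mem (Finset.mem_univ _), Finset.card_univ,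
      smul_eq_mul, if_true, add_zero]
    have := Fintype.card_pos (α := G)
    omega
  rw [h1, h2]

open Classical in
theorem sum_orbit_card_fixers [Fintype G] [Fintype X] (x : X) :
    ∑ y ∈ (MulAction.orbit G x).toFinset,
        ((nontrivialFixers G y).card + (parabolicFixers G y).card) =
      Nat.card (MulAction.orbit G x) *
        ((nontrivialFixers G x).card + (parabolicFixers G x).card) := by
  classical
  rw [Finset.sum_congr rfl (g := fun _ => (nontrivialFixers G x).card +
    (parabolicFixers G x).card), Finset.sum_const, Set.toFinset_card, Nat.card_eq_fintype_card,
    smul_eq_mul]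
  intro y hy
  obtain ⟨a, rfl⟩ := Set.mem_toFinset.1 hy
  simp only [card_nontrivialFixers_smul, card_parabolicFixers_smul]

/-- A Riemann–Hurwitz type computation: for a group action in which nontrivial elements have one
or two fixed points, an orbit with at least two parabolic elements per point and a further orbit
with nontrivial stabilizers determine each other's size. -/
theorem card_orbit_eq_of_parabolic [Fintype G] [Fintype X]
    (hfix : ∀ g : G, g ≠ 1 → ∃ x y : X, ∀ z, g • z = z ↔ z = x ∨ z = y) {x y : X}
    (hxy : y ∉ MulAction.orbit G x) (hx : 2 ≤ (parabolicFixers G x).card)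
    (hy : 1 ≤ (nontrivialFixers G y).card) :
    Nat.card (MulAction.orbit G y) =
      2 + Nat.card (MulAction.orbit G x) * ((parabolicFixers G x).card - 1) := by
  classical
  have hsum := sum_card_fixers hfix
  rw [← Nat.card_eq_fintype_card] at hsum
  have hdisj : ∀ {x y : X}, y ∉ MulAction.orbit G x →
      Disjoint (MulAction.orbit G x).toFinset (MulAction.orbit G y).toFinset := by
    intro x y h
    rw [Set.disjoint_toFinset]
    refine (MulAction.orbit.eq_or_disjoint x y).resolve_left fun e => h ?_
    rw [e]; exact MulAction.mem_orbit_self y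
  have ox := card_orbit_mul_nontrivialFixers (G := G) x
  have oy := card_orbit_mul_nontrivialFixers (G := G) y
  have sx := sum_orbit_card_fixers (G := G) x
  have sy := sum_orbit_card_fixers (G := G) y
  have hpos : ∀ z : X, 0 < Nat.card (MulAction.orbit G z) := fun z =>
    have : Nonempty (MulAction.orbit G z) := ⟨⟨z, MulAction.mem_orbit_self z⟩⟩
    Nat.card_pos
  have px := hpos x
  have py := hpos y
  set f : X → ℕ := fun z => (nontrivialFixers G z).card + (parabolicFixers G z).card with hf
  obtain ⟨b, hb⟩ : ∃ b, (parabolicFixers G x).card = b + 2 := ⟨_, (Nat.sub_add_cancel hx).symm⟩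
  rw [hb] at sx ⊢
  set w := Nat.card (MulAction.orbit G x)
  set o := Nat.card (MulAction.orbit G y)
  set g := Nat.card G
  obtain ⟨a, ha⟩ : ∃ a, (nontrivialFixers G y).card = a + 1 := ⟨_, (Nat.sub_add_cancel hy).symm⟩
  rw [ha] at sy oy
  have hzero : ∀ z, z ∉ (MulAction.orbit G x).toFinset ∪ (MulAction.orbit G y).toFinset →
      f z = 0 := by
    intro z hz
    simp only [Finset.mem_union, Set.mem_toFinset, not_or] at hz
    have hA : (nontrivialFixers G z).card = 0 := by
      by_contra hA
      obtain ⟨c, hc⟩ := Nat.exists_eq_succ_of_ne_zero hA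
      have oz := card_orbit_mul_nontrivialFixers (G := G) z
      have sz := sum_orbit_card_fixers (G := G) z
      have hle := Finset.sum_le_univ_sum_of_nonneg (f := f)
        (s := ((MulAction.orbit G x).toFinset ∪ (MulAction.orbit G y).toFinset) ∪
          (MulAction.orbit G z).toFinset) (fun _ => Nat.zero_le _)
      rw [Finset.sum_union (Finset.disjoint_union_left.2 ⟨hdisj hz.1, hdisj hz.2⟩),
        Finset.sum_union (hdisj hxy), sx, sy, sz] at hle
      rw [hc] at oz hle
      have pz := hpos z
      set v := Nat.card (MulAction.orbit G z)
      simp only [Nat.succ_eq_add_one] at *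
      nlinarith [Nat.zero_le (w * b), Nat.zero_le (o * a), Nat.zero_le (v * c),
        Nat.zero_le (o * (parabolicFixers G y).card), Nat.zero_le (v * (parabolicFixers G z).card)]
    have hB : (parabolicFixers G z).card ≤ (nontrivialFixers G z).card :=
      Finset.card_le_card fun g hg => by
        simp only [parabolicFixers, nontrivialFixers, Finset.mem_filter] at hg ⊢
        exact ⟨hg.1, hg.2.1, (hg.2.2 z).2 rfl⟩
    simp only [hf]; omega
  rw [← Finset.sum_subset (Finset.subset_univ _) (fun z _ hz => hzero z hz),
    Finset.sum_union (hdisj hxy), sx, sy] at hsum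
  have hp : (parabolicFixers G y).card = 0 := by
    by_contra hp
    obtain ⟨c, hc⟩ := Nat.exists_eq_succ_of_ne_zero hp
    rw [hc] at hsum
    simp only [Nat.succ_eq_add_one] at hsum
    nlinarith [Nat.zero_le (w * b), Nat.zero_le (o * c)]
  rw [hp] at hsum
  have : b + 2 - 1 = b + 1 := by omega
  rw [this]
  nlinarith

end FixedPoints

theorem eq_one_of_orbit_count {P d f a : ℕ} (hP : 3 ≤ P) (hd : d + 1 ≤ P) (hd0 : 1 ≤ d)
    (hf : 1 ≤ f) (ha : Even a)
    (h : a * (2 + (1 + f * P) * (P - 2)) = (1 + f * P) * (P * d)) : f = 1 := by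
  obtain ⟨Q, rfl⟩ : ∃ Q, P = Q + 2 := ⟨P - 2, by omega⟩
  obtain ⟨a, rfl⟩ := ha
  simp only [Nat.add_sub_cancel] at h
  have h1 : (a + a) * (1 + f * Q) = (1 + f * (Q + 2)) * d := by
    apply Nat.eq_of_mul_eq_mul_left (show 0 < Q + 2 by omega)
    linarith
  have hc : 1 + f * Q ∣ 2 * d := by
    have hcop : Nat.Coprime (1 + f * Q) f := by simp
    refine hcop.dvd_of_dvd_mul_left ((Nat.dvd_add_right (Dvd.intro d rfl)).1 ?_)
    exact ⟨a + a, by linarith⟩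
  have hle := Nat.le_of_dvd (by omega) hc
  rcases (by omega : f = 1 ∨ f = 2 ∨ 3 ≤ f) with rfl | rfl | hf3
  · rfl
  · exfalso
    have h2 : 1 + 2 * Q ∣ d := by
      refine Nat.Coprime.dvd_of_dvd_mul_left ?_ hc
      simp
    have := Nat.le_of_dvd (by omega) h2
    omega
  · exfalso
    have hQ : Q = 1 := by nlinarith
    subst hQ
    have : f ≤ 3 := by omega
    have hf' : f = 3 := by omega
    subst hf'
    omega

/-- An additive subgroup of a field of odd characteristic that contains `1` and `s` and is stable
under `v ↦ s / v` contains all powers of `s`. -/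
theorem pow_mem_of_div_mem {E : Type*} [Field E] [Finite E] (h2 : (2 : E) ≠ 0) {s : E}
    (hs0 : s ≠ 0) (V : AddSubgroup E) (h1 : (1 : E) ∈ V) (hs : s ∈ V)
    (hdiv : ∀ v ∈ V, v ≠ 0 → s / v ∈ V) (n : ℕ) : s ^ n ∈ V := by
  have hsq : ∀ v ∈ V, v * v ∈ V := by
    intro v hv
    by_cases hv0 : v = 0
    · simp [hv0, V.zero_mem]
    by_cases hv1 : 1 - v = 0
    · rw [← sub_eq_zero.1 hv1]; simpa
    have hsum := V.add_mem (hdiv v hv hv0) (hdiv _ (V.sub_mem h1 hv) hv1)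
    have e : s / v + s / (1 - v) = s / (v * (1 - v)) := by field_simp; ring
    rw [e] at hsum
    have := hdiv _ hsum (div_ne_zero hs0 (mul_ne_zero hv0 hv1))
    rw [div_div_cancel₀ hs0] at this
    have := V.sub_mem hv this
    convert this using 1; ring
  have hhalf : ∀ v : E, v + v ∈ V → v ∈ V := by
    intro v hv
    obtain ⟨p, hp⟩ := CharP.exists E
    have hpp := (CharP.char_is_prime_or_zero E p).resolve_right (CharP.char_ne_zero_of_finite E p)
    have hodd := hpp.odd_of_ne_two fun e => h2 (by subst e; exact_mod_cast CharP.cast_eq_zero E 2)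
    obtain ⟨m, rfl⟩ := hodd
    have := V.nsmul_mem hv (m + 1)
    convert this using 1
    have h0 : ((2 * m + 1 : ℕ) : E) = 0 := CharP.cast_eq_zero E _
    rw [nsmul_eq_mul]
    push_cast at h0 ⊢
    linear_combination (-v) * h0
  induction n with
  | zero => simpa
  | succ n ih =>
    apply hhalf
    have := V.sub_mem (V.sub_mem (hsq _ (V.add_mem ih hs)) (hsq _ ih)) (hsq _ hs)
    convert this using 1
    ring

section Moebius

open OnePoint GeneralLinearGroup

variable {E : Type*} [Field E] [DecidableEq E]

/-- The permutation `z ↦ z + b` of the projective line. -/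
noncomputable def translation (b : E) : Equiv.Perm (OnePoint E) :=
  MulAction.toPermHom (GL (Fin 2) E) (OnePoint E) (upperRightHom b)

@[simp]
theorem translation_infty (b : E) : translation b (∞ : OnePoint E) = ∞ := by
  simp [translation, smul_infty_eq_ite]

@[simp]
theorem translation_coe (b x : E) : translation b (x : OnePoint E) = ((x + b : E) : OnePoint E) := by
  simp [translation, smul_some_eq_ite]

theorem translation_add (a b : E) : translation (a + b) = translation a * translation b := by
  rw [translation, AddChar.map_add_eq_mul, map_mul]
  rfl

theorem translation_zero : translation (0 : E) = 1 := by
  rw [translation, AddChar.map_zero_eq_one, map_one]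

theorem translation_neg (a : E) : translation (-a) = (translation a)⁻¹ := by
  rw [eq_inv_iff_mul_eq_one, ← translation_add, neg_add_cancel, translation_zero]

theorem translation_injective : Function.Injective (translation (E := E)) := fun a b h => by
  simpa using congr($h ((0 : E) : OnePoint E))

theorem exists_fixedPoints_smul (h2 : (2 : E) ≠ 0) (M : GL (Fin 2) E)
    (hM : ∃ r, r * r = (M 0 0 - M 1 1) ^ 2 + 4 * (M 0 1 * M 1 0))
    (h1 : MulAction.toPermHom (GL (Fin 2) E) (OnePoint E) M ≠ 1) :
    ∃ x y : OnePoint E, ∀ z, M • z = z ↔ z = x ∨ z = y := by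
  have hdet : M 0 0 * M 1 1 - M 0 1 * M 1 0 ≠ 0 := by
    have := M.det_ne_zero
    rwa [det_fin_two] at this
  by_cases hc : M 1 0 = 0
  · rw [hc, mul_zero, sub_zero] at hdet
    have ha := left_ne_zero_of_mul hdet
    have hd := right_ne_zero_of_mul hdet
    by_cases had : M 0 0 = M 1 1
    · have hb : M 0 1 ≠ 0 := by
        intro hb
        apply h1
        ext z
        cases z with
        | infty => simp [smul_infty_eq_ite, hc]
        | coe z => simp [smul_some_eq_ite, hc, hb, hd, had]
      refine ⟨∞, ∞, fun z => ?_⟩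
      cases z with
      | infty => simp [smul_infty_eq_ite, hc]
      | coe z =>
        simp only [smul_some_eq_ite, hc, zero_mul, zero_add, hd, if_false, had, coe_ne_infty,
          or_self, iff_false, coe_eq_coe]
        intro h
        rw [div_eq_iff hd] at h
        apply hb
        linear_combination h
    · have had' : M 1 1 - M 0 0 ≠ 0 := sub_ne_zero.2 (Ne.symm had)
      refine ⟨∞, ((M 0 1 / (M 1 1 - M 0 0) : E) : OnePoint E), fun z => ?_⟩
      cases z with
      | infty => simp [smul_infty_eq_ite, hc]
      | coe z =>
        simp only [smul_some_eq_ite, hc, zero_mul, zero_add, hd, if_false, coe_ne_infty,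
          false_or, coe_eq_coe]
        rw [div_eq_iff hd, eq_div_iff had']
        constructor <;> intro h <;> linear_combination -h
  · obtain ⟨r, hr⟩ := hM
    have hc2 : 2 * M 1 0 ≠ 0 := mul_ne_zero h2 hc
    refine ⟨(((M 0 0 - M 1 1 + r) / (2 * M 1 0) : E) : OnePoint E),
      (((M 0 0 - M 1 1 - r) / (2 * M 1 0) : E) : OnePoint E), fun z => ?_⟩
    cases z with
    | infty => simp [smul_infty_eq_ite, hc]
    | coe z =>
      simp only [coe_eq_coe]
      rw [eq_div_iff hc2, eq_div_iff hc2, ← sub_eq_zero (b := _ + r), ← sub_eq_zero (b := _ - r),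
        ← mul_eq_zero, smul_some_eq_ite]
      have e : (z * (2 * M 1 0) - (M 0 0 - M 1 1 + r)) * (z * (2 * M 1 0) - (M 0 0 - M 1 1 - r)) =
          4 * M 1 0 * (z * (M 1 0 * z + M 1 1) - (M 0 0 * z + M 0 1)) := by
        linear_combination -hr
      have h4 : 4 * M 1 0 ≠ 0 := by
        have : (4 : E) = 2 * 2 := by norm_num
        rw [this]
        exact mul_ne_zero (mul_ne_zero h2 h2) hc
      rw [e, mul_eq_zero, or_iff_right h4, sub_eq_zero]
      split_ifs with h
      · simp only [infty_ne_coe, h, mul_zero, false_iff]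
        intro h'
        apply hdet
        linear_combination M 0 0 * h + M 1 0 * h'
      · rw [coe_eq_coe, div_eq_iff h, eq_comm]

theorem toPermHom_eq_translation (M : GL (Fin 2) E)
    (h : ∀ z : OnePoint E, M • z = z ↔ z = ∞) :
    ∃ b, MulAction.toPermHom (GL (Fin 2) E) (OnePoint E) M = translation b := by
  have hc : M 1 0 = 0 := smul_infty_eq_self_iff.1 ((h ∞).2 rfl)
  have hdet : M 0 0 * M 1 1 - M 0 1 * M 1 0 ≠ 0 := by
    have := M.det_ne_zero
    rwa [det_fin_two] at this
  rw [hc, mul_zero, sub_zero] at hdet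
  have hd := right_ne_zero_of_mul hdet
  have had : M 0 0 = M 1 1 := by
    by_contra had
    have had' : M 1 1 - M 0 0 ≠ 0 := sub_ne_zero.2 (Ne.symm had)
    refine coe_ne_infty _ ((h ((M 0 1 / (M 1 1 - M 0 0) : E) : OnePoint E)).1 ?_)
    simp only [smul_some_eq_ite, hc, zero_mul, zero_add, hd, if_false, coe_eq_coe]
    field_simp
    ring
  refine ⟨M 0 1 / M 1 1, ?_⟩
  ext z
  cases z with
  | infty => simp [smul_infty_eq_ite, hc]
  | coe z =>
    simp only [MulAction.toPermHom_apply, MulAction.toPerm_apply, smul_some_eq_ite, hc, zero_mul,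
      zero_add, hd, if_false, had, translation_coe]
    congr 2
    field_simp

/-- Conjugating a translation by a Möbius map that fixes `∞`. -/
theorem exists_conj_translation (M : GL (Fin 2) E) (h : M • (∞ : OnePoint E) = ∞) :
    ∃ t : E, t ≠ 0 ∧ MulAction.toPermHom (GL (Fin 2) E) (OnePoint E) M * translation 1 *
      (MulAction.toPermHom (GL (Fin 2) E) (OnePoint E) M)⁻¹ = translation t ∧
      (t = 1 → ∃ b, MulAction.toPermHom (GL (Fin 2) E) (OnePoint E) M = translation b) := by
  have hc : M 1 0 = 0 := smul_infty_eq_self_iff.1 h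
  have hdet : M 0 0 * M 1 1 - M 0 1 * M 1 0 ≠ 0 := by
    have := M.det_ne_zero
    rwa [det_fin_two] at this
  rw [hc, mul_zero, sub_zero] at hdet
  have ha := left_ne_zero_of_mul hdet
  have hd := right_ne_zero_of_mul hdet
  refine ⟨M 0 0 / M 1 1, div_ne_zero ha hd, ?_, fun ht => ?_⟩
  · rw [mul_inv_eq_iff_eq_mul]
    ext z
    cases z with
    | infty => simp [smul_infty_eq_ite, hc]
    | coe z =>
      simp only [Equiv.Perm.mul_apply, MulAction.toPermHom_apply, MulAction.toPerm_apply,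
        smul_some_eq_ite, hc, zero_mul, zero_add, hd, if_false, translation_coe]
      congr 2
      field_simp
      ring
  · rw [div_eq_one_iff_eq hd] at ht
    refine ⟨M 0 1 / M 1 1, ?_⟩
    ext z
    cases z with
    | infty => simp [smul_infty_eq_ite, hc]
    | coe z =>
      simp only [MulAction.toPermHom_apply, MulAction.toPerm_apply, smul_some_eq_ite, hc, zero_mul,
        zero_add, hd, if_false, ht, translation_coe]
      congr 2
      field_simp

end Moebius

/-- The index of a subgroup `T` in a group `S` is less than `|T|` if `S` conjugates a nontrivial
`τ ∈ T` into `T` and only elements of `T` commute with `τ`. -/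
theorem exists_card_eq_mul_of_conj_mem {Γ : Type*} [Group Γ] [Finite Γ] {S T : Subgroup Γ}
    (hTS : T ≤ S) {τ : Γ} (hτ1 : τ ≠ 1) (hconj : ∀ σ ∈ S, σ * τ * σ⁻¹ ∈ T)
    (hcomm : ∀ σ ∈ S, σ * τ * σ⁻¹ = τ → σ ∈ T) (hTτ : ∀ σ ∈ T, σ * τ * σ⁻¹ = τ) :
    ∃ d, Nat.card S = Nat.card T * d ∧ d + 1 ≤ Nat.card T := by
  classical
  have hwd : ∀ a b : S, QuotientGroup.leftRel (T.subgroupOf S) a b ↔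
      (a : Γ) * τ * (a : Γ)⁻¹ = (b : Γ) * τ * (b : Γ)⁻¹ := by
    intro a b
    rw [QuotientGroup.leftRel_apply, Subgroup.mem_subgroupOf]
    have e : ((a⁻¹ * b : S) : Γ) * τ * ((a⁻¹ * b : S) : Γ)⁻¹ = τ ↔
        (a : Γ) * τ * (a : Γ)⁻¹ = (b : Γ) * τ * (b : Γ)⁻¹ := by
      simp only [Subgroup.coe_mul, Subgroup.coe_inv, _root_.mul_inv_rev, inv_inv]
      constructor
      · intro h
        conv_lhs => rw [← h]
        group
      · intro h
        have : (a : Γ)⁻¹ * b * τ * ((b : Γ)⁻¹ * a) = (a : Γ)⁻¹ * (b * τ * (b : Γ)⁻¹) * a := by group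
        rw [this, ← h]; group
    rw [← e]
    exact ⟨fun h => hTτ _ h, fun h => hcomm _ (a⁻¹ * b).2 h⟩
  refine ⟨(T.subgroupOf S).index, ?_, ?_⟩
  · rw [← (T.subgroupOf S).card_mul_index, Nat.card_congr (Subgroup.subgroupOfEquivOfLe hTS).toEquiv]
  · let f : S ⧸ T.subgroupOf S → {t : T // t ≠ 1} := Quotient.lift
      (fun a : S => ⟨⟨a * τ * (a : Γ)⁻¹, hconj a a.2⟩, fun h => hτ1 (by
        have := congrArg Subtype.val h
        rwa [Subgroup.coe_one, conj_eq_one_iff] at this)⟩)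
      (fun a b h => Subtype.ext (Subtype.ext ((hwd a b).1 h)))
    have hf : Function.Injective f := by
      rintro ⟨a⟩ ⟨b⟩ h
      exact Quotient.sound ((hwd a b).2 (congrArg (fun x => (x.1 : Γ)) h))
    have h1 := Nat.card_le_card_of_injective f hf
    have := Fintype.ofFinite T
    have h2 : Nat.card {t : T // t ≠ 1} + 1 = Nat.card T := by
      rw [Nat.card_eq_fintype_card, Nat.card_eq_fintype_card, Fintype.card_subtype_compl,
        Fintype.card_subtype_eq]
      exact Nat.sub_add_cancel Fintype.card_pos
    rw [Subgroup.index]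
    omega

section Core

open OnePoint GeneralLinearGroup
open scoped Pointwise

variable {E : Type*} [Field E] [DecidableEq E]

/-- The additive group of all `b` such that `z ↦ z + b` belongs to `G`. -/
def translationSubgroup (G : Subgroup (Equiv.Perm (OnePoint E))) : AddSubgroup E where
  carrier := {b | translation b ∈ G}
  zero_mem' := by simp [translation_zero, G.one_mem]
  add_mem' ha hb := by
    simp only [Set.mem_ofPred_eq, translation_add] at *
    exact G.mul_mem ha hb
  neg_mem' ha := by
    simp only [Set.mem_ofPred_eq, translation_neg] at *
    exact G.inv_mem ha

theorem mem_translationSubgroup {G : Subgroup (Equiv.Perm (OnePoint E))} {b : E} :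
    b ∈ translationSubgroup G ↔ translation b ∈ G := Iff.rfl

theorem card_parabolicFixers_infty [Finite E] (G : Subgroup (Equiv.Perm (OnePoint E)))
    [Fintype G]
    (hG : ∀ σ ∈ G, ∃ M : GL (Fin 2) E,
      σ = MulAction.toPermHom (GL (Fin 2) E) (OnePoint E) M) :
    (parabolicFixers G (∞ : OnePoint E)).card + 1 = Nat.card (translationSubgroup G) := by
  classical
  have := Fintype.ofFinite (translationSubgroup G)
  let φ : translationSubgroup G → G := fun b => ⟨translation b, b.2⟩
  have hφ : Function.Injective φ := fun a b h =>
    Subtype.ext (translation_injective (congrArg Subtype.val h))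
  have himg : parabolicFixers G (∞ : OnePoint E) = (Finset.univ.erase 0).image φ := by
    ext σ
    simp only [parabolicFixers, Finset.mem_filter, Finset.mem_univ, true_and, Finset.mem_image,
      Finset.mem_erase, and_true]
    constructor
    · rintro ⟨h1, h⟩
      obtain ⟨M, hM⟩ := hG σ σ.2
      obtain ⟨b, hb⟩ := toPermHom_eq_translation M (fun z => by
        rw [← h z, Subgroup.smul_def, hM]; rfl)
      rw [← hM] at hb
      refine ⟨⟨b, by rw [mem_translationSubgroup, ← hb]; exact σ.2⟩, ?_, Subtype.ext hb.symm⟩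
      rintro h0
      apply h1
      rw [Subtype.ext_iff] at h0
      ext1
      rw [hb, show b = 0 from h0, translation_zero]
      rfl
    · rintro ⟨b, hb0, rfl⟩
      have hb0' : (b : E) ≠ 0 := fun h => hb0 (Subtype.ext h)
      refine ⟨fun h => hb0 (hφ (h.trans ?_)), fun z => ?_⟩
      · exact Subtype.ext translation_zero.symm
      · change translation (b : E) z = z ↔ _
        cases z with
        | infty => simp
        | coe z => simp [hb0']
  rw [himg, Finset.card_image_of_injective _ hφ, Finset.card_erase_of_mem (Finset.mem_univ _),
    Finset.card_univ, Nat.card_eq_fintype_card]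
  exact Nat.sub_add_cancel Fintype.card_pos

theorem exists_card_stabilizer_infty [Finite E] (G : Subgroup (Equiv.Perm (OnePoint E)))
    (hG : ∀ σ ∈ G, ∃ M : GL (Fin 2) E,
      σ = MulAction.toPermHom (GL (Fin 2) E) (OnePoint E) M)
    (hτ : translation 1 ∈ G) :
    ∃ d, Nat.card (MulAction.stabilizer G (∞ : OnePoint E)) =
      Nat.card (translationSubgroup G) * d ∧ d + 1 ≤ Nat.card (translationSubgroup G) := by
  have : Finite (OnePoint E) := inferInstanceAs (Finite (Option E))
  let T : Subgroup G :=
    { carrier := {σ | ∃ b, (σ : Equiv.Perm (OnePoint E)) = translation b}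
      one_mem' := ⟨0, translation_zero.symm⟩
      mul_mem' := by
        rintro _ _ ⟨a, ha⟩ ⟨b, hb⟩
        exact ⟨a + b, by rw [Subgroup.coe_mul, ha, hb, translation_add]⟩
      inv_mem' := by
        rintro _ ⟨a, ha⟩
        exact ⟨-a, by rw [Subgroup.coe_inv, ha, translation_neg]⟩ }
  have hT : Nat.card (translationSubgroup G) = Nat.card T := by
    refine Nat.card_eq_of_bijective
      (fun b : translationSubgroup G => (⟨⟨translation b, b.2⟩, b, rfl⟩ : T)) ⟨fun a b h => ?_, ?_⟩
    · exact Subtype.ext (translation_injective congr(($h : G).1))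
    · rintro ⟨⟨σ, hσ⟩, b, hb⟩
      change σ = translation b at hb
      subst hb
      exact ⟨⟨b, hσ⟩, rfl⟩
  have key : ∀ σ ∈ MulAction.stabilizer G (∞ : OnePoint E), ∃ t : E, t ≠ 0 ∧
      (σ : Equiv.Perm (OnePoint E)) * translation 1 * (σ : Equiv.Perm (OnePoint E))⁻¹ =
        translation t ∧ (t = 1 → σ ∈ T) := by
    intro σ hσ
    obtain ⟨M, hM⟩ := hG σ σ.2
    have h : M • (∞ : OnePoint E) = ∞ := by
      have h' : (σ : Equiv.Perm (OnePoint E)) ∞ = ∞ := hσ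
      rwa [hM] at h'
    obtain ⟨t, h1, h2, h3⟩ := exists_conj_translation M h
    rw [← hM] at h2 h3
    exact ⟨t, h1, h2, h3⟩
  rw [hT]
  refine exists_card_eq_mul_of_conj_mem (τ := ⟨translation 1, hτ⟩) ?_ ?_ ?_ ?_ ?_
  · rintro σ ⟨b, hb⟩
    change (σ : Equiv.Perm (OnePoint E)) ∞ = ∞
    rw [hb, translation_infty]
  · intro h
    exact one_ne_zero (translation_injective ((congrArg Subtype.val h).trans translation_zero.symm))
  · intro σ hσ
    obtain ⟨t, -, h, -⟩ := key σ hσ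
    exact ⟨t, h⟩
  · intro σ hσ h'
    obtain ⟨t, -, h, h3⟩ := key σ hσ
    exact h3 (translation_injective (h.symm.trans (congrArg Subtype.val h')))
  · rintro ⟨σ, hσ⟩ ⟨b, hb⟩
    change σ = translation b at hb
    subst hb
    ext1
    change translation b * translation 1 * (translation b)⁻¹ = translation 1
    rw [← translation_neg, ← translation_add, ← translation_add]
    congr 1; ring

/-- Let `s` be a nonsquare in a subfield `k` of `E`, every element of which is a square in `E`.
A group of Möbius transformations with coefficients in `k` that contains `z ↦ z + 1` and
`z ↦ 1 / (s z)` contains the translations by all powers of `s`. -/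
theorem translation_pow_mem [Finite E] (h2 : (2 : E) ≠ 0) (k : Subfield E)
    (hsq : ∀ a ∈ k, ∃ r : E, r * r = a) {s : E} (hs : s ∈ k) (hs0 : s ≠ 0)
    (hns : ∀ r ∈ k, r * r ≠ s) (G : Subgroup (Equiv.Perm (OnePoint E)))
    (hG : ∀ σ ∈ G, ∃ M : GL (Fin 2) E, (∀ i j, M i j ∈ k) ∧
      σ = MulAction.toPermHom (GL (Fin 2) E) (OnePoint E) M)
    (hτ : translation 1 ∈ G) {γ : Equiv.Perm (OnePoint E)} (hγ : γ ∈ G)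
    (hγinf : γ ∞ = ((0 : E) : OnePoint E)) (hγzero : γ ((0 : E) : OnePoint E) = ∞)
    (hγcoe : ∀ x : E, x ≠ 0 → γ x = ((1 / (s * x) : E) : OnePoint E)) (n : ℕ) :
    translation (s ^ n / s) ∈ G := by
  classical
  have : Finite (OnePoint E) := inferInstanceAs (Finite (Option E))
  have := Fintype.ofFinite (OnePoint E)
  have := Fintype.ofFinite G
  have hG' : ∀ σ ∈ G, ∃ M : GL (Fin 2) E,
      σ = MulAction.toPermHom (GL (Fin 2) E) (OnePoint E) M :=
    fun σ hσ => (hG σ hσ).imp fun M hM => hM.2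
  have hfix : ∀ σ : G, σ ≠ 1 → ∃ x y : OnePoint E, ∀ z, σ • z = z ↔ z = x ∨ z = y := by
    intro σ hσ
    obtain ⟨M, hMk, hM⟩ := hG σ σ.2
    obtain ⟨x, y, h⟩ := exists_fixedPoints_smul h2 M
      (hsq _ (k.add_mem (k.pow_mem (k.sub_mem (hMk 0 0) (hMk 1 1)) 2)
        (k.mul_mem (ofNat_mem k 4) (k.mul_mem (hMk 0 1) (hMk 1 0)))))
      (fun h => hσ (Subtype.ext (hM.trans h)))
    refine ⟨x, y, fun z => ?_⟩
    rw [← h z, Subgroup.smul_def, hM]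
    rfl
  set U := translationSubgroup G with hU
  have h1U : (1 : E) ∈ U := hτ
  have hP : 3 ≤ Nat.card U := by
    have hinj : Function.Injective (![0, ⟨1, h1U⟩, -⟨1, h1U⟩] : Fin 3 → U) := by
      have hne : (1 : E) ≠ -1 := fun h => h2 (by linear_combination h)
      intro i j
      fin_cases i <;> fin_cases j <;> simp [Subtype.ext_iff, hne, hne.symm]
    simpa using Nat.card_le_card_of_injective _ hinj
  have hpar := card_parabolicFixers_infty G hG'
  obtain ⟨d, hd, hdle⟩ := exists_card_stabilizer_infty G hG' hτ
  rw [← hU] at hpar hd hdle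
  set W : Set E := {x | (x : OnePoint E) ∈ MulAction.orbit G (∞ : OnePoint E)} with hW
  have hinfty : (∞ : OnePoint E) ∈ MulAction.orbit G (∞ : OnePoint E) :=
    MulAction.mem_orbit_self _
  have hsmul : ∀ σ ∈ G, ∀ z ∈ MulAction.orbit G (∞ : OnePoint E),
      σ z ∈ MulAction.orbit G (∞ : OnePoint E) := fun σ hσ z hz =>
    MulAction.mem_orbit_of_mem_orbit (⟨σ, hσ⟩ : G) hz
  have h0W : (0 : E) ∈ W := by
    have := hsmul γ hγ _ hinfty
    rwa [hγinf] at this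
  have hWadd : ∀ x ∈ W, ∀ b ∈ U, x + b ∈ W := by
    intro x hx b hb
    have := hsmul _ hb _ hx
    rwa [translation_coe] at this
  have hUW : (U : Set E) ⊆ W := fun b hb => by simpa using hWadd 0 h0W b hb
  have hcardorbit : Nat.card (MulAction.orbit G (∞ : OnePoint E)) = 1 + W.ncard := by
    have : MulAction.orbit G (∞ : OnePoint E) = insert ∞ ((↑) '' W) := by
      ext z
      cases z with
      | infty => simp [hinfty]
      | coe z => simp [hW]
    rw [Nat.card_coe_set_eq, this, Set.ncard_insert_of_notMem (by simp) (Set.toFinite _),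
      Set.ncard_image_of_injective _ OnePoint.coe_injective, add_comm]
  obtain ⟨f, hf⟩ : ∃ f, W.ncard = Nat.card U * f := by
    have h := AddSubgroup.card_add_eq_card_addSubgroup_add_card_quotient U W
    have e : W + (U : Set E) = W := by
      apply Set.Subset.antisymm
      · rintro _ ⟨x, hx, b, hb, rfl⟩
        exact hWadd x hx b hb
      · exact fun x hx => ⟨x, hx, 0, U.zero_mem, add_zero x⟩
    rw [e, Nat.card_coe_set_eq] at h
    exact ⟨_, h⟩
  have hf1 : 1 ≤ f := by
    rcases Nat.eq_zero_or_pos f with rfl | h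
    · rw [mul_zero, Set.ncard_eq_zero (Set.toFinite _)] at hf
      simp [hf] at h0W
    · exact h
  obtain ⟨r, hr⟩ := hsq s hs
  have hr0 : r ≠ 0 := by rintro rfl; exact hs0 (by simpa using hr.symm)
  have hγr : γ ((1 / r : E) : OnePoint E) = ((1 / r : E) : OnePoint E) := by
    rw [hγcoe _ (one_div_ne_zero hr0), ← hr]
    congr 1
    field_simp
  have hγ1 : γ ≠ 1 := by
    rintro rfl
    exact infty_ne_coe _ hγinf
  have hγγ : γ * γ = 1 := by
    ext z
    cases z with
    | infty => simp [hγinf, hγzero]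
    | coe z =>
      by_cases hz : z = 0
      · simp [hz, hγinf, hγzero]
      · rw [Equiv.Perm.mul_apply, hγcoe z hz, hγcoe _ (one_div_ne_zero (mul_ne_zero hs0 hz)),
          Equiv.Perm.one_apply]
        congr 2
        field_simp
  have hrorbit : ((1 / r : E) : OnePoint E) ∉ MulAction.orbit G (∞ : OnePoint E) := by
    rintro ⟨σ, hσ⟩
    obtain ⟨M, hMk, hM⟩ := hG σ σ.2
    have h : M • (∞ : OnePoint E) = ((1 / r : E) : OnePoint E) := by
      rw [← hσ]
      change _ = (σ : Equiv.Perm (OnePoint E)) ∞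
      rw [hM]
      rfl
    rw [smul_infty_eq_ite] at h
    split_ifs at h
    · exact infty_ne_coe _ h
    · rw [coe_eq_coe] at h
      refine hns r ?_ hr
      have : (1 / r)⁻¹ ∈ k := h ▸ k.inv_mem (k.div_mem (hMk 0 0) (hMk 1 0))
      simpa using this
  have heven : Even (Nat.card (MulAction.stabilizer G ((1 / r : E) : OnePoint E))) := by
    have ho : orderOf (⟨γ, hγ⟩ : G) = 2 :=
      orderOf_eq_prime (by rw [pow_two]; exact Subtype.ext hγγ)
        (fun h => hγ1 (congrArg Subtype.val h))
    rw [even_iff_two_dvd, ← ho]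
    exact Subgroup.orderOf_dvd_natCard _ hγr
  have hnf : 1 ≤ (nontrivialFixers G ((1 / r : E) : OnePoint E)).card := by
    rw [← card_nontrivialFixers_add_one] at heven
    rcases Nat.eq_zero_or_pos (nontrivialFixers G ((1 / r : E) : OnePoint E)).card with h | h
    · rw [h] at heven
      exact absurd heven (by decide)
    · exact h
  have hcount := card_orbit_eq_of_parabolic hfix hrorbit (by omega) hnf
  have hg1 := card_orbit_mul_nontrivialFixers (G := G) (∞ : OnePoint E)
  have hg2 := card_orbit_mul_nontrivialFixers (G := G) ((1 / r : E) : OnePoint E)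
  rw [card_nontrivialFixers_add_one, hcardorbit, hd, hf] at hg1
  rw [card_nontrivialFixers_add_one, hcount, hcardorbit, hf] at hg2
  have hf_one : f = 1 := by
    refine eq_one_of_orbit_count hP hdle ?_ hf1 heven ?_
    · rcases Nat.eq_zero_or_pos d with rfl | h
      · have := Nat.card_pos (α := MulAction.stabilizer G (∞ : OnePoint E))
        omega
      · exact h
    · have e : (parabolicFixers G (∞ : OnePoint E)).card - 1 = Nat.card U - 2 := by omega
      rw [e] at hg2
      rw [mul_comm f, mul_comm, hg2, hg1]
  have hWU : W = U := by
    refine (Set.eq_of_subset_of_ncard_le hUW ?_).symm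
    rw [hf, hf_one, mul_one]
    exact (Nat.card_coe_set_eq _).le
  have hinvU : ∀ x ∈ U, x ≠ 0 → 1 / (s * x) ∈ U := by
    intro x hx hx0
    have : (1 / (s * x)) ∈ W := by
      have := hsmul γ hγ _ (hUW hx)
      rwa [hγcoe x hx0] at this
    rwa [hWU] at this
  have := pow_mem_of_div_mem h2 hs0 (U.comap (AddMonoidHom.mulRight s⁻¹))
    (by simpa using hinvU 1 h1U one_ne_zero) (by simpa [hs0] using h1U)
    (fun v hv hv0 => by
      have := hinvU _ hv (mul_ne_zero hv0 (inv_ne_zero hs0))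
      simp only [AddSubgroup.mem_comap, AddMonoidHom.mulRight_apply] at this ⊢
      convert this using 1
      field_simp) n
  rw [div_eq_mul_inv]
  exact this

end Core

section Generation

open OnePoint GeneralLinearGroup
open scoped Pointwise

variable {K : Type*} [Field K]

/-- The matrix of the Möbius transformation `z ↦ 1 / (s z)`. -/
noncomputable def scaledInversion (s : Kˣ) : GL (Fin 2) K :=
  GeneralLinearGroup.mkOfDetNeZero !![0, 1; (s : K), 0] (by simp [det_fin_two_of])

theorem coe_scaledInversion (s : Kˣ) :
    (scaledInversion s : Matrix (Fin 2) (Fin 2) K) = !![0, 1; (s : K), 0] := rfl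

theorem scaledInversion_sq (s : Kˣ) : scaledInversion s ^ 2 = scalar (Fin 2) s := by
  ext i j
  fin_cases i <;> fin_cases j <;> simp [pow_two, coe_scaledInversion, GeneralLinearGroup.scalar]

theorem commute_scalar (c : Kˣ) (M : GL (Fin 2) K) :
    Commute (GeneralLinearGroup.scalar (Fin 2) c) M :=
  Units.ext (Matrix.scalar_commute (c : K) (fun r => mul_comm _ r) (M : Matrix (Fin 2) (Fin 2) K))

/-- Upper unipotent matrices. -/
def upperUnipotent (b : K) : SpecialLinearGroup (Fin 2) K := ⟨!![1, b; 0, 1], by simp⟩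

/-- Lower unipotent matrices. -/
def lowerUnipotent (b : K) : SpecialLinearGroup (Fin 2) K := ⟨!![1, 0; b, 1], by simp⟩

theorem coe_upperUnipotent (b : K) :
    (upperUnipotent b : Matrix (Fin 2) (Fin 2) K) = !![1, b; 0, 1] := rfl

theorem coe_lowerUnipotent (b : K) :
    (lowerUnipotent b : Matrix (Fin 2) (Fin 2) K) = !![1, 0; b, 1] := rfl

theorem upperUnipotent_pow (b : K) (n : ℕ) : upperUnipotent b ^ n = upperUnipotent (n * b) := by
  induction n with
  | zero => ext i j; fin_cases i <;> fin_cases j <;> simp [coe_upperUnipotent]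
  | succ n ih =>
    rw [pow_succ, ih]
    ext i j
    fin_cases i <;> fin_cases j <;> simp [coe_upperUnipotent]
    ring

theorem lowerUnipotent_pow (b : K) (n : ℕ) : lowerUnipotent b ^ n = lowerUnipotent (n * b) := by
  induction n with
  | zero => ext i j; fin_cases i <;> fin_cases j <;> simp [coe_lowerUnipotent]
  | succ n ih =>
    rw [pow_succ, ih]
    ext i j
    fin_cases i <;> fin_cases j <;> simp [coe_lowerUnipotent]
    ring

theorem toGL_upperUnipotent (b : K) :
    SpecialLinearGroup.toGL (upperUnipotent b) = upperRightHom b := by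
  ext i j
  fin_cases i <;> fin_cases j <;> simp [coe_upperUnipotent]

theorem conj_upperUnipotent (s : Kˣ) (b : K) :
    scaledInversion s * SpecialLinearGroup.toGL (upperUnipotent b) * (scaledInversion s)⁻¹ =
      SpecialLinearGroup.toGL (lowerUnipotent (s * b)) := by
  rw [mul_inv_eq_iff_eq_mul]
  ext i j
  fin_cases i <;> fin_cases j <;>
    simp [coe_upperUnipotent, coe_lowerUnipotent, coe_scaledInversion, mul_comm]

theorem conj_lowerUnipotent (s : Kˣ) :
    scaledInversion s * SpecialLinearGroup.toGL (lowerUnipotent (s : K)) * (scaledInversion s)⁻¹ =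
      SpecialLinearGroup.toGL (upperUnipotent 1) := by
  rw [mul_inv_eq_iff_eq_mul]
  ext i j
  fin_cases i <;> fin_cases j <;>
    simp [coe_upperUnipotent, coe_lowerUnipotent, coe_scaledInversion]

/-- Upper and lower unipotent matrices generate `SL₂`. -/
theorem eq_top_of_unipotent_mem (H : Subgroup (SpecialLinearGroup (Fin 2) K))
    (hu : ∀ b, upperUnipotent b ∈ H) (hl : ∀ b, lowerUnipotent b ∈ H) : H = ⊤ := by
  have key : ∀ M : SpecialLinearGroup (Fin 2) K, M 1 0 ≠ 0 → M ∈ H := by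
    intro M hM
    have hdet := M.det_coe
    rw [det_fin_two] at hdet
    have : M = upperUnipotent ((M 0 0 - 1) / M 1 0) * lowerUnipotent (M 1 0) *
        upperUnipotent ((M 1 1 - 1) / M 1 0) := by
      ext i j
      fin_cases i <;> fin_cases j <;>
        simp [coe_upperUnipotent, coe_lowerUnipotent, hM]
      · field_simp
        linear_combination -hdet
      · field_simp
        ring
    rw [this]
    exact H.mul_mem (H.mul_mem (hu _) (hl _)) (hu _)
  refine eq_top_iff.2 fun M _ => ?_
  by_cases hM : M 1 0 = 0
  · rw [← Subgroup.mul_mem_cancel_right H (hl 1)]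
    refine key _ ?_
    have hdet := M.det_coe
    rw [det_fin_two, hM, mul_zero, sub_zero] at hdet
    have hd : M 1 1 ≠ 0 := by
      intro h
      simp [h] at hdet
    simpa [coe_lowerUnipotent, hM, mul_apply, Fin.sum_univ_two] using hd
  · exact key M hM

theorem exists_scalar_of_toPermHom_map_eq_one {E : Type*} [Field E] [DecidableEq E] (f : K →+* E)
    (M : GL (Fin 2) K)
    (h : MulAction.toPermHom (GL (Fin 2) E) (OnePoint E) (GeneralLinearGroup.map f M) = 1) :
    ∃ c : Kˣ, M = scalar (Fin 2) c := by
  have hz (z : OnePoint E) : GeneralLinearGroup.map f M • z = z := congr($h z)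
  have h10 : M 1 0 = 0 := by
    have := hz ∞
    rw [smul_infty_eq_ite] at this
    simpa using this
  have hdet := M.det_ne_zero
  rw [det_fin_two, h10, mul_zero, sub_zero] at hdet
  have ha := left_ne_zero_of_mul hdet
  have hd := right_ne_zero_of_mul hdet
  have h01 : M 0 1 = 0 := by
    have := hz ((0 : E) : OnePoint E)
    rw [smul_some_eq_ite] at this
    simpa [h10, hd] using this
  have hdiag : M 0 0 = M 1 1 := by
    have := hz ((1 : E) : OnePoint E)
    rw [smul_some_eq_ite] at this
    exact f.injective (by simpa [h10, h01, hd, div_eq_one_iff_eq] using this)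
  refine ⟨Units.mk0 _ ha, ?_⟩
  ext i j
  fin_cases i <;> fin_cases j <;> simp [h10, h01, hdiag, GeneralLinearGroup.scalar]

theorem exists_mul_scalar_eq_upperRightHom [Finite K] (h2 : (2 : K) ≠ 0) (s : Kˣ)
    (hs : ∀ a : K, a ≠ 0 → ∃ n : ℕ, (s : K) ^ n = a) (b : K) :
    ∃ M ∈ Subgroup.closure {upperRightHom (1 : K), scaledInversion s}, ∃ c : Kˣ,
      M * scalar (Fin 2) c = upperRightHom b := by
  classical
  by_cases hb : b = 0
  · exact ⟨1, one_mem _, 1, by rw [hb, AddChar.map_zero_eq_one, map_one, mul_one]⟩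
  obtain ⟨n, hn⟩ := hs (b * s) (mul_ne_zero hb s.ne_zero)
  let E := (Polynomial.X ^ 2 - Polynomial.C (s : K)).SplittingField
  have : Finite E := Module.finite_of_finite K
  let f : K →+* E := algebraMap K E
  obtain ⟨r, hr⟩ : ∃ r : E, r * r = f s := by
    have hdeg : ((Polynomial.X ^ 2 - Polynomial.C (s : K)).map f).degree ≠ 0 := by
      rw [Polynomial.degree_map, Polynomial.degree_X_pow_sub_C two_pos]
      decide
    obtain ⟨r, hr⟩ := (Polynomial.SplittingField.splits _).exists_eval_eq_zero hdeg
    refine ⟨r, ?_⟩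
    simp only [Polynomial.map_sub, Polynomial.map_pow, Polynomial.map_X, Polynomial.map_C,
      Polynomial.eval_sub, Polynomial.eval_pow, Polynomial.eval_X, Polynomial.eval_C] at hr
    linear_combination hr
  have hns : ∀ r : K, r * r ≠ s := by
    intro r hr
    have := Fintype.ofFinite K
    obtain ⟨a, ha⟩ := FiniteField.exists_nonsquare (F := K)
      (fun h => h2 (by rw [← Nat.cast_two, ← h]; exact ringChar.Nat.cast_ringChar))
    have ha0 : a ≠ 0 := by
      rintro rfl
      exact ha (IsSquare.zero)
    obtain ⟨m, rfl⟩ := hs a ha0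
    exact ha (IsSquare.pow m ⟨r, hr.symm⟩)
  have hf0 : f s ≠ 0 := (map_ne_zero f).2 s.ne_zero
  let Φ : GL (Fin 2) K →* Equiv.Perm (OnePoint E) :=
    (MulAction.toPermHom (GL (Fin 2) E) (OnePoint E)).comp (GeneralLinearGroup.map f)
  have hΦ (x : K) : Φ (upperRightHom x) = translation (f x) := by
    change MulAction.toPermHom (GL (Fin 2) E) (OnePoint E) _ = _
    rw [translation]
    congr 1
    ext i j
    fin_cases i <;> fin_cases j <;> simp
  have hmem : translation (f s ^ n / f s) ∈
      (Subgroup.closure {upperRightHom (1 : K), scaledInversion s}).map Φ := by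
    refine translation_pow_mem ?_ f.fieldRange ?_ ⟨s, rfl⟩ hf0 ?_ _ ?_ ?_
      (γ := Φ (scaledInversion s)) ?_ ?_ ?_ ?_ n
    · rw [← map_ofNat f]
      exact (map_ne_zero f).2 h2
    · rintro _ ⟨a, rfl⟩
      by_cases ha : a = 0
      · exact ⟨0, by simp [ha]⟩
      · obtain ⟨m, rfl⟩ := hs a ha
        exact ⟨r ^ m, by rw [← mul_pow, hr, map_pow]⟩
    · rintro _ ⟨a, rfl⟩ h
      rw [← map_mul] at h
      exact hns a (f.injective h)
    · rintro _ ⟨M, -, rfl⟩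
      exact ⟨GeneralLinearGroup.map f M, fun i j => ⟨M i j, rfl⟩, rfl⟩
    · refine ⟨upperRightHom 1, Subgroup.subset_closure (by simp), ?_⟩
      rw [hΦ, map_one]
    · exact ⟨_, Subgroup.subset_closure (by simp), rfl⟩
    · change GeneralLinearGroup.map f (scaledInversion s) • (∞ : OnePoint E) = _
      rw [smul_infty_eq_ite]
      simp [coe_scaledInversion]
    · change GeneralLinearGroup.map f (scaledInversion s) • ((0 : E) : OnePoint E) = _
      rw [smul_some_eq_ite]
      simp [coe_scaledInversion]
    · intro x hx
      change GeneralLinearGroup.map f (scaledInversion s) • (x : OnePoint E) = _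
      rw [smul_some_eq_ite]
      simp [coe_scaledInversion, hx]
  obtain ⟨M, hM, hMb⟩ := hmem
  refine ⟨M, hM, ?_⟩
  have hb' : f s ^ n / f s = f b := by
    rw [← map_pow, hn, map_mul, mul_div_assoc, div_self hf0, mul_one]
  rw [hb', ← hΦ] at hMb
  obtain ⟨c, hc⟩ := exists_scalar_of_toPermHom_map_eq_one f (M⁻¹ * upperRightHom b) (by
    change Φ _ = 1
    rw [map_mul, map_inv, hMb, inv_mul_cancel])
  exact ⟨c, by rw [← hc, mul_inv_cancel_left]⟩

/-- If `s` generates the multiplicative group of a finite field `K` of odd order, then `SL₂(K)` is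
generated by two transvections. -/
theorem closure_lowerUnipotent_upperUnipotent [Finite K] (h2 : (2 : K) ≠ 0) (s : Kˣ)
    (hs : ∀ a : K, a ≠ 0 → ∃ n : ℕ, (s : K) ^ n = a) :
    Subgroup.closure {lowerUnipotent (s : K), upperUnipotent 1} = ⊤ := by
  set H := Subgroup.closure {lowerUnipotent (s : K), upperUnipotent 1} with hH
  set g := scaledInversion s with hg
  set N := H.map SpecialLinearGroup.toGL with hN
  have hN' : N = Subgroup.closure {SpecialLinearGroup.toGL (lowerUnipotent (s : K)),
      SpecialLinearGroup.toGL (upperUnipotent 1)} := by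
    rw [hN, hH, MonoidHom.map_closure, Set.image_pair]
  have hconj : N.map (MulAut.conj g).toMonoidHom = N := by
    rw [hN', MonoidHom.map_closure, Set.image_pair, Set.pair_comm]
    simp only [MulEquiv.toMonoidHom_eq_coe, MonoidHom.coe_coe, MulAut.conj_apply]
    rw [conj_lowerUnipotent, conj_upperUnipotent, mul_one]
  have hnorm : ∀ (n : ℕ), ∀ h ∈ N, g ^ n * h * (g ^ n)⁻¹ ∈ N := by
    intro n
    induction n with
    | zero => simp
    | succ n ih =>
      intro h hh
      have := Subgroup.mem_map_of_mem (MulAut.conj g).toMonoidHom (ih h hh)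
      rw [hconj] at this
      simpa [pow_succ', mul_assoc] using this
  have hclosure : ∀ M ∈ Subgroup.closure {upperRightHom (1 : K), g}, ∃ n : ℕ, ∃ h ∈ N,
      M = g ^ n * h := by
    have hle : Subgroup.zpowers g ≤ Subgroup.normalizer N := by
      rw [Subgroup.zpowers_le, Subgroup.mem_normalizer_iff]
      refine fun h => ⟨fun hh => by simpa using hnorm 1 h hh, fun hh => ?_⟩
      rw [← hconj] at hh
      obtain ⟨h', hh', e⟩ := hh
      rwa [← (MulAut.conj g).injective e]
    intro M hM
    have : M ∈ Subgroup.zpowers g ⊔ N := by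
      refine (Subgroup.closure_le _).2 ?_ hM
      rintro _ (rfl | rfl)
      · refine Subgroup.mem_sup_right (hN' ▸ Subgroup.subset_closure ?_)
        rw [toGL_upperUnipotent]
        simp
      · exact Subgroup.mem_sup_left (Subgroup.mem_zpowers g)
    rw [← SetLike.mem_coe, Subgroup.coe_mul_of_left_le_normalizer_right _ _ hle] at this
    obtain ⟨x, hx, h, hh, rfl⟩ := this
    obtain ⟨n, rfl⟩ := mem_powers_iff_mem_zpowers.2 hx
    exact ⟨n, h, hh, rfl⟩
  have hupper : ∀ b : K, upperUnipotent b ∈ H := by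
    have key : ∀ b : K, upperRightHom (4 * b) ∈ N := by
      intro b
      obtain ⟨M, hM, c, hc⟩ := exists_mul_scalar_eq_upperRightHom h2 s hs b
      obtain ⟨n, h, hh, rfl⟩ := hclosure M hM
      set h₁ := g ^ n * h * (g ^ n)⁻¹ * h with hh₁
      have hh₁N : h₁ ∈ N := N.mul_mem (hnorm n h hh) hh
      have hsq : upperRightHom (2 * b) = GeneralLinearGroup.scalar (Fin 2) (s ^ n * c ^ 2) * h₁ := by
        have hc' := commute_scalar c (g ^ n * h)
        have hs' := commute_scalar (s ^ n) (g ^ n * h * (g ^ n)⁻¹)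
        calc upperRightHom (2 * b) = upperRightHom b * upperRightHom b := by
              rw [two_mul, AddChar.map_add_eq_mul]
          _ = (g ^ n * h * (g ^ n)⁻¹) * (g ^ 2) ^ n * h * GeneralLinearGroup.scalar (Fin 2) c ^ 2 := by
              rw [← hc, hc'.mul_mul_mul_comm, pow_two (GeneralLinearGroup.scalar (Fin 2) c)]
              group
          _ = _ := by
              rw [hg, scaledInversion_sq, ← hg, ← map_pow, ← hs'.eq, mul_assoc _ _ h, ← hh₁,
                mul_assoc, ← map_pow, ← (commute_scalar (c ^ 2) h₁).eq, ← mul_assoc, ← map_mul]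
      have hd : (s ^ n * c ^ 2) ^ 2 = 1 := by
        have h1 : h₁.det = 1 := by
          obtain ⟨m, -, hm⟩ := hh₁N
          rw [← hm]
          ext
          simp
        have h3 := congrArg GeneralLinearGroup.det hsq
        rw [map_mul GeneralLinearGroup.det, h1, mul_one, ← toGL_upperUnipotent] at h3
        ext
        simpa [GeneralLinearGroup.scalar, mul_pow, pow_right_comm] using
          (congrArg Units.val h3).symm
      have h4 : upperRightHom (4 * b) = h₁ ^ 2 := by
        rw [show 4 * b = 2 * b + 2 * b by ring, AddChar.map_add_eq_mul, ← pow_two, hsq,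
          (commute_scalar _ h₁).mul_pow, ← map_pow, hd, map_one, one_mul]
      rw [h4]
      exact N.pow_mem hh₁N 2
    intro b
    have h4 : (4 : K) ≠ 0 := by
      have : (4 : K) = 2 * 2 := by norm_num
      rw [this]; exact mul_ne_zero h2 h2
    have := key (b / 4)
    rw [mul_div_cancel₀ _ h4, ← toGL_upperUnipotent] at this
    exact (Subgroup.mem_map_iff_mem SpecialLinearGroup.toGL_injective).1 this
  refine eq_top_of_unipotent_mem H hupper fun b => ?_
  have := Subgroup.mem_map_of_mem (MulAut.conj g).toMonoidHom
    (Subgroup.mem_map_of_mem SpecialLinearGroup.toGL (hupper (b / s)))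
  rw [hconj] at this
  simp only [MulEquiv.toMonoidHom_eq_coe, MonoidHom.coe_coe, MulAut.conj_apply] at this
  rw [conj_upperUnipotent, mul_div_cancel₀ _ s.ne_zero] at this
  exact (Subgroup.mem_map_iff_mem SpecialLinearGroup.toGL_injective).1 this

end Generation

section Singer

variable {F : Type*} [Field F] [Fintype F] {k : ℕ}

theorem card_adjoin_le (A : Matrix (Fin k) (Fin k) F) :
    Nat.card (Algebra.adjoin F {A}) ≤ Fintype.card F ^ k := by
  have hmem (p : Polynomial F) : Polynomial.aeval A p ∈ Algebra.adjoin F {A} := by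
    rw [Algebra.adjoin_singleton_eq_range_aeval]
    exact ⟨p, rfl⟩
  have hsurj : Function.Surjective
      (fun p : Polynomial.degreeLT F k => (⟨Polynomial.aeval A p.1, hmem p⟩ :
        Algebra.adjoin F {A})) := by
    rintro ⟨B, hB⟩
    rw [Algebra.adjoin_singleton_eq_range_aeval] at hB
    obtain ⟨p, rfl⟩ := hB
    refine ⟨⟨p %ₘ A.charpoly, ?_⟩, Subtype.ext ?_⟩
    · rw [Polynomial.mem_degreeLT]
      refine (Polynomial.degree_modByMonic_lt _ A.charpoly_monic).trans_le ?_
      rw [A.charpoly_degree_eq_dim, Fintype.card_fin]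
    · exact Polynomial.aeval_modByMonic_eq_self_of_root A.aeval_self_charpoly
  have e := (Polynomial.degreeLTEquiv F k).toEquiv
  have := Finite.of_equiv _ e.symm
  refine (Nat.card_le_card_of_surjective _ hsurj).trans ?_
  rw [Nat.card_congr e, Nat.card_fun, Nat.card_eq_fintype_card, Nat.card_fin]

/-- A matrix of order `q ^ k - 1` comes from a generator of the multiplicative group of the field
with `q ^ k` elements. -/
theorem exists_ringHom_apply_eq_of_orderOf (hk : 1 ≤ k) (S : GL (Fin k) F)
    (hS : orderOf S = Fintype.card F ^ k - 1) (L : Type*) [Field L] [Fintype L]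
    (hL : Fintype.card L = Fintype.card F ^ k) :
    ∃ (φ : L →+* Matrix (Fin k) (Fin k) F) (s : Lˣ), φ s = S ∧
      ∀ a : L, a ≠ 0 → ∃ n : ℕ, (s : L) ^ n = a := by
  classical
  have : Nonempty (Fin k) := ⟨⟨0, hk⟩⟩
  set A := Algebra.adjoin F {(S : Matrix (Fin k) (Fin k) F)} with hA
  have hSA : (S : Matrix (Fin k) (Fin k) F) ∈ A := Algebra.self_mem_adjoin_singleton F _
  have := Fintype.ofFinite A
  have hq : 1 < Fintype.card F ^ k := Nat.one_lt_pow (by omega) Fintype.one_lt_card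
  have hcard : Fintype.card A ≤ Fintype.card F ^ k := by
    rw [← Nat.card_eq_fintype_card]
    exact card_adjoin_le _
  let f : Option (Fin (orderOf S)) → A := fun o =>
    o.elim 0 fun i => ⟨(S : Matrix (Fin k) (Fin k) F) ^ (i : ℕ), A.pow_mem hSA _⟩
  have hf : Function.Injective f := by
    have hne (i : ℕ) : (S : Matrix (Fin k) (Fin k) F) ^ i ≠ 0 := by
      rw [← Units.val_pow_eq_pow_val]
      exact Units.ne_zero _
    rintro (_ | i) (_ | j) h
    · rfl
    · exact absurd (congrArg Subtype.val h).symm (hne j)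
    · exact absurd (congrArg Subtype.val h) (hne i)
    · have h' : (S : Matrix (Fin k) (Fin k) F) ^ (i : ℕ) = S ^ (j : ℕ) := congrArg Subtype.val h
      rw [← Units.val_pow_eq_pow_val, ← Units.val_pow_eq_pow_val, Units.val_inj] at h'
      rw [Fin.ext (pow_injOn_Iio_orderOf i.2 j.2 h')]
  have hcardf : Fintype.card (Option (Fin (orderOf S))) = Fintype.card F ^ k := by
    rw [Fintype.card_option, Fintype.card_fin, hS]
    omega
  have hcardA : Fintype.card A = Fintype.card F ^ k :=
    hcard.antisymm (hcardf ▸ Fintype.card_le_of_injective f hf)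
  have hfs : Function.Surjective f :=
    ((Fintype.bijective_iff_injective_and_card f).2 ⟨hf, hcardf.trans hcardA.symm⟩).2
  set S' : A := ⟨S, hSA⟩ with hS'
  have hpow : ∀ a : A, a ≠ 0 → ∃ n : ℕ, n < orderOf S ∧ S' ^ n = a := by
    intro a ha
    obtain ⟨_ | i, rfl⟩ := hfs a
    · exact absurd rfl ha
    · exact ⟨i, i.2, rfl⟩
  have hfield : IsField A :=
    { exists_pair_ne := ⟨0, 1, fun h => zero_ne_one (congrArg Subtype.val h)⟩
      mul_comm := by
        intro a b
        by_cases ha : a = 0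
        · rw [ha, zero_mul, mul_zero]
        by_cases hb : b = 0
        · rw [hb, zero_mul, mul_zero]
        obtain ⟨n, -, rfl⟩ := hpow a ha
        obtain ⟨m, -, rfl⟩ := hpow b hb
        exact (Commute.refl S').pow_pow n m
      mul_inv_cancel := by
        intro a ha
        obtain ⟨n, hn, rfl⟩ := hpow a ha
        refine ⟨S' ^ (orderOf S - n), ?_⟩
        rw [← pow_add, Nat.add_sub_cancel' hn.le]
        apply Subtype.ext
        change (S : Matrix (Fin k) (Fin k) F) ^ orderOf S = 1
        rw [← Units.val_pow_eq_pow_val, pow_orderOf_eq_one, Units.val_one] }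
  let e : L ≃+* A := by
    letI := hfield.toField
    exact FiniteField.ringEquivOfCardEq (hL.trans hcardA.symm)
  have hs0 : e.symm S' ≠ 0 := by
    rw [Ne, map_eq_zero_iff e.symm e.symm.injective]
    exact fun h => S.ne_zero (congrArg Subtype.val h)
  refine ⟨A.val.toRingHom.comp (e : L →+* A), Units.mk0 (e.symm S') hs0, ?_, fun a ha => ?_⟩
  · change ((e (e.symm S') : A) : Matrix (Fin k) (Fin k) F) = S
    rw [e.apply_symm_apply]
  · obtain ⟨n, -, hn⟩ := hpow (e a) ((map_ne_zero_iff e e.injective).2 ha)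
    exact ⟨n, by rw [Units.val_mk0, ← map_pow, hn, e.symm_apply_apply]⟩

end Singer

section BlockMatrices

variable {F : Type*} [Field F] {k : ℕ} {L : Type*} [Field L]

/-- Substitution of `k × k` matrices for the entries of a `2 × 2` matrix. -/
def blockHom (φ : L →+* Matrix (Fin k) (Fin k) F) :
    Matrix (Fin 2) (Fin 2) L →+* Matrix (Fin 2 × Fin k) (Fin 2 × Fin k) F :=
  ((compRingEquiv (Fin 2) (Fin k) F : _ ≃+* _) : _ →+* _).comp φ.mapMatrix

theorem blockHom_apply (φ : L →+* Matrix (Fin k) (Fin k) F) (M : Matrix (Fin 2) (Fin 2) L) :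
    blockHom φ M = blocks2 (M.map φ) := rfl

theorem blockHom_injective [Nonempty (Fin k)] (φ : L →+* Matrix (Fin k) (Fin k) F) :
    Function.Injective (blockHom φ) :=
  (compRingEquiv (Fin 2) (Fin k) F).injective.comp (Matrix.map_injective φ.injective)

theorem blockHom_lowerUnipotent (φ : L →+* Matrix (Fin k) (Fin k) F) (b : L) :
    blockHom φ (lowerUnipotent b).1 = blocks2 !![1, 0; φ b, 1] := by
  rw [blockHom_apply, coe_lowerUnipotent]
  congr 1
  ext i j : 2
  fin_cases i <;> fin_cases j <;> simp

theorem blockHom_upperUnipotent (φ : L →+* Matrix (Fin k) (Fin k) F) :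
    blockHom φ (upperUnipotent 1).1 = blocks2 !![1, 1; 0, 1] := by
  rw [blockHom_apply, coe_upperUnipotent]
  congr 1
  ext i j : 2
  fin_cases i <;> fin_cases j <;> simp

theorem det_blockHom_eq_one [Fintype F] (φ : L →+* Matrix (Fin k) (Fin k) F)
    {M : SpecialLinearGroup (Fin 2) L} (hM : M ^ Fintype.card F = 1) :
    (blockHom φ M.1).det = 1 := by
  rw [← FiniteField.pow_card (blockHom φ M.1).det, ← det_pow, ← map_pow]
  have : M.1 ^ Fintype.card F = 1 := congrArg Subtype.val hM
  rw [this, map_one, det_one]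

end BlockMatrices

theorem stmt6 (p r q k : ℕ) (hp : p.Prime) (hodd : Odd p) (hr : 1 ≤ r) (hq : q = p ^ r)
    (hk : 1 ≤ k) (h9 : q ^ k ≠ 9)
    (F : Type) [Field F] [Fintype F] (hF : Fintype.card F = q)
    (S : GL (Fin k) F) (hS : orderOf S = q ^ k - 1) :
    ∀ (L : Type) [Field L] [Fintype L], Fintype.card L = q ^ k →
      Nonempty
        ((Subgroup.closure {g : Matrix.SpecialLinearGroup (Fin 2 × Fin k) F |
            (g : Matrix (Fin 2 × Fin k) (Fin 2 × Fin k) F)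
              = blocks2 !![1, 0; (S : Matrix (Fin k) (Fin k) F), 1] ∨
            (g : Matrix (Fin 2 × Fin k) (Fin 2 × Fin k) F) = blocks2 !![1, 1; 0, 1]})
          ≃* Matrix.SpecialLinearGroup (Fin 2) L) := by
  intro L _ _ hL
  subst hF
  obtain ⟨φ, s, hφ, hs⟩ := exists_ringHom_apply_eq_of_orderOf hk S hS L hL
  have : Nonempty (Fin k) := ⟨⟨0, hk⟩⟩
  have hcast : ((Fintype.card F : ℕ) : L) = 0 := by
    have := Nat.cast_card_eq_zero L
    rw [hL, Nat.cast_pow] at this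
    exact eq_zero_of_pow_eq_zero this
  have h2 : (2 : L) ≠ 0 := by
    apply Ring.two_ne_zero
    rw [Ne, FiniteField.even_card_iff_char_two, hL, hq, ← pow_mul]
    have := (hodd.pow (n := r * k))
    rw [Nat.odd_iff] at this
    omega
  have htop := closure_lowerUnipotent_upperUnipotent h2 s hs
  have hdet : ∀ M : SpecialLinearGroup (Fin 2) L, (blockHom φ M.1).det = 1 := by
    let χ : SpecialLinearGroup (Fin 2) L →* F :=
      Matrix.detMonoidHom.comp
        ((blockHom φ).toMonoidHom.comp SpecialLinearGroup.coeMonoidHom)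
    have hle : (⊤ : Subgroup (SpecialLinearGroup (Fin 2) L)) ≤ χ.ker := by
      rw [← htop, Subgroup.closure_le]
      rintro _ (rfl | rfl)
      · refine det_blockHom_eq_one φ ?_
        rw [lowerUnipotent_pow, hcast, zero_mul]
        ext i j
        fin_cases i <;> fin_cases j <;> simp [coe_lowerUnipotent]
      · refine det_blockHom_eq_one φ ?_
        rw [upperUnipotent_pow, hcast, zero_mul]
        ext i j
        fin_cases i <;> fin_cases j <;> simp [coe_upperUnipotent]
    exact fun M => hle (Subgroup.mem_top M)
  let Ψ : SpecialLinearGroup (Fin 2) L →* SpecialLinearGroup (Fin 2 × Fin k) F :=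
    { toFun := fun M => ⟨blockHom φ M.1, hdet M⟩
      map_one' := Subtype.ext (map_one (blockHom φ))
      map_mul' := fun M N => Subtype.ext (map_mul (blockHom φ) M.1 N.1) }
  have hΨ : Function.Injective Ψ := fun M N h =>
    Subtype.ext (blockHom_injective φ (congrArg Subtype.val h))
  have hrange : Ψ.range = Subgroup.closure {g : Matrix.SpecialLinearGroup (Fin 2 × Fin k) F |
      (g : Matrix (Fin 2 × Fin k) (Fin 2 × Fin k) F)
        = blocks2 !![1, 0; (S : Matrix (Fin k) (Fin k) F), 1] ∨
      (g : Matrix (Fin 2 × Fin k) (Fin 2 × Fin k) F) = blocks2 !![1, 1; 0, 1]} := by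
    rw [MonoidHom.range_eq_map, ← htop, MonoidHom.map_closure, Set.image_pair]
    congr 1
    ext g
    have h1 : (Ψ (lowerUnipotent (s : L))).1 = blocks2 !![1, 0; S.1, 1] := by
      rw [← hφ]
      exact blockHom_lowerUnipotent φ s
    have h2 : (Ψ (upperUnipotent 1)).1 = blocks2 !![1, 1; 0, 1] := blockHom_upperUnipotent φ
    simp only [Set.mem_insert_iff, Set.mem_singleton_iff, Set.mem_ofPred_eq]
    rw [← h1, ← h2]
    exact or_congr Subtype.ext_iff Subtype.ext_iff
  exact ⟨((MonoidHom.ofInjective hΨ).trans (MulEquiv.subgroupCongr hrange)).symm⟩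
end
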